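/- Let n ≥ 2 be an integer, let Γ ∈ 𝒰, let K be a homogeneous Calderón–Zygmund kernel on ℝ^n, and for j, l ∈ ℤ and u ∈ ℝ define T_{j,l}[u]f(x) := ∫_{ℝ^n} f(x−t) (e^{i2^j u Γ(|t|)} − 1) ψ_{l+j_*}(t) K(t) dt, where j_* := sup{ m ∈ ℤ : 2^j Γ(2^m) ≤ 1 }. If p ∈ (1,∞) and r ∈ [2,∞), then there exist constants ε > 0 and C such that for every integer l ≤ 0 and every Schwartz function f on ℝ^n one has ‖ ( ∑_{j∈ℤ} ‖ u ↦ χ(u) T_{j,l}[u]f(x) ‖_{B_{r,1}^{1/r}(ℝ)}^r )^{1/r} ‖_{L^p(ℝ^n, dx)} ≤ C · 2^{εl} ‖f‖_{L^p(ℝ^n)}, with ε, C independent of l. -/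

import Mathlib

open MeasureTheory Filter Set
open scoped ENNReal NNReal FourierTransform Topology

noncomputable section

/-- `ℝⁿ` as a Euclidean space. -/
abbrev Rn (n : ℕ) := EuclideanSpace ℝ (Fin n)

/-- The class `𝒰` of phase functions: `Γ` is continuous on `[0,∞)`, smooth on `(0,∞)`,
`Γ(0) = 0`, `Γ′ > 0` on `(0,∞)`, with the bounds `c_{1,j} ≤ |s^j Γ^{(j)}(s)/Γ(s)|` for
`j = 1, 2` and `|s^j Γ^{(j)}(s)/Γ(s)| ≤ c_{2,j}` for all `j ≥ 1`. -/
structure IsGammaU (Γ : ℝ → ℝ) : Prop where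
  continuousOn : ContinuousOn Γ (Set.Ici 0)
  smooth : ContDiffOn ℝ (⊤ : ℕ∞) Γ (Set.Ioi 0)
  map_zero : Γ 0 = 0
  deriv_pos : ∀ s > (0 : ℝ), 0 < deriv Γ s
  lower : ∀ j ∈ ({1, 2} : Set ℕ), ∃ c > (0 : ℝ), ∀ s > (0 : ℝ),
    c ≤ |s ^ j * iteratedDeriv j Γ s / Γ s|
  upper : ∀ j : ℕ, 1 ≤ j → ∃ c > (0 : ℝ), ∀ s > (0 : ℝ),
    |s ^ j * iteratedDeriv j Γ s / Γ s| ≤ c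

/-- `K` is a homogeneous Calderón–Zygmund kernel on `ℝⁿ`: `K(t) = Ω(t)/‖t‖ⁿ` with `Ω` smooth
away from the origin, homogeneous of degree `0`, and of mean value zero on the unit sphere. -/
def IsHomCZKernel (n : ℕ) (K : Rn n → ℝ) : Prop :=
  ∃ Ω : Rn n → ℝ,
    ContDiffOn ℝ (⊤ : ℕ∞) Ω {x : Rn n | x ≠ 0} ∧
    (∀ c : ℝ, 0 < c → ∀ t : Rn n, Ω (c • t) = Ω t) ∧
    (∫ θ : Metric.sphere (0 : Rn n) 1, Ω θ ∂((volume : Measure (Rn n)).toSphere) = 0) ∧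
    (∀ t : Rn n, t ≠ 0 → K t = Ω t / ‖t‖ ^ n)

/-- The `r`-variation of a family `(a_u)_{u ∈ 𝒦}`. -/
def variation {ι : Type*} [LinearOrder ι] (r : ℝ) (𝒦 : Set ι) (a : ι → ℂ) : ℝ≥0∞ :=
  ⨆ (J : ℕ) (u : Fin (J + 1) → ι) (_ : StrictMono u) (_ : ∀ i, u i ∈ 𝒦),
    (∑ i : Fin J, (‖a (u i.succ) - a (u i.castSucc)‖₊ : ℝ≥0∞) ^ r) ^ (1 / r)

/-- The `λ`-jump counting function of a family `(a_u)_{u ∈ 𝒦}`. -/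
def jumpCount {ι : Type*} [LinearOrder ι] (lam : ℝ) (𝒦 : Set ι) (a : ι → ℂ) : ℝ≥0∞ :=
  ⨆ (J : ℕ) (s : Fin J → ι) (t : Fin J → ι) (_ : ∀ i, s i ∈ 𝒦) (_ : ∀ i, t i ∈ 𝒦)
    (_ : ∀ i, s i < t i) (_ : ∀ i j : Fin J, i < j → t i < s j)
    (_ : ∀ i, lam < ‖a (t i) - a (s i)‖), (J : ℝ≥0∞)

/-- The `L^p` norm of an `ℝ≥0∞`-valued function. -/
def lpNormENN {α : Type*} [MeasurableSpace α] (p : ℝ) (g : α → ℝ≥0∞) (μ : Measure α) : ℝ≥0∞ :=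
  (∫⁻ x, g x ^ p ∂μ) ^ (1 / p)

/-- The fixed Littlewood–Paley cutoff `ψ : ℝ → [0,1]`, supported in `{1/2 ≤ |s| ≤ 2}`,
with `∑_{l ∈ ℤ} ψ(2^{-l} s) = 1` for `s ≠ 0`. -/
def IsLPCutoff (ψ : ℝ → ℝ) : Prop :=
  ContDiff ℝ (⊤ : ℕ∞) ψ ∧ (∀ s, ψ s ∈ Set.Icc (0 : ℝ) 1) ∧
    (∀ s, ψ s ≠ 0 → |s| ∈ Set.Icc (1/2 : ℝ) 2) ∧
    (∀ s : ℝ, s ≠ 0 → HasSum (fun l : ℤ => ψ ((2 : ℝ) ^ (-l) * s)) 1)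

/-- `k_* = sup{ m ∈ ℤ : 2^k Γ(2^m) ≤ 1 }`. -/
def kstar (Γ : ℝ → ℝ) (k : ℤ) : ℤ :=
  sSup {m : ℤ | (2 : ℝ) ^ k * Γ ((2 : ℝ) ^ m) ≤ 1}

/-- The fixed cutoff `χ : ℝ → [0,1]`, supported in `[1/2, 4]` and equal to `1` on `[1,2]`. -/
def IsChiCutoff (χ : ℝ → ℝ) : Prop :=
  ContDiff ℝ (⊤ : ℕ∞) χ ∧ (∀ u, χ u ∈ Set.Icc (0 : ℝ) 1) ∧
    (∀ u, χ u ≠ 0 → u ∈ Set.Icc (1/2 : ℝ) 4) ∧ (∀ u ∈ Set.Icc (1 : ℝ) 2, χ u = 1)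

/-- The Littlewood–Paley piece `Δ_i g` (`i ≥ 0`) on `ℝ`. -/
def deltaHigh (ψ : ℝ → ℝ) (i : ℕ) (g : ℝ → ℂ) : ℝ → ℂ :=
  𝓕⁻ fun τ : ℝ => Complex.ofReal (ψ ((2 : ℝ) ^ (-(i : ℤ)) * |τ|)) * 𝓕 g τ

/-- The low-frequency piece `Δ_{-1} g` on `ℝ`. -/
def deltaLow (ψ : ℝ → ℝ) (g : ℝ → ℂ) : ℝ → ℂ :=
  𝓕⁻ fun τ : ℝ => Complex.ofReal (1 - ∑' i : ℕ, ψ ((2 : ℝ) ^ (-(i : ℤ)) * |τ|)) * 𝓕 g τ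

/-- The Besov norm `‖g‖_{B_{r,1}^{1/r}(ℝ)} = ‖Δ_{-1}g‖_{L^r} + ∑_{i≥0} 2^{i/r} ‖Δ_i g‖_{L^r}`. -/
def besovNorm (ψ : ℝ → ℝ) (r : ℝ) (g : ℝ → ℂ) : ℝ≥0∞ :=
  eLpNorm (deltaLow ψ g) (ENNReal.ofReal r) volume +
    ∑' i : ℕ, ENNReal.ofReal ((2 : ℝ) ^ ((i : ℝ) / r)) *
      eLpNorm (deltaHigh ψ i g) (ENNReal.ofReal r) volume

/-- The operator `T_{j,l}[u]`. -/
def Tjl {n : ℕ} (Γ : ℝ → ℝ) (K : Rn n → ℝ) (ψ : ℝ → ℝ) (j l : ℤ) (u : ℝ)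
    (f : Rn n → ℂ) (x : Rn n) : ℂ :=
  ∫ t : Rn n, f (x - t) *
    (Complex.exp (Complex.I * Complex.ofReal ((2 : ℝ) ^ j * u * Γ ‖t‖)) - 1) *
      Complex.ofReal (ψ ((2 : ℝ) ^ (-(l + kstar Γ j)) * ‖t‖) * K t)

/-- Plancherel's theorem for integrable and square integrable functions. -/
theorem eLpNorm_fourier_of_integrable {V F : Type*} [NormedAddCommGroup V] [InnerProductSpace ℝ V]
    [FiniteDimensional ℝ V] [MeasurableSpace V] [BorelSpace V] [NormedAddCommGroup F]
    [InnerProductSpace ℂ F] [CompleteSpace F] {f : V → F} (hf : Integrable f)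
    (hf2 : MemLp f 2 volume) :
    eLpNorm (𝓕 f) 2 volume = eLpNorm f 2 volume := by
  set f2 : Lp (α := V) F 2 volume := hf2.toLp f
  have hcont : Continuous (𝓕 f) := VectorFourier.fourierIntegral_continuous
    Real.continuous_fourierChar (innerSL ℝ).continuous₂ hf
  have key : ((𝓕 f2 : Lp (α := V) F 2 volume) : V → F) =ᵐ[volume] 𝓕 f := by
    refine ae_eq_of_integral_contDiff_smul_eq ?_ hcont.locallyIntegrable ?_
    · exact ((Lp.memLp (𝓕 f2)).locallyIntegrable (by norm_num))
    intro g hg hgs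
    have hgs' : HasCompactSupport (fun x => (g x : ℂ)) := hgs.comp_left Complex.ofReal_zero
    set φ : SchwartzMap V ℂ := hgs'.toSchwartzMap (Complex.ofRealCLM.contDiff.comp hg)
    have h1 := Lp.fourier_toTemperedDistribution_eq f2
    have h2 := congrArg (fun D => D φ) h1
    simp only [TemperedDistribution.fourier_apply, Lp.toTemperedDistribution_apply] at h2
    have h3 : ∫ x, (𝓕 φ : SchwartzMap V ℂ) x • (f2 : V → F) x = ∫ x, (𝓕 φ : SchwartzMap V ℂ) x • f x := by
      refine integral_congr_ae ?_
      filter_upwards [hf2.coeFn_toLp] with x hx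
      rw [hx]
    rw [h3] at h2
    have h4 := VectorFourier.integral_fourierIntegral_smul_eq_flip (μ := volume) (ν := volume)
      (L := innerₗ V) Real.continuous_fourierChar continuous_inner φ.integrable hf
    have h5 : ∀ (x : V) (y : F), g x • y = φ x • y := fun x y => (Complex.coe_smul (g x) y).symm
    simp_rw [h5]
    rw [← h2]
    simpa using! h4
  rw [← eLpNorm_congr_ae key]
  have := Lp.norm_fourier_eq f2
  have h7 : ‖f2‖ₑ = eLpNorm f 2 volume := Lp.enorm_toLp hf2
  rw [← h7, ← Lp.enorm_def]
  rw [← ofReal_norm, this, ofReal_norm]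

section CalderonZygmund

variable {V E F : Type*} [NormedAddCommGroup V] [InnerProductSpace ℝ V]
    [FiniteDimensional ℝ V] [MeasurableSpace V] [BorelSpace V]
    [NormedAddCommGroup E] [InnerProductSpace ℂ E]
    [NormedAddCommGroup F] [InnerProductSpace ℂ F]

/-- Convolution of an operator valued kernel with a vector valued function. -/
def clmConv (k : V → E →L[ℂ] F) (f : V → E) (x : V) : F := ∫ t, k t (f (x - t))

theorem clmConv_eq_convolution (k : V → E →L[ℂ] F) (f : V → E) :
    clmConv k f = convolution k f (ContinuousLinearMap.id ℂ (E →L[ℂ] F)) volume := rfl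

theorem clmConv_eq_integral_sub (k : V → E →L[ℂ] F) (f : V → E) (x : V) :
    clmConv k f x = ∫ y, k (x - y) (f y) := by
  rw [clmConv_eq_convolution, convolution_eq_swap]
  rfl

theorem continuous_clmConv {k : V → E →L[ℂ] F} (hk : Continuous k) (hkc : HasCompactSupport k)
    {f : V → E} (hf : Integrable f) : Continuous (clmConv k f) :=
  hkc.continuous_convolution_left (ContinuousLinearMap.id ℂ (E →L[ℂ] F)) hk hf.locallyIntegrable

theorem integrable_clmConv {k : V → E →L[ℂ] F} (hk : Continuous k) (hkc : HasCompactSupport k)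
    {f : V → E} (hf : Integrable f) : Integrable (clmConv k f) :=
  (hk.integrable_of_hasCompactSupport hkc).integrable_convolution
    (ContinuousLinearMap.id ℂ (E →L[ℂ] F)) hf

theorem integrable_clm_sub_apply {k : V → E →L[ℂ] F} (hk : Continuous k)
    (hkc : HasCompactSupport k) {f : V → E} (hf : Integrable f) (x : V) :
    Integrable fun y => k (x - y) (f y) := by
  obtain ⟨M, hM⟩ := hk.bounded_above_of_compact_support hkc
  refine (hf.norm.const_mul M).mono' ?_ (ae_of_all _ fun y => ?_)
  · exact (ContinuousLinearMap.id ℂ (E →L[ℂ] F)).aestronglyMeasurable_comp₂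
      (hk.comp (by fun_prop)).aestronglyMeasurable hf.1
  · exact (ContinuousLinearMap.le_opNorm _ _).trans
      (mul_le_mul_of_nonneg_right (hM _) (norm_nonneg _))

theorem exists_norm_clmConv_le {k : V → E →L[ℂ] F} (hk : Continuous k)
    (hkc : HasCompactSupport k) {f : V → E} (hf : Integrable f) :
    ∃ M : ℝ, ∀ x, ‖clmConv k f x‖ ≤ M := by
  obtain ⟨M, hM⟩ := hk.bounded_above_of_compact_support hkc
  refine ⟨M * ∫ y, ‖f y‖, fun x => ?_⟩
  rw [clmConv_eq_integral_sub, ← integral_const_mul]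
  refine norm_integral_le_of_norm_le (hf.norm.const_mul M) (ae_of_all _ fun y => ?_)
  exact (ContinuousLinearMap.le_opNorm _ _).trans
      (mul_le_mul_of_nonneg_right (hM _) (norm_nonneg _))

theorem memLp_of_integrable_of_bound {α G : Type*} [MeasurableSpace α] {μ : Measure α}
    [NormedAddCommGroup G] {f : α → G} (hf : Integrable f μ) {M : ℝ} (hM : ∀ x, ‖f x‖ ≤ M)
    {p : ℝ} (hp : 1 ≤ p) : MemLp f (ENNReal.ofReal p) μ := by
  have hp0 : ENNReal.ofReal p ≠ 0 := by simp; linarith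
  rw [← integrable_norm_rpow_iff hf.1 hp0 ENNReal.ofReal_ne_top,
    ENNReal.toReal_ofReal (by linarith)]
  refine (hf.norm.const_mul (|M| ^ (p - 1))).mono' ?_ (ae_of_all _ fun x => ?_)
  · exact (hf.1.norm.aemeasurable.pow_const p).aestronglyMeasurable
  · rw [Real.norm_of_nonneg (by positivity)]
    rcases (norm_nonneg (f x)).eq_or_lt with h | h
    · rw [← h, Real.zero_rpow (by linarith), mul_zero]
    · calc ‖f x‖ ^ p = ‖f x‖ ^ (p - 1) * ‖f x‖ := by
            rw [← Real.rpow_add_one h.ne']; congr 1; ring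
        _ ≤ _ := by
            refine mul_le_mul_of_nonneg_right (Real.rpow_le_rpow h.le ?_ (by linarith)) h.le
            exact (hM x).trans (le_abs_self M)

theorem eLpNorm_two_clmConv_le [CompleteSpace E] [CompleteSpace F] {k : V → E →L[ℂ] F} (hk : Continuous k)
    (hkc : HasCompactSupport k) (hk1 : ∀ ξ, ‖𝓕 k ξ‖ ≤ 1) {f : V → E} (hf : Integrable f)
    (hf2 : MemLp f 2 volume) :
    eLpNorm (clmConv k f) 2 volume ≤ eLpNorm f 2 volume := by
  have hi := integrable_clmConv hk hkc hf
  obtain ⟨M, hM⟩ := exists_norm_clmConv_le hk hkc hf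
  have hi2 : MemLp (clmConv k f) 2 volume := by
    simpa using memLp_of_integrable_of_bound hi hM (p := 2) (by norm_num)
  rw [← eLpNorm_fourier_of_integrable hi hi2,
    ← eLpNorm_fourier_of_integrable hf hf2]
  refine eLpNorm_mono fun ξ => ?_
  rw [clmConv_eq_convolution, Real.fourier_bilin_convolution_eq _
    (hk.integrable_of_hasCompactSupport hkc) hf]
  refine (ContinuousLinearMap.le_opNorm _ _).trans ?_
  exact mul_le_of_le_one_left (norm_nonneg _) (hk1 ξ)

end CalderonZygmund

section CalderonZygmund

variable {V E F : Type*} [NormedAddCommGroup V] [InnerProductSpace ℝ V]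
    [FiniteDimensional ℝ V] [MeasurableSpace V] [BorelSpace V]
    [NormedAddCommGroup E] [InnerProductSpace ℂ E] [NormedAddCommGroup F] [InnerProductSpace ℂ F]

theorem setLIntegral_enorm_sub_le_of_hormander {G : Type*} [NormedAddCommGroup G] {k : V → G}
    {B : ℝ≥0∞} (hk2 : ∀ y, ∫⁻ x in {x | 2 * ‖y‖ ≤ ‖x‖}, ‖k (x - y) - k x‖ₑ ≤ B)
    {c y : V} {ρ : ℝ} (hy : ‖y - c‖ ≤ ρ) :
    ∫⁻ x in (Metric.closedBall c (2 * ρ))ᶜ, ‖k (x - y) - k (x - c)‖ₑ ≤ B := by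
  refine le_trans ?_ (hk2 (y - c))
  have h := (measurePreserving_sub_right (volume : Measure V) c).setLIntegral_comp_preimage_emb
    (MeasurableEquiv.subRight c).measurableEmbedding
    (fun z => ‖k (z - (y - c)) - k z‖ₑ) {x | 2 * ‖y - c‖ ≤ ‖x‖}
  rw [← h]
  simp only [sub_sub_sub_cancel_right]
  refine lintegral_mono_set fun x hx => ?_
  simp only [mem_compl_iff, Metric.mem_closedBall, not_le, dist_eq_norm] at hx
  simp only [mem_preimage, mem_ofPred_eq]
  linarith

theorem clmConv_sub {k : V → E →L[ℂ] F} (hk : Continuous k)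
    (hkc : HasCompactSupport k) {f g : V → E} (hf : Integrable f) (hg : Integrable g) (x : V) :
    clmConv k (fun y => f y - g y) x = clmConv k f x - clmConv k g x := by
  simp only [clmConv_eq_integral_sub, map_sub]
  exact integral_sub (integrable_clm_sub_apply hk hkc hf x) (integrable_clm_sub_apply hk hkc hg x)

/-- Away from the doubled cells, the convolution of a kernel satisfying Hörmander's condition with
a function of mean value zero on every cell is controlled in `L¹`. -/
theorem lintegral_clmConv_le_of_cells [CompleteSpace E] [CompleteSpace F]
    {ι : Type*} [Countable ι] {k : V → E →L[ℂ] F} (hk : Continuous k) (hkc : HasCompactSupport k)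
    {B : ℝ≥0∞} (hk2 : ∀ y, ∫⁻ x in {x | 2 * ‖y‖ ≤ ‖x‖}, ‖k (x - y) - k x‖ₑ ≤ B)
    {Q : ι → Set V} {c : ι → V} {ρ : ι → ℝ} (hQm : ∀ s, MeasurableSet (Q s))
    (hdisj : Pairwise (Function.onFun Disjoint Q))
    (hQsub : ∀ s, Q s ⊆ Metric.closedBall (c s) (ρ s)) {b : V → E} (hb : Integrable b)
    (hb0 : ∀ x ∉ ⋃ s, Q s, b x = 0) (hbQ : ∀ s, ∫ x in Q s, b x = 0) :
    ∫⁻ x in (⋃ s, Metric.closedBall (c s) (2 * ρ s))ᶜ, ‖clmConv k b x‖ₑ ≤ B * ∫⁻ x, ‖b x‖ₑ := by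
  set W := (⋃ s, Metric.closedBall (c s) (2 * ρ s))ᶜ
  have hUm : MeasurableSet (⋃ s, Q s) := MeasurableSet.iUnion hQm
  have hpt : ∀ x, ‖clmConv k b x‖ₑ ≤
      ∑' s, ∫⁻ y in Q s, ‖k (x - y) - k (x - c s)‖ₑ * ‖b y‖ₑ := by
    intro x
    have hi := integrable_clm_sub_apply hk hkc hb x
    have h1 : clmConv k b x = ∑' s, ∫ y in Q s, k (x - y) (b y) := by
      rw [clmConv_eq_integral_sub, ← integral_iUnion hQm hdisj hi.integrableOn,
        setIntegral_eq_integral_of_forall_compl_eq_zero]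
      intro y hy
      rw [hb0 y hy, map_zero]
    rw [h1]
    refine (enorm_tsum_le_tsum_enorm).trans (ENNReal.tsum_le_tsum fun s => ?_)
    have h2 : ∫ y in Q s, k (x - y) (b y) = ∫ y in Q s, (k (x - y) - k (x - c s)) (b y) := by
      have h3 : ∫ y in Q s, k (x - c s) (b y) = 0 := by
        rw [ContinuousLinearMap.integral_comp_comm _ hb.integrableOn, hbQ, map_zero]
      simp only [sub_apply]
      rw [integral_sub hi.integrableOn ((k (x - c s)).integrable_comp hb.integrableOn), h3,
        sub_zero]
    rw [h2]
    refine (enorm_integral_le_lintegral_enorm _).trans (lintegral_mono fun y => ?_)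
    exact ContinuousLinearMap.le_opENorm _ _
  have hmeas : ∀ s, AEMeasurable (Function.uncurry fun x y : V =>
      ‖k (x - y) - k (x - c s)‖ₑ * ‖b y‖ₑ)
        ((volume.restrict W).prod (volume.restrict (Q s))) := by
    intro s
    have h1 : Continuous fun z : V × V => ‖k (z.1 - z.2) - k (z.1 - c s)‖ₑ := by fun_prop
    have h2 : AEMeasurable (fun z : V × V => ‖b z.2‖ₑ)
        ((volume.restrict W).prod (volume.restrict (Q s))) := hb.1.restrict.enorm.comp_snd
    exact h1.aemeasurable.mul h2
  calc ∫⁻ x in W, ‖clmConv k b x‖ₑ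
      ≤ ∫⁻ x in W, ∑' s, ∫⁻ y in Q s, ‖k (x - y) - k (x - c s)‖ₑ * ‖b y‖ₑ :=
        lintegral_mono fun x => hpt x
    _ = ∑' s, ∫⁻ x in W, ∫⁻ y in Q s, ‖k (x - y) - k (x - c s)‖ₑ * ‖b y‖ₑ :=
        lintegral_tsum fun s => (hmeas s).lintegral_prod_right'
    _ = ∑' s, ∫⁻ y in Q s, ∫⁻ x in W, ‖k (x - y) - k (x - c s)‖ₑ * ‖b y‖ₑ := by
        congr 1; ext s
        exact lintegral_lintegral_swap (hmeas s)
    _ ≤ ∑' s, ∫⁻ y in Q s, B * ‖b y‖ₑ := by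
        refine ENNReal.tsum_le_tsum fun s => setLIntegral_mono' (hQm s) fun y hy => ?_
        have h1 : Continuous fun x : V => ‖k (x - y) - k (x - c s)‖ₑ := by fun_prop
        rw [lintegral_mul_const'' _ h1.aemeasurable]
        gcongr
        refine le_trans (lintegral_mono_set ?_)
          (setLIntegral_enorm_sub_le_of_hormander hk2 (ρ := ρ s) (c := c s) ?_)
        · exact compl_subset_compl.2 (subset_iUnion_of_subset s subset_rfl)
        · simpa [dist_eq_norm] using hQsub s hy
    _ = B * ∑' s, ∫⁻ y in Q s, ‖b y‖ₑ := by
        rw [← ENNReal.tsum_mul_left]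
        congr 1; ext s
        exact lintegral_const_mul'' _ hb.1.restrict.enorm
    _ ≤ _ := by
        gcongr
        rw [← lintegral_iUnion hQm hdisj]
        exact setLIntegral_le_lintegral _ _

end CalderonZygmund

section CalderonZygmund

variable {V E F : Type*} [NormedAddCommGroup V] [InnerProductSpace ℝ V]
    [FiniteDimensional ℝ V] [MeasurableSpace V] [BorelSpace V]
    [NormedAddCommGroup E] [InnerProductSpace ℂ E] [NormedAddCommGroup F] [InnerProductSpace ℂ F]

/-- Replacing a function by its averages on countably many disjoint cells. -/
theorem exists_cell_average [CompleteSpace E] {ι : Type*} [Countable ι] {Q : ι → Set V}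
    (hQm : ∀ s, MeasurableSet (Q s)) (hdisj : Pairwise (Function.onFun Disjoint Q))
    (hQfin : ∀ s, volume (Q s) ≠ ∞) (hQ0 : ∀ s, volume (Q s) ≠ 0)
    {f : V → E} (hf : Integrable f) {M : ℝ} (hM : ∀ x, ‖f x‖ ≤ M) {N L : ℝ≥0∞}
    (hN : ∀ s, ∫⁻ x in Q s, ‖f x‖ₑ ≤ N * L * volume (Q s)) :
    ∃ g : V → E, Integrable g ∧ MemLp g 2 volume ∧ (∀ x ∉ ⋃ s, Q s, g x = f x) ∧
      (∀ s, ∀ x ∈ Q s, ‖g x‖ₑ ≤ N * L) ∧ (∀ s, ∫ x in Q s, (f x - g x) = 0) := by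
  classical
  set a : ι → E := fun s => ⨍ x in Q s, f x
  set g : V → E := fun x => if h : ∃ s, x ∈ Q s then a h.choose else f x
  have hgQ : ∀ s, ∀ x ∈ Q s, g x = a s := by
    intro s x hx
    have h : ∃ s, x ∈ Q s := ⟨s, hx⟩
    have h1 : h.choose = s := by
      by_contra hne
      exact Set.disjoint_left.1 (hdisj hne) h.choose_spec hx
    simp only [g, dif_pos h, h1]
  have hgo : ∀ x ∉ ⋃ s, Q s, g x = f x := by
    intro x hx
    have : ¬ ∃ s, x ∈ Q s := by simpa using hx
    simp only [g, dif_neg this]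
  have ha : ∀ s, ‖a s‖ₑ * volume (Q s) ≤ ∫⁻ x in Q s, ‖f x‖ₑ := by
    intro s
    have h1 : (volume.real (Q s)) • a s = ∫ x in Q s, f x := measure_smul_setAverage f (hQfin s)
    calc ‖a s‖ₑ * volume (Q s) = ‖(volume.real (Q s)) • a s‖ₑ := by
          rw [enorm_smul, mul_comm, Real.enorm_of_nonneg measureReal_nonneg,
            ofReal_measureReal (hQfin s)]
      _ ≤ _ := by
          rw [h1]
          exact enorm_integral_le_lintegral_enorm _
  have haM : ∀ s, ‖a s‖ ≤ M := by
    intro s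
    have : Fact (volume (Q s) < ∞) := ⟨(hQfin s).lt_top⟩
    have h1 : ‖∫ x in Q s, f x‖ ≤ M * volume.real (Q s) :=
      norm_setIntegral_le_of_norm_le_const (hQfin s).lt_top fun x _ => hM x
    have h2 : 0 < volume.real (Q s) := ENNReal.toReal_pos (hQ0 s) (hQfin s)
    have h3 : (volume.real (Q s)) • a s = ∫ x in Q s, f x := measure_smul_setAverage f (hQfin s)
    rw [← h3, norm_smul, Real.norm_of_nonneg h2.le, mul_comm] at h1
    exact le_of_mul_le_mul_right h1 h2
  have hgM : ∀ x, ‖g x‖ ≤ M := by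
    intro x
    by_cases hx : x ∈ ⋃ s, Q s
    · obtain ⟨s, hs⟩ := mem_iUnion.1 hx
      rw [hgQ s x hs]
      exact haM s
    · rw [hgo x hx]
      exact hM x
  have hUm : MeasurableSet (⋃ s, Q s) := MeasurableSet.iUnion hQm
  have hgm : AEStronglyMeasurable g volume := by
    have h1 : AEStronglyMeasurable g (volume.restrict (⋃ s, Q s)) := by
      refine aestronglyMeasurable_iUnion_iff.2 fun s => ?_
      refine (aestronglyMeasurable_const (b := a s)).congr ?_
      filter_upwards [ae_restrict_mem (hQm s)] with x hx
      rw [hgQ s x hx]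
    have h2 : AEStronglyMeasurable g (volume.restrict (⋃ s, Q s)ᶜ) := by
      refine hf.1.restrict.congr ?_
      filter_upwards [ae_restrict_mem hUm.compl] with x hx
      rw [hgo x hx]
    rw [← Measure.restrict_univ (μ := (volume : Measure V)), ← union_compl_self (⋃ s, Q s)]
    exact aestronglyMeasurable_union_iff.2 ⟨h1, h2⟩
  have hgi : Integrable g := by
    refine ⟨hgm, ?_⟩
    rw [hasFiniteIntegral_iff_enorm]
    refine lt_of_le_of_lt ?_ hf.2
    rw [← lintegral_add_compl _ hUm, ← lintegral_add_compl (fun x => ‖f x‖ₑ) hUm]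
    refine add_le_add ?_ (le_of_eq ?_)
    · rw [lintegral_iUnion hQm hdisj, lintegral_iUnion hQm hdisj]
      refine ENNReal.tsum_le_tsum fun s => ?_
      rw [setLIntegral_congr_fun (g := fun _ => ‖a s‖ₑ) (hQm s)
        (fun x hx => by rw [hgQ s x hx]), setLIntegral_const]
      exact ha s
    · exact setLIntegral_congr_fun hUm.compl (fun x hx => by rw [hgo x hx])
  refine ⟨g, hgi, ?_, hgo, ?_, ?_⟩
  · simpa using memLp_of_integrable_of_bound hgi hgM (p := 2) (by norm_num)
  · intro s x hx
    rw [hgQ s x hx]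
    have h1 := (ha s).trans (hN s)
    exact (ENNReal.mul_le_mul_iff_left (hQ0 s) (hQfin s)).1 h1
  · intro s
    rw [integral_sub hf.integrableOn hgi.integrableOn,
      setIntegral_congr_fun (g := fun _ => a s) (hQm s) (fun x hx => hgQ s x hx),
      setIntegral_const, ← measure_smul_setAverage f (hQfin s), sub_self]

/-- The weak type estimate obtained from a covering of the set where `f` is large. -/
theorem measure_lt_clmConv_le_of_cells [CompleteSpace E] [CompleteSpace F]
    {ι : Type*} [Countable ι] {k : V → E →L[ℂ] F} (hk : Continuous k) (hkc : HasCompactSupport k)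
    (hk1 : ∀ ξ, ‖𝓕 k ξ‖ ≤ 1)
    {B : ℝ≥0∞} (hk2 : ∀ y, ∫⁻ x in {x | 2 * ‖y‖ ≤ ‖x‖}, ‖k (x - y) - k x‖ₑ ≤ B)
    {Q : ι → Set V} {c : ι → V} {ρ : ι → ℝ} (hQm : ∀ s, MeasurableSet (Q s))
    (hdisj : Pairwise (Function.onFun Disjoint Q))
    (hQsub : ∀ s, Q s ⊆ Metric.closedBall (c s) (ρ s)) {D : ℝ≥0∞}
    (hQD : ∀ s, volume (Metric.closedBall (c s) (2 * ρ s)) ≤ D * volume (Q s))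
    (hQfin : ∀ s, volume (Q s) ≠ ∞) (hQ0 : ∀ s, volume (Q s) ≠ 0)
    {f : V → E} (hf : Integrable f) {M : ℝ} (hM : ∀ x, ‖f x‖ ≤ M) {N : ℝ≥0∞} {lam : ℝ}
    (hlam : 0 < lam)
    (hN : ∀ s, ∫⁻ x in Q s, ‖f x‖ₑ ≤ N * ENNReal.ofReal lam * volume (Q s))
    (hout : ∀ x ∉ ⋃ s, Q s, ‖f x‖ ≤ lam) :
    volume {x | 2 * lam < ‖clmConv k f x‖} ≤
      (D + N ^ 2 + 2 * B * N) * ∑' s, volume (Q s) +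
        (∫⁻ x in {x | ‖f x‖ ≤ lam}, ‖f x‖ₑ ^ 2) / ENNReal.ofReal lam ^ 2 := by
  set L := ENNReal.ofReal lam
  have hL0 : L ≠ 0 := by simpa [L] using hlam
  have hLt : L ≠ ∞ := ENNReal.ofReal_ne_top
  obtain ⟨g, hgi, hg2, hgo, hgN, hgf⟩ := exists_cell_average hQm hdisj hQfin hQ0 hf hM hN
  have hUm : MeasurableSet (⋃ s, Q s) := MeasurableSet.iUnion hQm
  set b : V → E := fun x => f x - g x
  have hbi : Integrable b := hf.sub hgi
  have hb0 : ∀ x ∉ ⋃ s, Q s, b x = 0 := fun x hx => by simp [b, hgo x hx]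
  set Ws := ⋃ s, Metric.closedBall (c s) (2 * ρ s)
  have hWm : MeasurableSet Ws := MeasurableSet.iUnion fun s => measurableSet_closedBall
  set S := ∑' s, volume (Q s)
  have hfS : ∑' s, ∫⁻ x in Q s, ‖f x‖ₑ ≤ N * L * S := by
    rw [← ENNReal.tsum_mul_left]
    exact ENNReal.tsum_le_tsum hN
  have hgS : ∑' s, ∫⁻ x in Q s, ‖g x‖ₑ ≤ N * L * S := by
    rw [← ENNReal.tsum_mul_left]
    refine ENNReal.tsum_le_tsum fun s => ?_
    rw [← setLIntegral_const]
    exact setLIntegral_mono' (hQm s) (hgN s)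
  have hbS : ∫⁻ x, ‖b x‖ₑ ≤ 2 * (N * L * S) := by
    have h1 : ∫⁻ x, ‖b x‖ₑ = ∫⁻ x in ⋃ s, Q s, ‖b x‖ₑ := by
      rw [setLIntegral_eq_of_support_subset]
      intro x hx
      by_contra hc
      exact hx (by simp [hb0 x hc])
    rw [h1, lintegral_iUnion hQm hdisj]
    calc _ ≤ ∑' s, ((∫⁻ x in Q s, ‖f x‖ₑ) + ∫⁻ x in Q s, ‖g x‖ₑ) := by
          refine ENNReal.tsum_le_tsum fun s => ?_
          rw [← lintegral_add_left' hf.1.restrict.enorm]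
          exact lintegral_mono fun x => enorm_sub_le
      _ = _ := ENNReal.tsum_add
      _ ≤ _ := by rw [two_mul]; exact add_le_add hfS hgS
  have hW : volume Ws ≤ D * S := by
    refine (measure_iUnion_le _).trans ?_
    rw [← ENNReal.tsum_mul_left]
    exact ENNReal.tsum_le_tsum hQD
  have hg : volume {x | L ≤ ‖clmConv k g x‖ₑ} ≤
      N ^ 2 * S + (∫⁻ x in {x | ‖f x‖ ≤ lam}, ‖f x‖ₑ ^ 2) / L ^ 2 := by
    have h1 : volume {x | L ≤ ‖clmConv k g x‖ₑ} ≤ (∫⁻ x, ‖clmConv k g x‖ₑ ^ 2) / L ^ 2 := by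
      have h := meas_ge_le_lintegral_div (μ := (volume : Measure V))
        (f := fun x => ‖clmConv k g x‖ₑ ^ 2) (ε := L ^ 2)
        ((continuous_clmConv hk hkc hgi).enorm.measurable.pow_const 2).aemeasurable
        (pow_ne_zero 2 hL0) (ENNReal.pow_ne_top hLt)
      refine le_trans (measure_mono fun x hx => ?_) h
      have hx' : L ≤ ‖clmConv k g x‖ₑ := hx
      exact pow_le_pow_left₀ bot_le hx' 2
    have h2 : ∫⁻ x, ‖clmConv k g x‖ₑ ^ 2 ≤ ∫⁻ x, ‖g x‖ₑ ^ 2 := by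
      have h := eLpNorm_two_clmConv_le hk hkc hk1 hgi hg2
      rw [eLpNorm_eq_lintegral_rpow_enorm_toReal (by norm_num) (by norm_num),
        eLpNorm_eq_lintegral_rpow_enorm_toReal (by norm_num) (by norm_num)] at h
      simpa using (ENNReal.rpow_le_rpow_iff (by norm_num)).1 h
    have h3 : ∫⁻ x, ‖g x‖ₑ ^ 2 ≤
        N ^ 2 * L ^ 2 * S + ∫⁻ x in {x | ‖f x‖ ≤ lam}, ‖f x‖ₑ ^ 2 := by
      rw [← lintegral_add_compl _ hUm]
      refine add_le_add ?_ ?_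
      · rw [lintegral_iUnion hQm hdisj, ← ENNReal.tsum_mul_left]
        refine ENNReal.tsum_le_tsum fun s => ?_
        rw [← setLIntegral_const]
        refine setLIntegral_mono' (hQm s) fun x hx => ?_
        rw [← mul_pow]
        exact pow_le_pow_left₀ bot_le (hgN s x hx) 2
      · rw [setLIntegral_congr_fun (g := fun x => ‖f x‖ₑ ^ 2) hUm.compl
          (fun x hx => by rw [hgo x hx])]
        exact lintegral_mono_set fun x hx => hout x hx
    refine h1.trans ((ENNReal.div_le_div_right (h2.trans h3) _).trans (le_of_eq ?_))
    rw [ENNReal.add_div]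
    congr 1
    rw [mul_assoc, mul_comm (L ^ 2), ← mul_assoc, ENNReal.mul_div_cancel_right]
    · exact pow_ne_zero 2 hL0
    · exact ENNReal.pow_ne_top hLt
  have hb : volume ({x | L ≤ ‖clmConv k b x‖ₑ} ∩ Wsᶜ) ≤ 2 * B * N * S := by
    have h1 := meas_ge_le_lintegral_div (μ := (volume.restrict Wsᶜ : Measure V))
        (f := fun x => ‖clmConv k b x‖ₑ) (ε := L)
        (continuous_clmConv hk hkc hbi).enorm.aemeasurable hL0 hLt
    rw [Measure.restrict_apply' hWm.compl] at h1
    refine h1.trans ?_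
    have h2 := lintegral_clmConv_le_of_cells hk hkc hk2 hQm hdisj hQsub hbi hb0 hgf
    refine (ENNReal.div_le_div_right (h2.trans (mul_le_mul_right hbS B)) _).trans (le_of_eq ?_)
    have h3 : B * (2 * (N * L * S)) = (2 * B * N * S) * L := by ring
    rw [h3, ENNReal.mul_div_cancel_right hL0 hLt]
  have hsub : {x | 2 * lam < ‖clmConv k f x‖} ⊆
      Ws ∪ ({x | L ≤ ‖clmConv k g x‖ₑ} ∪ ({x | L ≤ ‖clmConv k b x‖ₑ} ∩ Wsᶜ)) := by
    intro x hx
    by_cases hxW : x ∈ Ws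
    · exact Or.inl hxW
    · refine Or.inr ?_
      have h1 : clmConv k b x = clmConv k f x - clmConv k g x := clmConv_sub hk hkc hf hgi x
      have hx' : 2 * lam < ‖clmConv k f x‖ := hx
      by_cases hx2 : lam ≤ ‖clmConv k g x‖
      · refine Or.inl ?_
        change ENNReal.ofReal lam ≤ _
        rw [← ofReal_norm]
        exact ENNReal.ofReal_le_ofReal hx2
      · refine Or.inr ⟨?_, hxW⟩
        change ENNReal.ofReal lam ≤ _
        rw [← ofReal_norm]
        refine ENNReal.ofReal_le_ofReal ?_
        rw [h1]
        have := norm_sub_norm_le (clmConv k f x) (clmConv k g x)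
        linarith
  calc _ ≤ volume Ws + (volume {x | L ≤ ‖clmConv k g x‖ₑ} +
          volume ({x | L ≤ ‖clmConv k b x‖ₑ} ∩ Wsᶜ)) :=
        (measure_mono hsub).trans ((measure_union_le _ _).trans
          (add_le_add_right (measure_union_le _ _) _))
    _ ≤ D * S + ((N ^ 2 * S + (∫⁻ x in {x | ‖f x‖ ≤ lam}, ‖f x‖ₑ ^ 2) / L ^ 2) +
          2 * B * N * S) := add_le_add hW (add_le_add hg hb)
    _ = _ := by ring

end CalderonZygmund

section DyadicCubes

variable {n : ℕ}

/-- The half-open dyadic cube of side length `2 ^ k` with corner `2 ^ k * m`. -/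
def dyadicCube (k : ℤ) (m : Fin n → ℤ) : Set (Rn n) :=
  {x | ∀ i, ⌊x i / (2 : ℝ) ^ k⌋ = m i}

theorem mem_dyadicCube_self (k : ℤ) (x : Rn n) :
    x ∈ dyadicCube k (fun i => ⌊x i / (2 : ℝ) ^ k⌋) := fun _ => rfl

theorem corner_mem_dyadicCube (k : ℤ) (m : Fin n → ℤ) :
    (WithLp.toLp 2 fun i => (m i : ℝ) * 2 ^ k : Rn n) ∈ dyadicCube k m := by
  intro i
  have h : ((m i : ℝ) * 2 ^ k) / 2 ^ k = m i := mul_div_cancel_right₀ _ (by positivity)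
  simp [h]

theorem measurableSet_dyadicCube (k : ℤ) (m : Fin n → ℤ) : MeasurableSet (dyadicCube k m) := by
  unfold dyadicCube
  simp only [ofPred_forall]
  refine MeasurableSet.iInter fun i => ?_
  have h : Measurable fun x : Rn n => ⌊x i / (2 : ℝ) ^ k⌋ := by fun_prop
  exact h (measurableSet_singleton (m i))

theorem volume_dyadicCube (k : ℤ) (m : Fin n → ℤ) :
    volume (dyadicCube k m) = ENNReal.ofReal ((2 : ℝ) ^ k) ^ n := by
  have h2 : (0 : ℝ) < (2 : ℝ) ^ k := by positivity
  have h : dyadicCube k m = (MeasurableEquiv.toLp 2 (Fin n → ℝ)).symm ⁻¹'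
      (Set.pi univ fun i => Ico ((m i : ℝ) * 2 ^ k) ((m i + 1 : ℝ) * 2 ^ k)) := by
    ext x
    simp only [dyadicCube, mem_ofPred_eq, mem_preimage, Set.mem_pi, mem_univ, true_imp_iff, mem_Ico]
    refine forall_congr' fun i => ?_
    rw [Int.floor_eq_iff, le_div_iff₀ h2, div_lt_iff₀ h2]
    rfl
  rw [h, (EuclideanSpace.volume_preserving_symm_measurableEquiv_toLp (Fin n)).measure_preimage_equiv,
    Real.volume_pi_Ico]
  simp [← sub_mul]

theorem dyadicCube_eq_of_mem {k k' : ℤ} (hk : k ≤ k') {m m' : Fin n → ℤ} {x : Rn n}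
    (hx : x ∈ dyadicCube k m) (hx' : x ∈ dyadicCube k' m') : dyadicCube k m ⊆ dyadicCube k' m' := by
  obtain ⟨d, rfl⟩ := Int.le.dest hk
  intro y hy i
  have key : ∀ z : Rn n, z ∈ dyadicCube k m →
      ⌊z i / (2 : ℝ) ^ (k + (d : ℤ))⌋ = m i / ((2 ^ d : ℕ) : ℤ) := by
    intro z hz
    have : z i / (2 : ℝ) ^ (k + (d : ℤ)) = (z i / (2 : ℝ) ^ k) / ((2 ^ d : ℕ) : ℝ) := by
      rw [zpow_add₀ (by norm_num)]
      push_cast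
      rw [zpow_natCast, div_div]
    rw [this, Int.floor_div_natCast, hz i]
  rw [key y hy, ← key x hx, hx' i]

theorem dist_le_of_mem_dyadicCube {k : ℤ} {m : Fin n → ℤ} {x y : Rn n}
    (hx : x ∈ dyadicCube k m) (hy : y ∈ dyadicCube k m) : dist x y ≤ √n * 2 ^ k := by
  have h2 : (0 : ℝ) < (2 : ℝ) ^ k := by positivity
  rw [EuclideanSpace.dist_eq]
  have h : ∀ i, dist (x i) (y i) ^ 2 ≤ ((2 : ℝ) ^ k) ^ 2 := by
    intro i
    refine pow_le_pow_left₀ dist_nonneg ?_ 2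
    have hx1 := Int.floor_eq_iff.1 (hx i)
    have hy1 := Int.floor_eq_iff.1 (hy i)
    rw [le_div_iff₀ h2, div_lt_iff₀ h2] at hx1 hy1
    rw [Real.dist_eq, abs_le]
    constructor <;> linarith
  calc √(∑ i, dist (x i) (y i) ^ 2) ≤ √(∑ _i : Fin n, ((2 : ℝ) ^ k) ^ 2) :=
        Real.sqrt_le_sqrt (Finset.sum_le_sum fun i _ => h i)
    _ = √n * 2 ^ k := by
        rw [Finset.sum_const, Finset.card_univ, Fintype.card_fin, nsmul_eq_mul,
          Real.sqrt_mul (by positivity), Real.sqrt_sq h2.le]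

/-- The maximal dyadic cubes on which the average of `‖f‖` exceeds `lam`. -/
def IsMaximalCube {E : Type*} [NormedAddCommGroup E] (f : Rn n → E) (L : ℝ≥0∞)
    (s : ℤ × (Fin n → ℤ)) : Prop :=
  L * volume (dyadicCube s.1 s.2) < ∫⁻ x in dyadicCube s.1 s.2, ‖f x‖ₑ ∧
    ∀ k' > s.1, ∀ m', dyadicCube s.1 s.2 ⊆ dyadicCube k' m' →
      ∫⁻ x in dyadicCube k' m', ‖f x‖ₑ ≤ L * volume (dyadicCube k' m')

variable {E : Type*} [NormedAddCommGroup E] {f : Rn n → E} {L : ℝ≥0∞}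

theorem IsMaximalCube.disjoint : Pairwise (Function.onFun Disjoint
    fun s : {s : ℤ × (Fin n → ℤ) // IsMaximalCube f L s} => dyadicCube s.1.1 s.1.2) := by
  have key : ∀ s t : {s : ℤ × (Fin n → ℤ) // IsMaximalCube f L s}, s.1.1 ≤ t.1.1 → s ≠ t →
      Disjoint (dyadicCube s.1.1 s.1.2) (dyadicCube t.1.1 t.1.2) := by
    rintro ⟨⟨k, m⟩, hs⟩ ⟨⟨k', m'⟩, ht⟩ hst hne
    rw [Set.disjoint_left]
    intro x hx hx'
    rcases hst.eq_or_lt with h | h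
    · simp only at h hx hx'
      subst h
      refine hne ?_
      have : m = m' := funext fun i => (hx i).symm.trans (hx' i)
      subst this
      rfl
    · exact absurd (hs.2 k' h m' (dyadicCube_eq_of_mem hst hx hx')) (not_le.2 ht.1)
  intro s t hst
  rcases le_total s.1.1 t.1.1 with h | h
  · exact key s t h hst
  · exact (key t s h hst.symm).symm

theorem IsMaximalCube.lintegral_le {s : ℤ × (Fin n → ℤ)} (hs : IsMaximalCube f L s) :
    ∫⁻ x in dyadicCube s.1 s.2, ‖f x‖ₑ ≤ 2 ^ n * L * volume (dyadicCube s.1 s.2) := by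
  obtain ⟨k, m⟩ := s
  have hsub := dyadicCube_eq_of_mem (by lia : k ≤ k + 1) (corner_mem_dyadicCube k m) (mem_dyadicCube_self (k + 1) _)
  refine (lintegral_mono_set hsub).trans ((hs.2 (k + 1) (by simp) _ hsub).trans (le_of_eq ?_))
  rw [volume_dyadicCube, volume_dyadicCube, zpow_add₀ (by norm_num), zpow_one,
    ENNReal.ofReal_mul (by positivity), mul_pow]
  simp only [ENNReal.ofReal_ofNat]
  ring

theorem IsMaximalCube.volume_le {lam : ℝ} (hlam : 0 < lam) {s : ℤ × (Fin n → ℤ)}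
    (hf : Continuous f) (hs : IsMaximalCube f (ENNReal.ofReal lam) s) :
    volume (dyadicCube s.1 s.2) ≤ (ENNReal.ofReal (lam / 2))⁻¹ *
      ∫⁻ x in dyadicCube s.1 s.2, {x | lam / 2 < ‖f x‖}.indicator (fun x => ‖f x‖ₑ) x := by
  set Q := dyadicCube s.1 s.2
  set l2 := ENNReal.ofReal (lam / 2)
  have hQ : volume Q ≠ ∞ := by
    rw [volume_dyadicCube]
    exact ENNReal.pow_ne_top ENNReal.ofReal_ne_top
  have h0 : l2 ≠ 0 := by simpa [l2] using hlam
  have ht : l2 ≠ ∞ := ENNReal.ofReal_ne_top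
  have hS : MeasurableSet {x | lam / 2 < ‖f x‖} := (isOpen_lt continuous_const hf.norm).measurableSet
  have h1 : l2 * volume Q + l2 * volume Q ≤
      (∫⁻ x in Q, {x | lam / 2 < ‖f x‖}.indicator (fun x => ‖f x‖ₑ) x) + l2 * volume Q := by
    calc l2 * volume Q + l2 * volume Q = ENNReal.ofReal lam * volume Q := by
          rw [← add_mul, ← ENNReal.ofReal_add (by positivity) (by positivity), add_halves]
      _ ≤ ∫⁻ x in Q, ‖f x‖ₑ := hs.1.le
      _ ≤ ∫⁻ x in Q, ({x | lam / 2 < ‖f x‖}.indicator (fun x => ‖f x‖ₑ) x + l2) := by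
          refine lintegral_mono fun x => ?_
          by_cases hx : lam / 2 < ‖f x‖
          · simp [hx]
          · simp only [mem_ofPred_eq, hx, not_false_eq_true, indicator_of_notMem, zero_add]
            rw [← ofReal_norm]
            exact ENNReal.ofReal_le_ofReal (not_lt.1 hx)
      _ = _ := by
          rw [lintegral_add_right _ measurable_const, setLIntegral_const]
  have h2 := (ENNReal.add_le_add_iff_right (ENNReal.mul_ne_top ht hQ)).1 h1
  rw [mul_comm, ← div_eq_mul_inv, ENNReal.le_div_iff_mul_le (Or.inl h0) (Or.inl ht), mul_comm]
  exact h2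

theorem exists_isMaximalCube (hn : n ≠ 0) {lam : ℝ} (hlam : 0 < lam) (hf : Continuous f)
    (hfi : Integrable f) {x : Rn n} (hx : lam < ‖f x‖) :
    ∃ s, IsMaximalCube f (ENNReal.ofReal lam) s ∧ x ∈ dyadicCube s.1 s.2 := by
  set L := ENNReal.ofReal lam
  set P : ℤ → Prop := fun k => L * volume (dyadicCube k (fun i => ⌊x i / (2 : ℝ) ^ k⌋)) <
    ∫⁻ y in dyadicCube k (fun i => ⌊x i / (2 : ℝ) ^ k⌋), ‖f y‖ₑ
  have hex : ∃ k, P k := by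
    obtain ⟨mu, hmu1, hmu2⟩ := exists_between hx
    have hopen : IsOpen {y | mu < ‖f y‖} := isOpen_lt continuous_const hf.norm
    obtain ⟨ε, hε, hball⟩ := Metric.isOpen_iff.1 hopen x hmu2
    have hn' : (0 : ℝ) < √n + 1 := by positivity
    obtain ⟨N, hN⟩ := exists_pow_lt_of_lt_one (div_pos hε hn') (by norm_num : (1 / 2 : ℝ) < 1)
    refine ⟨-(N : ℤ), ?_⟩
    set Q := dyadicCube (-(N : ℤ)) (fun i => ⌊x i / (2 : ℝ) ^ (-(N : ℤ))⌋)
    have hQ : volume Q = ENNReal.ofReal ((2 : ℝ) ^ (-(N : ℤ))) ^ n := volume_dyadicCube _ _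
    have hpos : volume Q ≠ 0 := by
      rw [hQ]
      exact pow_ne_zero _ (by simp)
    have hfin : volume Q ≠ ∞ := by
      rw [hQ]
      exact ENNReal.pow_ne_top ENNReal.ofReal_ne_top
    have hsub : ∀ y ∈ Q, ENNReal.ofReal mu ≤ ‖f y‖ₑ := by
      intro y hy
      have h1 : dist y x ≤ √n * 2 ^ (-(N : ℤ)) :=
        dist_le_of_mem_dyadicCube hy (mem_dyadicCube_self _ x)
      have h2 : dist y x < ε := by
        rw [lt_div_iff₀ hn'] at hN
        have h3 : (2 : ℝ) ^ (-(N : ℤ)) = (1 / 2) ^ N := by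
          rw [zpow_neg, zpow_natCast, one_div, inv_pow]
        rw [h3] at h1
        have : (0 : ℝ) < (1 / 2) ^ N := by positivity
        nlinarith
      rw [← ofReal_norm]
      exact ENNReal.ofReal_le_ofReal (le_of_lt (hball h2))
    calc L * volume Q < ENNReal.ofReal mu * volume Q := by
          refine (ENNReal.mul_lt_mul_iff_left hpos hfin).2 ?_
          exact (ENNReal.ofReal_lt_ofReal_iff (hlam.trans hmu1)).2 hmu1
      _ = ∫⁻ y in Q, ENNReal.ofReal mu := (setLIntegral_const _ _).symm
      _ ≤ ∫⁻ y in Q, ‖f y‖ₑ := setLIntegral_mono' (measurableSet_dyadicCube _ _) hsub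
  have hbdd : ∃ b : ℤ, ∀ k, P k → k ≤ b := by
    have hfin : (∫⁻ y, ‖f y‖ₑ) / L ≠ ∞ := (ENNReal.div_lt_top hfi.2.ne (by simpa [L] using hlam)).ne
    obtain ⟨N, hN⟩ := ENNReal.exists_nat_gt hfin
    refine ⟨N, fun k hk => ?_⟩
    by_contra hkN
    push Not at hkN
    have h1 : L * ENNReal.ofReal ((2 : ℝ) ^ k) ^ n < ∫⁻ y, ‖f y‖ₑ := by
      have := lt_of_lt_of_le hk (setLIntegral_le_lintegral _ _)
      rwa [volume_dyadicCube] at this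
    have h2 : (N : ℝ≥0∞) ≤ ENNReal.ofReal ((2 : ℝ) ^ k) ^ n := by
      have h3 : (N : ℝ) ≤ 2 ^ k := by
        calc (N : ℝ) ≤ 2 ^ N := by exact_mod_cast Nat.lt_two_pow_self.le
          _ = (2 : ℝ) ^ (N : ℤ) := (zpow_natCast _ _).symm
          _ ≤ 2 ^ k := zpow_le_zpow_right₀ (by norm_num) hkN.le
      have h4 : (1 : ℝ) ≤ 2 ^ k := one_le_zpow₀ (by norm_num) (by lia)
      calc (N : ℝ≥0∞) = ENNReal.ofReal N := (ENNReal.ofReal_natCast N).symm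
        _ ≤ ENNReal.ofReal (2 ^ k) := ENNReal.ofReal_le_ofReal h3
        _ ≤ _ := by
          refine le_self_pow₀ ?_ hn
          rw [← ENNReal.ofReal_one]
          exact ENNReal.ofReal_le_ofReal h4
    rw [ENNReal.div_lt_iff (Or.inl (by simpa [L] using hlam)) (Or.inl ENNReal.ofReal_ne_top)] at hN
    refine absurd (h1.trans hN) (not_lt.2 ?_)
    rw [mul_comm]
    exact mul_le_mul_right h2 L
  obtain ⟨b, hb⟩ := hbdd
  obtain ⟨k, hk, hmax⟩ := Int.exists_greatest_of_bdd ⟨b, hb⟩ hex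
  refine ⟨(k, fun i => ⌊x i / (2 : ℝ) ^ k⌋), ⟨hk, ?_⟩, mem_dyadicCube_self k x⟩
  intro k' hk' m' hsub
  have hx' : x ∈ dyadicCube k' m' := hsub (mem_dyadicCube_self k x)
  have hm : m' = fun i => ⌊x i / (2 : ℝ) ^ k'⌋ := funext fun i => (hx' i).symm
  by_contra hc
  rw [not_le, hm] at hc
  exact absurd (hmax k' hc) (not_le.2 hk')

end DyadicCubes

section WeakType

/-- A weak type estimate for convolution with a kernel satisfying Hörmander's condition, with the
large values of `f` measured in `L¹` and the small ones in `L²`. -/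
theorem exists_measure_lt_clmConv_le {n : ℕ} (hn : n ≠ 0) (B : ℝ≥0) :
    ∃ C : ℝ≥0, ∀ {E F : Type} [NormedAddCommGroup E] [InnerProductSpace ℂ E]
    [CompleteSpace E] [NormedAddCommGroup F] [InnerProductSpace ℂ F] [CompleteSpace F]
    {k : Rn n → E →L[ℂ] F} (_ : Continuous k) (_ : HasCompactSupport k)
    (_ : ∀ ξ, ‖𝓕 k ξ‖ ≤ 1) (_ : ∀ y, ∫⁻ x in {x | 2 * ‖y‖ ≤ ‖x‖}, ‖k (x - y) - k x‖ₑ ≤ B)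
    {f : Rn n → E} (_ : Continuous f) (_ : Integrable f) {M : ℝ} (_ : ∀ x, ‖f x‖ ≤ M)
    {lam : ℝ} (_ : 0 < lam),
    volume {x | 2 * lam < ‖clmConv k f x‖} ≤
      C * ((ENNReal.ofReal (lam / 2))⁻¹ * ∫⁻ x in {x | lam / 2 < ‖f x‖}, ‖f x‖ₑ) +
        (∫⁻ x in {x | ‖f x‖ ≤ lam}, ‖f x‖ₑ ^ 2) / ENNReal.ofReal lam ^ 2 := by
  set D : ℝ≥0∞ := ENNReal.ofReal (2 * √n) ^ n * volume (Metric.ball (0 : Rn n) 1)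
  have hD : D ≠ ∞ := ENNReal.mul_ne_top (ENNReal.pow_ne_top ENNReal.ofReal_ne_top)
    Metric.isBounded_ball.measure_lt_top.ne
  have hC : D + (2 ^ n) ^ 2 + 2 * B * 2 ^ n ≠ ∞ := by finiteness
  refine ⟨(D + (2 ^ n) ^ 2 + 2 * B * 2 ^ n).toNNReal, ?_⟩
  intro E F _ _ _ _ _ _ k hk hkc hk1 hk2 f hf hfi M hM lam hlam
  rw [ENNReal.coe_toNNReal hC]
  set ι := {s : ℤ × (Fin n → ℤ) // IsMaximalCube f (ENNReal.ofReal lam) s}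
  have hQm : ∀ s : ι, MeasurableSet (dyadicCube s.1.1 s.1.2) :=
    fun s => measurableSet_dyadicCube _ _
  have hfin : ∀ s : ι, volume (dyadicCube s.1.1 s.1.2) ≠ ∞ := fun s => by
    rw [volume_dyadicCube]
    exact ENNReal.pow_ne_top ENNReal.ofReal_ne_top
  have hpos : ∀ s : ι, volume (dyadicCube s.1.1 s.1.2) ≠ 0 := fun s => by
    rw [volume_dyadicCube]
    exact pow_ne_zero _ (by simp; positivity)
  have key := measure_lt_clmConv_le_of_cells hk hkc hk1 hk2 (ι := ι)
    (Q := fun s => dyadicCube s.1.1 s.1.2)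
    (c := fun s => WithLp.toLp 2 fun i => (s.1.2 i : ℝ) * 2 ^ s.1.1)
    (ρ := fun s => √n * 2 ^ s.1.1) (D := D) (N := 2 ^ n) hQm IsMaximalCube.disjoint
    (fun s x hx => dist_le_of_mem_dyadicCube hx (corner_mem_dyadicCube _ _))
    (fun s => by
      rw [Measure.addHaar_closedBall _ _ (by positivity), finrank_euclideanSpace_fin,
        volume_dyadicCube, ← mul_assoc, mul_pow, ENNReal.ofReal_mul (by positivity),
        ENNReal.ofReal_pow (by positivity), ENNReal.ofReal_pow (by positivity)]
      refine le_of_eq ?_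
      ring) hfin hpos hfi hM hlam (fun s => s.2.lintegral_le)
    (fun x hx => by
      by_contra hc
      obtain ⟨s, hs, hxs⟩ := exists_isMaximalCube hn hlam hf hfi (not_le.1 hc)
      exact hx (mem_iUnion.2 ⟨⟨s, hs⟩, hxs⟩))
  refine key.trans (add_le_add_left (mul_le_mul_right ?_ _) _)
  have hS : MeasurableSet {x | lam / 2 < ‖f x‖} := (isOpen_lt continuous_const hf.norm).measurableSet
  calc ∑' s : ι, volume (dyadicCube s.1.1 s.1.2) ≤
      ∑' s : ι, (ENNReal.ofReal (lam / 2))⁻¹ * ∫⁻ x in dyadicCube s.1.1 s.1.2,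
        {x | lam / 2 < ‖f x‖}.indicator (fun x => ‖f x‖ₑ) x :=
        ENNReal.tsum_le_tsum fun s => s.2.volume_le hlam hf
    _ = (ENNReal.ofReal (lam / 2))⁻¹ * ∫⁻ x in ⋃ s : ι, dyadicCube s.1.1 s.1.2,
        {x | lam / 2 < ‖f x‖}.indicator (fun x => ‖f x‖ₑ) x := by
        rw [ENNReal.tsum_mul_left, lintegral_iUnion hQm IsMaximalCube.disjoint]
    _ ≤ _ := by
        rw [← lintegral_indicator hS]
        exact mul_le_mul_right (setLIntegral_le_lintegral _ _) _

end WeakType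

section Interpolation

variable {α : Type*} [MeasurableSpace α] {μ : Measure α}

theorem lintegral_indicator_rpow_sub_two_small {p : ℝ} (hp : 1 < p) {a : ℝ} (ha : 0 ≤ a) :
    ∫⁻ t in Ioi (0 : ℝ), {t | t / 2 < a}.indicator
      (fun t => ENNReal.ofReal (2 * a * t ^ (p - 2))) t ≤
      ENNReal.ofReal (2 ^ p / (p - 1)) * ENNReal.ofReal (a ^ p) := by
  have hm : MeasurableSet {t : ℝ | t / 2 < a} :=
    (isOpen_lt (by fun_prop) continuous_const).measurableSet
  rw [lintegral_indicator hm, Measure.restrict_restrict hm]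
  have hInt : IntegrableOn (fun t : ℝ => t ^ (p - 2)) (Ioc 0 (2 * a)) :=
    (intervalIntegrable_iff_integrableOn_Ioc_of_le (by linarith)).1
      (intervalIntegral.intervalIntegrable_rpow' (by linarith))
  calc _ ≤ ∫⁻ t in Ioc 0 (2 * a), ENNReal.ofReal (2 * a * t ^ (p - 2)) := by
        refine lintegral_mono_set fun t ht => ⟨ht.2, ?_⟩
        have := ht.1
        simp only [mem_ofPred_eq] at this
        linarith
    _ = ENNReal.ofReal (∫ t in Ioc 0 (2 * a), 2 * a * t ^ (p - 2)) := by
        refine (ofReal_integral_eq_lintegral_ofReal (hInt.const_mul _) ?_).symm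
        filter_upwards [ae_restrict_mem measurableSet_Ioc] with t ht
        exact mul_nonneg (by positivity) (Real.rpow_nonneg ht.1.le _)
    _ = ENNReal.ofReal (2 ^ p / (p - 1) * a ^ p) := by
        congr 1
        rw [integral_const_mul, ← intervalIntegral.integral_of_le (by linarith),
          integral_rpow (Or.inl (by linarith)), Real.zero_rpow (by linarith),
          show p - 2 + 1 = p - 1 by ring, sub_zero]
        rcases ha.eq_or_lt with h | h
        · rw [← h, Real.zero_rpow (by linarith)]
          simp
        · rw [← mul_div_assoc, ← Real.rpow_one_add' (by positivity) (by linarith),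
            Real.mul_rpow (by norm_num) ha]
          ring_nf
    _ ≤ _ := by
        rw [ENNReal.ofReal_mul (div_nonneg (by positivity) (by linarith))]

theorem lintegral_indicator_rpow_sub_three_large {p : ℝ} (hp2 : p < 2) {a : ℝ}
    (ha : 0 ≤ a) :
    ∫⁻ t in Ioi (0 : ℝ), {t | a ≤ t}.indicator
      (fun t => ENNReal.ofReal (a ^ 2 * t ^ (p - 3))) t ≤
      ENNReal.ofReal (1 / (2 - p)) * ENNReal.ofReal (a ^ p) := by
  rcases ha.eq_or_lt with h | h
  · simp [← h]
  have hm : MeasurableSet {t : ℝ | a ≤ t} := measurableSet_Ici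
  rw [lintegral_indicator hm, Measure.restrict_restrict hm]
  have hInt : IntegrableOn (fun t : ℝ => t ^ (p - 3)) (Ioi a) :=
    integrableOn_Ioi_rpow_of_lt (by linarith) h
  calc _ ≤ ∫⁻ t in Ici a, ENNReal.ofReal (a ^ 2 * t ^ (p - 3)) :=
        lintegral_mono_set fun t ht => ht.1
    _ = ∫⁻ t in Ioi a, ENNReal.ofReal (a ^ 2 * t ^ (p - 3)) :=
        setLIntegral_congr Ioi_ae_eq_Ici.symm
    _ = ENNReal.ofReal (∫ t in Ioi a, a ^ 2 * t ^ (p - 3)) := by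
        refine (ofReal_integral_eq_lintegral_ofReal (hInt.const_mul _) ?_).symm
        filter_upwards [ae_restrict_mem measurableSet_Ioi] with t ht
        exact mul_nonneg (by positivity) (Real.rpow_nonneg (h.trans ht).le _)
    _ = ENNReal.ofReal (1 / (2 - p) * a ^ p) := by
        congr 1
        rw [integral_const_mul, integral_Ioi_rpow_of_lt (by linarith) h,
          show p - 3 + 1 = p - 2 by ring, ← neg_sub 2 p, neg_div_neg_eq, ← mul_div_assoc,
          ← Real.rpow_natCast, ← Real.rpow_add h]
        push_cast
        rw [show (2 : ℝ) + -(2 - p) = p by ring]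
        ring
    _ ≤ _ := by
        rw [ENNReal.ofReal_mul (div_nonneg (by positivity) (by linarith))]

/-- Integrating a mixed weak type estimate. -/
theorem lintegral_rpow_le_of_measure_lt_le [SigmaFinite μ] {p : ℝ} (hp : 1 < p) (hp2 : p < 2)
    {a b : α → ℝ} (ha : Measurable a) (hb : Measurable b) (ha0 : ∀ x, 0 ≤ a x)
    (hb0 : ∀ x, 0 ≤ b x) {C : ℝ≥0∞}
    (h : ∀ t > 0, μ {x | 2 * t < b x} ≤
      C * ((ENNReal.ofReal (t / 2))⁻¹ * ∫⁻ x in {x | t / 2 < a x}, ENNReal.ofReal (a x) ∂μ) +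
        (∫⁻ x in {x | a x ≤ t}, ENNReal.ofReal (a x) ^ 2 ∂μ) / ENNReal.ofReal t ^ 2) :
    ∫⁻ x, ENNReal.ofReal ((b x / 2) ^ p) ∂μ ≤
      ENNReal.ofReal p * ((C * ENNReal.ofReal (2 ^ p / (p - 1)) + ENNReal.ofReal (1 / (2 - p))) *
        ∫⁻ x, ENNReal.ofReal (a x ^ p) ∂μ) := by
  rw [lintegral_rpow_eq_lintegral_meas_lt_mul μ (ae_of_all _ fun x => by
    have := hb0 x; positivity) (by fun_prop) (by linarith)]
  refine mul_le_mul_right ?_ _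
  set Φ : α → ℝ → ℝ≥0∞ := fun x t => {t | t / 2 < a x}.indicator
      (fun t => ENNReal.ofReal (2 * a x * t ^ (p - 2))) t
  set Ψ : α → ℝ → ℝ≥0∞ := fun x t => {t | a x ≤ t}.indicator
      (fun t => ENNReal.ofReal (a x ^ 2 * t ^ (p - 3))) t
  have hΦ : Measurable (Function.uncurry Φ) := by
    have : Function.uncurry Φ = {z : α × ℝ | z.2 / 2 < a z.1}.indicator
      (fun z => ENNReal.ofReal (2 * a z.1 * z.2 ^ (p - 2))) := by
      ext z
      simp [Function.uncurry, Φ, indicator]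
    rw [this]
    exact Measurable.indicator (by fun_prop) (measurableSet_lt (by fun_prop) (by fun_prop))
  have hΨ : Measurable (Function.uncurry Ψ) := by
    have : Function.uncurry Ψ = {z : α × ℝ | a z.1 ≤ z.2}.indicator
      (fun z => ENNReal.ofReal (a z.1 ^ 2 * z.2 ^ (p - 3))) := by
      ext z
      simp [Function.uncurry, Ψ, indicator]
    rw [this]
    exact Measurable.indicator (by fun_prop) (measurableSet_le (by fun_prop) (by fun_prop))
  have hpt : ∀ t ∈ Ioi (0 : ℝ), μ {x | t < b x / 2} * ENNReal.ofReal (t ^ (p - 1)) ≤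
      C * (∫⁻ x, Φ x t ∂μ) + ∫⁻ x, Ψ x t ∂μ := by
    intro t ht
    have ht' : (0 : ℝ) < t := ht
    have h1 : {x | t < b x / 2} = {x | 2 * t < b x} := by
      ext x
      simp only [mem_ofPred_eq]
      rw [lt_div_iff₀ (by norm_num), mul_comm]
    rw [h1]
    refine (mul_le_mul_left (h t ht) _).trans ?_
    rw [add_mul, mul_assoc]
    refine add_le_add (mul_le_mul_right ?_ _) ?_
    · have hm : MeasurableSet {x | t / 2 < a x} := measurableSet_lt measurable_const ha
      rw [← ENNReal.ofReal_inv_of_pos (by positivity), mul_right_comm,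
        ← ENNReal.ofReal_mul (by positivity), ← lintegral_indicator hm,
        ← lintegral_const_mul _ (Measurable.indicator (by fun_prop) hm)]
      refine lintegral_mono fun x => ?_
      simp only [Φ, indicator, mem_ofPred_eq]
      split_ifs
      · rw [← ENNReal.ofReal_mul (by positivity)]
        refine ENNReal.ofReal_le_ofReal (le_of_eq ?_)
        rw [show p - 2 = (p - 1) - 1 by ring, Real.rpow_sub_one ht'.ne' (p - 1)]
        field_simp
      · simp
    · have hm : MeasurableSet {x | a x ≤ t} := measurableSet_le ha measurable_const
      rw [div_eq_mul_inv, mul_assoc, ← ENNReal.ofReal_pow ht'.le,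
        ← ENNReal.ofReal_inv_of_pos (by positivity), ← ENNReal.ofReal_mul (by positivity),
        mul_comm, ← lintegral_indicator hm,
        ← lintegral_const_mul _ (Measurable.indicator (by fun_prop) hm)]
      refine lintegral_mono fun x => ?_
      simp only [Ψ, indicator, mem_ofPred_eq]
      split_ifs
      · rw [← ENNReal.ofReal_pow (ha0 x), ← ENNReal.ofReal_mul (by positivity)]
        refine ENNReal.ofReal_le_ofReal (le_of_eq ?_)
        rw [show p - 3 = (p - 1) - (2 : ℕ) by push_cast; ring, Real.rpow_sub_natCast ht'.ne' (p - 1)]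
        field_simp
      · simp
  calc _ ≤ ∫⁻ t in Ioi (0 : ℝ), (C * (∫⁻ x, Φ x t ∂μ) + ∫⁻ x, Ψ x t ∂μ) :=
        setLIntegral_mono' measurableSet_Ioi hpt
    _ = C * (∫⁻ x, (∫⁻ t in Ioi (0 : ℝ), Φ x t) ∂μ) + ∫⁻ x, (∫⁻ t in Ioi (0 : ℝ), Ψ x t) ∂μ := by
        have hΦ' : Measurable fun t => ∫⁻ x, Φ x t ∂μ := hΦ.lintegral_prod_left'
        have hΨ' : Measurable fun t => ∫⁻ x, Ψ x t ∂μ := hΨ.lintegral_prod_left'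
        rw [lintegral_add_right _ hΨ', lintegral_const_mul _ hΦ', lintegral_lintegral_swap hΦ.aemeasurable,
          lintegral_lintegral_swap hΨ.aemeasurable]
    _ ≤ C * (∫⁻ x, ENNReal.ofReal (2 ^ p / (p - 1)) * ENNReal.ofReal (a x ^ p) ∂μ) +
        ∫⁻ x, ENNReal.ofReal (1 / (2 - p)) * ENNReal.ofReal (a x ^ p) ∂μ := by
        refine add_le_add (mul_le_mul_right (lintegral_mono fun x => ?_) _)
          (lintegral_mono fun x => ?_)
        · exact lintegral_indicator_rpow_sub_two_small hp (ha0 x)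
        · exact lintegral_indicator_rpow_sub_three_large hp2 (ha0 x)
    _ = _ := by
        have hap : Measurable fun x => ENNReal.ofReal (a x ^ p) := by fun_prop
        rw [lintegral_const_mul _ hap, lintegral_const_mul _ hap]
        ring

end Interpolation

section StrongType

/-- Convolution with a kernel with bounded Fourier transform satisfying Hörmander's condition is
bounded on `L^p` for `1 < p ≤ 2`. -/
theorem exists_lintegral_clmConv_rpow_le {n : ℕ} (hn : n ≠ 0) (B : ℝ≥0) {p : ℝ} (hp : 1 < p)
    (hp2 : p ≤ 2) :
    ∃ C : ℝ≥0, ∀ {E F : Type} [NormedAddCommGroup E] [InnerProductSpace ℂ E]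
    [CompleteSpace E] [NormedAddCommGroup F] [InnerProductSpace ℂ F] [CompleteSpace F]
    {k : Rn n → E →L[ℂ] F} (_ : Continuous k) (_ : HasCompactSupport k)
    (_ : ∀ ξ, ‖𝓕 k ξ‖ ≤ 1) (_ : ∀ y, ∫⁻ x in {x | 2 * ‖y‖ ≤ ‖x‖}, ‖k (x - y) - k x‖ₑ ≤ B)
    {f : Rn n → E} (_ : Continuous f) (_ : Integrable f) {M : ℝ} (_ : ∀ x, ‖f x‖ ≤ M),
    ∫⁻ x, ‖clmConv k f x‖ₑ ^ p ≤ C * ∫⁻ x, ‖f x‖ₑ ^ p := by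
  rcases hp2.eq_or_lt with rfl | hp2
  · refine ⟨1, ?_⟩
    intro E F _ _ _ _ _ _ k hk hkc hk1 hk2 f hf hfi M hM
    have hf2 : MemLp f 2 volume := by
      simpa using memLp_of_integrable_of_bound hfi hM (p := 2) (by norm_num)
    have h := eLpNorm_two_clmConv_le hk hkc hk1 hfi hf2
    rw [eLpNorm_eq_lintegral_rpow_enorm_toReal (by norm_num) (by norm_num),
      eLpNorm_eq_lintegral_rpow_enorm_toReal (by norm_num) (by norm_num)] at h
    simpa using (ENNReal.rpow_le_rpow_iff (by norm_num)).1 h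
  · obtain ⟨C, hC⟩ := exists_measure_lt_clmConv_le hn B
    have hfin : ENNReal.ofReal (2 ^ p) * (ENNReal.ofReal p *
      (C * ENNReal.ofReal (2 ^ p / (p - 1)) + ENNReal.ofReal (1 / (2 - p)))) ≠ ∞ := by finiteness
    refine ⟨(ENNReal.ofReal (2 ^ p) * (ENNReal.ofReal p *
      (C * ENNReal.ofReal (2 ^ p / (p - 1)) + ENNReal.ofReal (1 / (2 - p))))).toNNReal, ?_⟩
    intro E F _ _ _ _ _ _ k hk hkc hk1 hk2 f hf hfi M hM
    rw [ENNReal.coe_toNNReal hfin]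
    have h := lintegral_rpow_le_of_measure_lt_le (μ := (volume : Measure (Rn n))) hp hp2
      (a := fun x => ‖f x‖) (b := fun x => ‖clmConv k f x‖) (C := C) hf.norm.measurable
      (continuous_clmConv hk hkc hfi).norm.measurable (fun x => norm_nonneg _)
      (fun x => norm_nonneg _) (fun t ht => by
        simpa only [ofReal_norm] using hC hk hkc hk1 hk2 hf hfi hM ht)
    have h2 : ∀ x, ‖clmConv k f x‖ₑ ^ p =
        ENNReal.ofReal (2 ^ p) * ENNReal.ofReal ((‖clmConv k f x‖ / 2) ^ p) := by
      intro x
      rw [← ENNReal.ofReal_mul (by positivity), ← Real.mul_rpow (by norm_num) (by positivity),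
        mul_div_cancel₀ _ (by norm_num), ← ofReal_norm,
        ENNReal.ofReal_rpow_of_nonneg (norm_nonneg _) (by linarith)]
    have h3 : ∀ x, ‖f x‖ₑ ^ p = ENNReal.ofReal (‖f x‖ ^ p) := by
      intro x
      rw [← ofReal_norm, ENNReal.ofReal_rpow_of_nonneg (norm_nonneg _) (by linarith)]
    simp only [h2, h3]
    rw [lintegral_const_mul' _ _ ENNReal.ofReal_ne_top, mul_assoc, mul_assoc]
    exact mul_le_mul_right h _

end StrongType

section BumpKernels

variable {n : ℕ}

/-- Kernels of mean value zero adapted to a ball of radius comparable to `2 ^ σ`. -/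
structure IsBumpKernel (A : ℝ) (σ : ℤ) (k : Rn n → ℝ) : Prop where
  continuous : Continuous k
  norm_le : ∀ t, k t ≠ 0 → ‖t‖ ≤ 2 * 2 ^ σ
  bound : ∀ t, |k t| * (2 ^ σ) ^ n ≤ A
  lipschitz : ∀ t t', |k t - k t'| * (2 ^ σ) ^ (n + 1) ≤ A * ‖t - t'‖
  integral_eq_zero : ∫ t, k t = 0

theorem measureReal_closedBall_Rn {r : ℝ} (hr : 0 ≤ r) :
    volume.real (Metric.closedBall (0 : Rn n) r) =
      r ^ n * volume.real (Metric.ball (0 : Rn n) 1) := by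
  rw [Measure.real, Measure.addHaar_closedBall _ _ hr, finrank_euclideanSpace_fin,
    ENNReal.toReal_mul, ENNReal.toReal_ofReal (by positivity)]
  rfl

theorem lintegral_enorm_le_of_norm_le {G : Type*} [NormedAddCommGroup G] {g : Rn n → G} {c r : ℝ}
    (hc : 0 ≤ c) (hr : 0 ≤ r) (hg : ∀ t, ‖g t‖ ≤ c) (h0 : ∀ t, g t ≠ 0 → ‖t‖ ≤ r) :
    ∫⁻ t, ‖g t‖ₑ ≤ ENNReal.ofReal (c * (r ^ n * volume.real (Metric.ball (0 : Rn n) 1))) := by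
  rw [← setLIntegral_eq_of_support_subset (s := Metric.closedBall (0 : Rn n) r) (fun t ht => by
    rw [mem_closedBall_zero_iff]
    exact h0 t (by simpa using ht))]
  calc _ ≤ ∫⁻ _ in Metric.closedBall (0 : Rn n) r, ENNReal.ofReal c := by
        refine lintegral_mono fun t => ?_
        rw [← ofReal_norm]
        exact ENNReal.ofReal_le_ofReal (hg t)
    _ = _ := by
        rw [setLIntegral_const, ENNReal.ofReal_mul hc, ← measureReal_closedBall_Rn hr,
          ofReal_measureReal measure_closedBall_lt_top.ne]

theorem norm_integral_le_of_norm_le_of_support {G : Type*} [NormedAddCommGroup G] [NormedSpace ℝ G]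
    {g : Rn n → G} {c r : ℝ}
    (hc : 0 ≤ c) (hr : 0 ≤ r) (hg : ∀ t, ‖g t‖ ≤ c) (h0 : ∀ t, g t ≠ 0 → ‖t‖ ≤ r) :
    ‖∫ t, g t‖ ≤ c * (r ^ n * volume.real (Metric.ball (0 : Rn n) 1)) := by
  have h1 := (enorm_integral_le_lintegral_enorm g).trans (lintegral_enorm_le_of_norm_le hc hr hg h0)
  rwa [← ofReal_norm, ENNReal.ofReal_le_ofReal_iff (by positivity)] at h1

namespace IsBumpKernel

variable {A : ℝ} {σ : ℤ} {k : Rn n → ℝ}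

theorem hasCompactSupport (hk : IsBumpKernel A σ k) : HasCompactSupport k :=
  HasCompactSupport.intro (isCompact_closedBall (0 : Rn n) (2 * 2 ^ σ)) fun t ht => by
    by_contra hc
    exact ht (mem_closedBall_zero_iff.2 (hk.norm_le t hc))

theorem integrable (hk : IsBumpKernel A σ k) : Integrable k :=
  hk.continuous.integrable_of_hasCompactSupport hk.hasCompactSupport

theorem nonneg (hk : IsBumpKernel A σ k) : 0 ≤ A :=
  (mul_nonneg (abs_nonneg _) (by positivity)).trans (hk.bound 0)

theorem comp_neg (hk : IsBumpKernel A σ k) : IsBumpKernel A σ fun t => k (-t) where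
  continuous := hk.continuous.comp continuous_neg
  norm_le t ht := by simpa using hk.norm_le _ ht
  bound t := hk.bound _
  lipschitz t t' := by
    refine (hk.lipschitz _ _).trans (le_of_eq ?_)
    rw [neg_sub_neg, norm_sub_rev]
  integral_eq_zero := by rw [integral_neg_eq_self, hk.integral_eq_zero]

theorem norm_fourier_le (hk : IsBumpKernel A σ k) (ξ : Rn n) :
    ‖𝓕 (fun t => (k t : ℂ)) ξ‖ ≤
      4 ^ (n + 2) * volume.real (Metric.ball (0 : Rn n) 1) * A * (2 ^ σ * ‖ξ‖) := by
  have hA := hk.nonneg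
  set v := volume.real (Metric.ball (0 : Rn n) 1)
  have hv : 0 ≤ v := measureReal_nonneg
  set ρ : ℝ := 2 ^ σ
  have hρ : 0 < ρ := by positivity
  have h1 : 𝓕 (fun t => (k t : ℂ)) ξ =
      ∫ t, (Complex.exp (Complex.I * ((-2 * Real.pi * inner ℝ t ξ : ℝ) : ℂ)) - 1) * (k t : ℂ) := by
    have h0 : ∫ t, (k t : ℂ) = 0 := by
      rw [integral_complex_ofReal, hk.integral_eq_zero, Complex.ofReal_zero]
    have hi : Integrable fun t => (k t : ℂ) := hk.integrable.ofReal
    have hi2 := (Real.fourierIntegral_convergent_iff ξ).2 hi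
    simp only [Circle.smul_def, Real.fourierChar_apply, smul_eq_mul] at hi2
    rw [Real.fourier_eq']
    simp only [smul_eq_mul, sub_mul, one_mul]
    rw [integral_sub _ hi, h0, sub_zero]
    · simp only [mul_comm Complex.I]
    · refine hi2.congr (ae_of_all _ fun t => ?_)
      simp only
      congr 2
      push_cast
      ring
  rw [h1]
  refine (norm_integral_le_of_norm_le_of_support (c := 2 * Real.pi * (2 * ρ) * ‖ξ‖ * (A / ρ ^ n))
    (r := 2 * ρ) (by positivity) (by positivity) (fun t => ?_) (fun t ht => ?_)).trans ?_
  · rw [norm_mul]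
    by_cases h : k t = 0
    · rw [h, Complex.ofReal_zero, norm_zero, mul_zero]
      positivity
    · refine mul_le_mul ?_ ?_ (norm_nonneg _) (by positivity)
      · refine Real.norm_exp_I_mul_ofReal_sub_one_le.trans ?_
        rw [norm_mul, norm_mul, norm_neg, Real.norm_ofNat, Real.norm_of_nonneg Real.pi_pos.le,
          mul_assoc (2 * Real.pi)]
        refine mul_le_mul_of_nonneg_left ((norm_inner_le_norm t ξ).trans ?_) (by positivity)
        exact mul_le_mul_of_nonneg_right (hk.norm_le t h) (norm_nonneg _)
      · rw [Complex.norm_real, le_div_iff₀ (by positivity)]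
        exact hk.bound t
  · refine hk.norm_le t fun h => ht ?_
    rw [h, Complex.ofReal_zero, mul_zero]
  · have h2 : 2 * Real.pi * (2 * ρ) * ‖ξ‖ * (A / ρ ^ n) * ((2 * ρ) ^ n * v) =
        (4 * Real.pi * 2 ^ n) * (v * A * (ρ * ‖ξ‖)) := by
      rw [mul_pow]
      field_simp
      ring
    rw [h2]
    have h3 : (4 * Real.pi * 2 ^ n) ≤ 4 ^ (n + 2) := by
      have h4 : (2 : ℝ) ^ n ≤ 4 ^ n := pow_le_pow_left₀ (by norm_num) (by norm_num) n
      have h5 : (0 : ℝ) < 2 ^ n := by positivity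
      rw [pow_add]
      nlinarith [Real.pi_lt_four, Real.pi_pos]
    calc _ ≤ 4 ^ (n + 2) * (v * A * (ρ * ‖ξ‖)) := mul_le_mul_of_nonneg_right h3 (by positivity)
      _ = _ := by ring

theorem norm_fourier_le_inv (hk : IsBumpKernel A σ k) {ξ : Rn n} (hξ : ξ ≠ 0) :
    ‖𝓕 (fun t => (k t : ℂ)) ξ‖ ≤
      4 ^ (n + 2) * volume.real (Metric.ball (0 : Rn n) 1) * A * (2 ^ σ * ‖ξ‖)⁻¹ := by
  have hA := hk.nonneg
  have hx : 0 < (2 : ℝ) ^ σ * ‖ξ‖ := mul_pos (by positivity) (norm_pos_iff.2 hξ)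
  rcases lt_or_ge ((2 : ℝ) ^ σ * ‖ξ‖) (1 / 2) with h | h
  · refine (hk.norm_fourier_le ξ).trans (mul_le_mul_of_nonneg_left ?_ (by positivity))
    rw [le_inv_comm₀ hx hx]
    have : (2 : ℝ) ≤ ((2 : ℝ) ^ σ * ‖ξ‖)⁻¹ := by
      rw [le_inv_comm₀ (by norm_num) hx]
      linarith
    linarith
  set v := volume.real (Metric.ball (0 : Rn n) 1)
  have hv : 0 ≤ v := measureReal_nonneg
  set ρ : ℝ := 2 ^ σ
  have hρ : 0 < ρ := by positivity
  have hξ' := norm_pos_iff.2 hξ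
  have hi : Integrable fun t => (k t : ℂ) := hk.integrable.ofReal
  have hw : ‖(1 / (2 * ‖ξ‖ ^ 2) : ℝ) • ξ‖ = 1 / (2 * ‖ξ‖) := by
    rw [norm_smul, Real.norm_of_nonneg (by positivity)]
    field_simp
  have hw2 : 1 / (2 * ‖ξ‖) ≤ ρ := by
    rw [div_le_iff₀ (by positivity)]
    linarith
  rw [Real.fourier_eq, fourierIntegral_eq_half_sub_half_period_translate hξ hi, norm_smul]
  have key := norm_integral_le_of_norm_le_of_support
    (g := fun t : Rn n => Real.fourierChar (-inner ℝ t ξ) •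
      ((k t : ℂ) - (k (t + (1 / (2 * ‖ξ‖ ^ 2) : ℝ) • ξ) : ℂ)))
    (c := A / ρ ^ (n + 1) * (1 / (2 * ‖ξ‖))) (r := 3 * ρ) (by positivity) (by positivity)
    (fun t => ?_) (fun t ht => ?_)
  · refine (mul_le_mul_of_nonneg_left key (norm_nonneg _)).trans ?_
    have h2 : ‖(1 / 2 : ℂ)‖ * (A / ρ ^ (n + 1) * (1 / (2 * ‖ξ‖)) * ((3 * ρ) ^ n * v)) =
        (3 ^ n / 4) * (v * A * (ρ * ‖ξ‖)⁻¹) := by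
      rw [mul_pow, norm_div, norm_one, Complex.norm_ofNat]
      field_simp
      ring
    rw [h2]
    have h3 : (3 ^ n / 4 : ℝ) ≤ 4 ^ (n + 2) := by
      have h4 : (3 : ℝ) ^ n ≤ 4 ^ n := pow_le_pow_left₀ (by norm_num) (by norm_num) n
      have h5 : (0 : ℝ) < 4 ^ n := by positivity
      rw [pow_add]
      linarith
    calc _ ≤ 4 ^ (n + 2) * (v * A * (ρ * ‖ξ‖)⁻¹) := mul_le_mul_of_nonneg_right h3 (by positivity)
      _ = _ := by ring
  · rw [Circle.norm_smul, ← Complex.ofReal_sub, Complex.norm_real, div_mul_eq_mul_div,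
      le_div_iff₀ (by positivity)]
    refine (hk.lipschitz _ _).trans (le_of_eq ?_)
    rw [sub_add_cancel_left, norm_neg, hw]
  · by_contra hc
    push Not at hc
    refine ht ?_
    have h1 : k t = 0 := by
      by_contra h0
      linarith [hk.norm_le t h0]
    have h2 : k (t + (1 / (2 * ‖ξ‖ ^ 2) : ℝ) • ξ) = 0 := by
      by_contra h0
      have h3 := hk.norm_le _ h0
      have h4 := norm_sub_norm_le t (-((1 / (2 * ‖ξ‖ ^ 2) : ℝ) • ξ))
      rw [sub_neg_eq_add, norm_neg, hw] at h4
      linarith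
    simp only [h1, h2, sub_zero, Complex.ofReal_zero, smul_zero]

theorem norm_fourier_le_zpow (hk : IsBumpKernel A σ k) {ξ : Rn n} {s : ℤ}
    (hs : ‖ξ‖ ∈ Ico ((2 : ℝ) ^ s) (2 ^ (s + 1))) :
    ‖𝓕 (fun t => (k t : ℂ)) ξ‖ ≤
      2 * (4 ^ (n + 2) * volume.real (Metric.ball (0 : Rn n) 1)) * A * 2 ^ (-|σ + s|) := by
  have hA := hk.nonneg
  have h2 : (0 : ℝ) < 2 ^ s := by positivity
  have hξ : ξ ≠ 0 := norm_pos_iff.1 (h2.trans_le hs.1)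
  rw [show ∀ a b c : ℝ, 2 * a * b * c = a * b * (2 * c) by intros; ring]
  rcases le_or_gt (σ + s) 0 with h | h
  · refine (hk.norm_fourier_le ξ).trans (mul_le_mul_of_nonneg_left ?_ (by positivity))
    rw [abs_of_nonpos h, neg_neg, zpow_add₀ (by norm_num)]
    have := hs.2.le
    rw [zpow_add_one₀ (by norm_num)] at this
    have h3 : (0 : ℝ) < 2 ^ σ := by positivity
    nlinarith
  · refine (hk.norm_fourier_le_inv hξ).trans (mul_le_mul_of_nonneg_left ?_ (by positivity))
    rw [abs_of_pos h, zpow_neg]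
    have h3 : ((2 : ℝ) ^ σ * ‖ξ‖)⁻¹ ≤ (2 ^ (σ + s))⁻¹ := by
      refine inv_anti₀ (by positivity) ?_
      rw [zpow_add₀ (by norm_num)]
      exact mul_le_mul_of_nonneg_left hs.1 (by positivity)
    have h4 : (0 : ℝ) < (2 ^ (σ + s))⁻¹ := by positivity
    linarith

theorem lintegral_sub_le_zpow (hk : IsBumpKernel A σ k) {y : Rn n} {s : ℤ}
    (hs : ‖y‖ ∈ Ico ((2 : ℝ) ^ s) (2 ^ (s + 1))) :
    ∫⁻ x in {x | 2 * ‖y‖ ≤ ‖x‖}, ‖k (x - y) - k x‖ₑ ≤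
      ENNReal.ofReal
        ((4 ^ (n + 2) * volume.real (Metric.ball (0 : Rn n) 1)) * A * 2 ^ (-|σ - s|)) := by
  have hA := hk.nonneg
  set v := volume.real (Metric.ball (0 : Rn n) 1)
  have hv : 0 ≤ v := measureReal_nonneg
  set ρ : ℝ := 2 ^ σ with hρdef
  have hρ : 0 < ρ := by positivity
  rcases lt_or_ge (2 * ρ) ‖y‖ with h | h
  · rw [setLIntegral_congr_fun (g := fun _ => 0) (measurableSet_le (by fun_prop) (by fun_prop)),
      lintegral_zero]
    · exact bot_le
    · intro x hx
      have hx' : 2 * ‖y‖ ≤ ‖x‖ := hx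
      have h1 : k x = 0 := by
        by_contra h0
        linarith [hk.norm_le x h0]
      have h2 : k (x - y) = 0 := by
        by_contra h0
        linarith [hk.norm_le _ h0, norm_sub_norm_le x y]
      simp [h1, h2]
  · refine (setLIntegral_le_lintegral _ _).trans ((lintegral_enorm_le_of_norm_le
      (c := A / ρ ^ (n + 1) * ‖y‖) (r := 4 * ρ) (by positivity) (by positivity) (fun t => ?_)
      (fun t ht => ?_)).trans (ENNReal.ofReal_le_ofReal ?_))
    · rw [div_mul_eq_mul_div, le_div_iff₀ (by positivity)]
      refine (hk.lipschitz _ _).trans (le_of_eq ?_)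
      rw [sub_sub_cancel_left, norm_neg]
    · by_contra hc
      push Not at hc
      refine ht ?_
      have h1 : k t = 0 := by
        by_contra h0
        linarith [hk.norm_le t h0]
      have h2 : k (t - y) = 0 := by
        by_contra h0
        linarith [hk.norm_le _ h0, norm_sub_norm_le t y]
      rw [h1, h2, sub_zero]
    · have h1 : A / ρ ^ (n + 1) * ‖y‖ * ((4 * ρ) ^ n * v) = (4 ^ n * v * A) * (‖y‖ / ρ) := by
        rw [mul_pow]
        field_simp
        ring
      rw [h1, show (4 : ℝ) ^ (n + 2) * v * A * 2 ^ (-|σ - s|) =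
        (4 ^ n * v * A) * (16 * 2 ^ (-|σ - s|)) by ring]
      refine mul_le_mul_of_nonneg_left ?_ (by positivity)
      rw [div_le_iff₀ hρ]
      have h3 : s ≤ σ + 1 := by
        have : (2 : ℝ) ^ s ≤ 2 ^ (σ + 1) := by
          rw [zpow_add_one₀ (by norm_num)]
          linarith [hs.1]
        exact (zpow_le_zpow_iff_right₀ (by norm_num)).1 this
      have h4 : (2 : ℝ) ^ (s + 1) ≤ 16 * 2 ^ (-|σ - s|) * ρ := by
        rw [hρdef, show (16 : ℝ) = 2 ^ (4 : ℤ) by norm_num, ← zpow_add₀ (by norm_num),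
          ← zpow_add₀ (by norm_num)]
        refine zpow_le_zpow_right₀ (by norm_num) ?_
        rcases abs_cases (σ - s) with h | h <;> lia
      exact hs.2.le.trans h4

end IsBumpKernel

theorem summable_two_zpow_neg_abs : Summable fun s : ℤ => (2 : ℝ) ^ (-|s|) := by
  have h : Summable fun m : ℕ => (2 : ℝ) ^ (-|(m : ℤ)|) := by
    refine summable_geometric_two.congr fun m => ?_
    simp
  exact Summable.of_nat_of_neg h (by simpa only [abs_neg] using h)

theorem sum_two_zpow_neg_abs_le {ι : Type*} [Fintype ι] {σ : ι → ℤ} {M : ℕ}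
    (hM : ∀ s, (Finset.univ.filter fun j => σ j = s).card ≤ M) (s₀ : ℤ) :
    ∑ j, (2 : ℝ) ^ (-|σ j - s₀|) ≤ M * ∑' s : ℤ, (2 : ℝ) ^ (-|s|) := by
  classical
  rw [Finset.sum_comp (fun s : ℤ => (2 : ℝ) ^ (-|s - s₀|)) σ]
  have hs : Summable fun s : ℤ => (2 : ℝ) ^ (-|s - s₀|) :=
    summable_two_zpow_neg_abs.comp_injective (Equiv.subRight s₀).injective
  calc _ ≤ ∑ s ∈ Finset.univ.image σ, (M : ℝ) * 2 ^ (-|s - s₀|) := by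
        refine Finset.sum_le_sum fun s _ => ?_
        rw [nsmul_eq_mul]
        exact mul_le_mul_of_nonneg_right (by exact_mod_cast hM s) (by positivity)
    _ = M * ∑ s ∈ Finset.univ.image σ, 2 ^ (-|s - s₀|) := by rw [Finset.mul_sum]
    _ ≤ M * ∑' s : ℤ, 2 ^ (-|s - s₀|) :=
        mul_le_mul_of_nonneg_left (hs.sum_le_tsum _ fun s _ => by positivity) (by positivity)
    _ = _ := by
        have h := (Equiv.subRight s₀).tsum_eq (fun s : ℤ => (2 : ℝ) ^ (-|s|))
        simp only [Equiv.subRight_apply] at h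
        rw [h]

end BumpKernels

section BumpSum

variable {n : ℕ} {ι : Type} [Fintype ι] {E F : Type} [NormedAddCommGroup E]
  [InnerProductSpace ℂ E] [NormedAddCommGroup F] [InnerProductSpace ℂ F]

/-- The operator-valued kernel `∑ j, k j • L j`. -/
def bumpSum (k : ι → Rn n → ℝ) (L : ι → E →L[ℂ] F) (t : Rn n) : E →L[ℂ] F :=
  ∑ j, (k j t : ℂ) • L j

variable {A : ℝ} {σ : ι → ℤ} {k : ι → Rn n → ℝ} {L : ι → E →L[ℂ] F}

theorem continuous_bumpSum (hk : ∀ j, IsBumpKernel A (σ j) (k j)) : Continuous (bumpSum k L) :=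
  continuous_finsetSum _ fun j _ =>
    (Complex.continuous_ofReal.comp (hk j).continuous).smul continuous_const

theorem hasCompactSupport_bumpSum (hk : ∀ j, IsBumpKernel A (σ j) (k j)) :
    HasCompactSupport (bumpSum k L) := by
  have h : IsCompact (⋃ j, tsupport (k j)) := isCompact_iUnion fun j => (hk j).hasCompactSupport
  refine HasCompactSupport.intro h fun t ht => ?_
  refine Finset.sum_eq_zero fun j _ => ?_
  have h1 : k j t = 0 := by
    by_contra hc
    exact ht (mem_iUnion.2 ⟨j, subset_tsupport _ hc⟩)
  rw [h1, Complex.ofReal_zero, zero_smul]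

theorem fourier_bumpSum [CompleteSpace F] (hk : ∀ j, IsBumpKernel A (σ j) (k j)) (ξ : Rn n) :
    𝓕 (bumpSum k L) ξ = ∑ j, 𝓕 (fun t => (k j t : ℂ)) ξ • L j := by
  simp only [Real.fourier_eq, bumpSum, Finset.smul_sum]
  rw [integral_finsetSum]
  · refine Finset.sum_congr rfl fun j _ => ?_
    have h := integral_smul_const (μ := (volume : Measure (Rn n)))
      (fun t => Real.fourierChar (-inner ℝ t ξ) • (k j t : ℂ)) (L j)
    simp only [smul_assoc] at h
    exact h
  · intro j _
    exact (Real.fourierIntegral_convergent_iff ξ).2 ((hk j).integrable.ofReal.smul_const (L j))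

theorem norm_fourier_bumpSum_le [CompleteSpace F] (hA : 0 < A)
    (hk : ∀ j, IsBumpKernel A (σ j) (k j)) {M : ℕ}
    (hM : ∀ s, (Finset.univ.filter fun j => σ j = s).card ≤ M) (hL : ∀ j, ‖L j‖ ≤ 1) (ξ : Rn n) :
    ‖𝓕 (bumpSum k L) ξ‖ ≤ 2 * (4 ^ (n + 2) * volume.real (Metric.ball (0 : Rn n) 1)) * A *
      (M * ∑' s : ℤ, (2 : ℝ) ^ (-|s|)) := by
  rw [fourier_bumpSum hk]
  refine (norm_sum_le _ _).trans ?_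
  have h1 : ∀ j, ‖𝓕 (fun t => (k j t : ℂ)) ξ • L j‖ ≤ ‖𝓕 (fun t => (k j t : ℂ)) ξ‖ := fun j => by
    rw [norm_smul]
    exact mul_le_of_le_one_right (norm_nonneg _) (hL j)
  refine (Finset.sum_le_sum fun j _ => h1 j).trans ?_
  have hv : 0 ≤ volume.real (Metric.ball (0 : Rn n) 1) := measureReal_nonneg
  rcases eq_or_ne ξ 0 with rfl | hξ
  · have h2 : ∀ j, ‖𝓕 (fun t => (k j t : ℂ)) 0‖ = 0 := fun j => by
      refine le_antisymm (((hk j).norm_fourier_le 0).trans (le_of_eq ?_)) (norm_nonneg _)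
      simp
    simp only [h2, Finset.sum_const_zero]
    have hS : 0 ≤ ∑' s : ℤ, (2 : ℝ) ^ (-|s|) := tsum_nonneg fun s => by positivity
    positivity
  · obtain ⟨s, hs⟩ := exists_mem_Ico_zpow (norm_pos_iff.2 hξ) (by norm_num : (1 : ℝ) < 2)
    refine (Finset.sum_le_sum fun j _ => (hk j).norm_fourier_le_zpow hs).trans ?_
    rw [← Finset.mul_sum]
    refine mul_le_mul_of_nonneg_left ?_ (by positivity)
    simpa only [sub_neg_eq_add] using sum_two_zpow_neg_abs_le hM (-s)

theorem lintegral_bumpSum_sub_le (hA : 0 < A)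
    (hk : ∀ j, IsBumpKernel A (σ j) (k j)) {M : ℕ}
    (hM : ∀ s, (Finset.univ.filter fun j => σ j = s).card ≤ M) (hL : ∀ j, ‖L j‖ ≤ 1) (y : Rn n) :
    ∫⁻ x in {x | 2 * ‖y‖ ≤ ‖x‖}, ‖bumpSum k L (x - y) - bumpSum k L x‖ₑ ≤ ENNReal.ofReal
      ((4 ^ (n + 2) * volume.real (Metric.ball (0 : Rn n) 1)) * A *
        (M * ∑' s : ℤ, (2 : ℝ) ^ (-|s|))) := by
  rcases eq_or_ne y 0 with rfl | hy
  · have h0 : ∀ x, ‖bumpSum k L (x - 0) - bumpSum k L x‖ₑ = 0 := fun x => by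
      rw [sub_zero, sub_self, ← ofReal_norm, norm_zero, ENNReal.ofReal_zero]
    simp only [h0, lintegral_zero, zero_le]
  obtain ⟨s, hs⟩ := exists_mem_Ico_zpow (norm_pos_iff.2 hy) (by norm_num : (1 : ℝ) < 2)
  have hv : 0 ≤ volume.real (Metric.ball (0 : Rn n) 1) := measureReal_nonneg
  calc _ ≤ ∫⁻ x in {x | 2 * ‖y‖ ≤ ‖x‖}, ∑ j, ‖k j (x - y) - k j x‖ₑ := by
        refine lintegral_mono fun x => ?_
        simp only [bumpSum, ← Finset.sum_sub_distrib, ← sub_smul]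
        refine (enorm_sum_le Finset.univ fun j => ((k j (x - y) : ℂ) - (k j x : ℂ)) • L j).trans
          (Finset.sum_le_sum fun j _ => ?_)
        rw [enorm_smul, ← Complex.ofReal_sub, ← ofReal_norm (Complex.ofReal _), Complex.norm_real,
          ofReal_norm, ← ofReal_norm (L j)]
        refine mul_le_of_le_one_right' ?_
        rw [← ENNReal.ofReal_one]
        exact ENNReal.ofReal_le_ofReal (hL j)
    _ = ∑ j, ∫⁻ x in {x | 2 * ‖y‖ ≤ ‖x‖}, ‖k j (x - y) - k j x‖ₑ := by
        refine lintegral_finsetSum _ fun j _ => ?_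
        have := (hk j).continuous
        exact Continuous.measurable (by fun_prop)
    _ ≤ ∑ j, ENNReal.ofReal _ :=
        Finset.sum_le_sum fun j _ => (hk j).lintegral_sub_le_zpow hs
    _ = ENNReal.ofReal (∑ j, _) := by
        refine (ENNReal.ofReal_sum_of_nonneg fun j _ => ?_).symm
        positivity
    _ ≤ _ := by
        refine ENNReal.ofReal_le_ofReal ?_
        rw [← Finset.mul_sum]
        exact mul_le_mul_of_nonneg_left (sum_two_zpow_neg_abs_le hM s) (by positivity)

end BumpSum

/-- Operator-valued sums of bump kernels at different scales are bounded on `L^p`, `1 < p ≤ 2`. -/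
theorem exists_lintegral_clmConv_bumpSum_le {n : ℕ} (hn : n ≠ 0) (M : ℕ) {p : ℝ} (hp : 1 < p)
    (hp2 : p ≤ 2) :
    ∃ C : ℝ≥0, ∀ {E F : Type} [NormedAddCommGroup E] [InnerProductSpace ℂ E]
    [CompleteSpace E] [NormedAddCommGroup F] [InnerProductSpace ℂ F] [CompleteSpace F]
    {ι : Type} [Fintype ι] {A : ℝ} (_ : 0 < A) {σ : ι → ℤ} {k : ι → Rn n → ℝ}
    (_ : ∀ j, IsBumpKernel A (σ j) (k j))
    (_ : ∀ s, (Finset.univ.filter fun j => σ j = s).card ≤ M)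
    {L : ι → E →L[ℂ] F} (_ : ∀ j, ‖L j‖ ≤ 1)
    {f : Rn n → E} (_ : Continuous f) (_ : Integrable f) {R : ℝ} (_ : ∀ x, ‖f x‖ ≤ R),
    ∫⁻ x, ‖clmConv (bumpSum k L) f x‖ₑ ^ p ≤ C * ENNReal.ofReal A ^ p * ∫⁻ x, ‖f x‖ₑ ^ p := by
  obtain ⟨C, hC⟩ := exists_lintegral_clmConv_rpow_le hn 1 hp hp2
  have hv : 0 ≤ volume.real (Metric.ball (0 : Rn n) 1) := measureReal_nonneg
  have hS : 0 ≤ ∑' s : ℤ, (2 : ℝ) ^ (-|s|) := tsum_nonneg fun s => by positivity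
  set D : ℝ := 2 * (4 ^ (n + 2) * volume.real (Metric.ball (0 : Rn n) 1)) *
    (M * ∑' s : ℤ, (2 : ℝ) ^ (-|s|)) + 1
  have hD : 0 < D := by positivity
  refine ⟨C * (D.toNNReal ^ p), ?_⟩
  intro E F _ _ _ _ _ _ ι _ A hA σ k hk hM L hL f hf hfi R hR
  have hk' : ∀ j, IsBumpKernel D⁻¹ (σ j) (fun t => (D * A)⁻¹ * k j t) := by
    intro j
    have hDA : 0 < D * A := by positivity
    refine ⟨continuous_const.mul (hk j).continuous, fun t ht => (hk j).norm_le t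
      (right_ne_zero_of_mul ht), fun t => ?_, fun t t' => ?_, ?_⟩
    · rw [abs_mul, abs_of_pos (by positivity), mul_assoc]
      calc _ ≤ (D * A)⁻¹ * A := mul_le_mul_of_nonneg_left ((hk j).bound t) (by positivity)
        _ = _ := by field_simp
    · rw [← mul_sub, abs_mul, abs_of_pos (by positivity), mul_assoc]
      calc _ ≤ (D * A)⁻¹ * (A * ‖t - t'‖) :=
            mul_le_mul_of_nonneg_left ((hk j).lipschitz t t') (by positivity)
        _ = _ := by field_simp
    · rw [integral_const_mul, (hk j).integral_eq_zero, mul_zero]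
  have hD' : 0 < D⁻¹ := by positivity
  have hX : 2 * (4 ^ (n + 2) * volume.real (Metric.ball (0 : Rn n) 1)) * D⁻¹ *
      (M * ∑' s : ℤ, (2 : ℝ) ^ (-|s|)) ≤ 1 := by
    rw [mul_right_comm, ← div_eq_mul_inv, div_le_one hD]
    exact (lt_add_one _).le
  have h1 := fun ξ => (norm_fourier_bumpSum_le (L := L) hD' hk' hM hL ξ).trans hX
  have h2 : ∀ y, ∫⁻ x in {x | 2 * ‖y‖ ≤ ‖x‖},
      ‖bumpSum (fun j t => (D * A)⁻¹ * k j t) L (x - y) -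
        bumpSum (fun j t => (D * A)⁻¹ * k j t) L x‖ₑ ≤ (1 : ℝ≥0) := by
    intro y
    refine (lintegral_bumpSum_sub_le hD' hk' hM hL y).trans ?_
    rw [ENNReal.coe_one, ← ENNReal.ofReal_one]
    refine ENNReal.ofReal_le_ofReal (le_trans ?_ hX)
    have : 0 ≤ (4 ^ (n + 2) * volume.real (Metric.ball (0 : Rn n) 1)) * D⁻¹ *
      (M * ∑' s : ℤ, (2 : ℝ) ^ (-|s|)) := by positivity
    linarith
  have key := hC (continuous_bumpSum hk') (hasCompactSupport_bumpSum hk') h1 h2 hf hfi hR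
  have h3 : ∀ x, clmConv (bumpSum k L) f x =
      ((D * A : ℝ) : ℂ) • clmConv (bumpSum (fun j t => (D * A)⁻¹ * k j t) L) f x := by
    intro x
    rw [clmConv, clmConv, ← integral_smul]
    congr 1
    ext t
    have h4 : bumpSum k L t =
        ((D * A : ℝ) : ℂ) • bumpSum (fun j t => (D * A)⁻¹ * k j t) L t := by
      simp only [bumpSum, Finset.smul_sum, smul_smul, ← Complex.ofReal_mul]
      refine Finset.sum_congr rfl fun j _ => ?_
      rw [mul_inv_cancel_left₀ (by positivity)]
    rw [h4]
    rfl
  have h5 : ∀ x, ‖clmConv (bumpSum k L) f x‖ₑ ^ p =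
      (ENNReal.ofReal D ^ p * ENNReal.ofReal A ^ p) *
        ‖clmConv (bumpSum (fun j t => (D * A)⁻¹ * k j t) L) f x‖ₑ ^ p := by
    intro x
    rw [h3, enorm_smul, ENNReal.mul_rpow_of_nonneg _ _ (by linarith), ← ofReal_norm,
      Complex.norm_real, Real.norm_of_nonneg (by positivity), ENNReal.ofReal_mul hD.le,
      ENNReal.mul_rpow_of_nonneg _ _ (by linarith)]
  simp only [h5]
  rw [lintegral_const_mul' _ _ (by finiteness)]
  refine (mul_le_mul_right key _).trans (le_of_eq ?_)
  rw [ENNReal.coe_mul, ENNReal.coe_rpow_of_nonneg _ (by linarith), ENNReal.ofReal]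
  ring

section Duality

variable {V E F : Type*} [NormedAddCommGroup V] [InnerProductSpace ℝ V]
    [FiniteDimensional ℝ V] [MeasurableSpace V] [BorelSpace V]
    [NormedAddCommGroup E] [InnerProductSpace ℂ E] [CompleteSpace E]
    [NormedAddCommGroup F] [InnerProductSpace ℂ F] [CompleteSpace F]

theorem integral_inner_clmConv {k : V → E →L[ℂ] F} (hk : Continuous k) (hkc : HasCompactSupport k)
    {f : V → E} (hf : Continuous f) (hfi : Integrable f) {g : V → F} (hg : Continuous g)
    (hgi : Integrable g) :
    ∫ x, inner ℂ (g x) (clmConv k f x) =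
      ∫ y, inner ℂ (clmConv (fun t => ContinuousLinearMap.adjoint (k (-t))) g y) (f y) := by
  obtain ⟨M, hM⟩ := hk.bounded_above_of_compact_support hkc
  set k' : V → F →L[ℂ] E := fun t => ContinuousLinearMap.adjoint (k (-t)) with hk'
  have hk'c : Continuous k' :=
    (ContinuousLinearMap.adjoint : (E →L[ℂ] F) ≃ₗᵢ⋆[ℂ] _).continuous.comp (hk.comp continuous_neg)
  have hk's : HasCompactSupport k' :=
    (hkc.comp_homeomorph (Homeomorph.neg V)).comp_left (map_zero _)
  have h1 : ∀ x, inner ℂ (g x) (clmConv k f x) = ∫ y, inner ℂ (g x) (k (x - y) (f y)) := by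
    intro x
    rw [clmConv_eq_integral_sub]
    exact (integral_inner (integrable_clm_sub_apply hk hkc hfi x) (g x)).symm
  have h2 : ∀ y, inner ℂ (clmConv k' g y) (f y) = ∫ x, inner ℂ (g x) (k (x - y) (f y)) := by
    intro y
    rw [clmConv_eq_integral_sub, ← inner_conj_symm,
      ← integral_inner (integrable_clm_sub_apply hk'c hk's hgi y) (f y), ← integral_conj]
    congr 1
    ext x
    rw [inner_conj_symm, hk']
    simp only [neg_sub, ContinuousLinearMap.adjoint_inner_left]
  simp only [h1, h2]
  refine integral_integral_swap ?_
  refine ((hgi.norm.mul_prod hfi.norm).const_mul M).mono' ?_ (ae_of_all _ fun z => ?_)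
  · refine Continuous.aestronglyMeasurable ?_
    have h3 : Continuous fun z : V × V => k (z.1 - z.2) (f z.2) :=
      (hk.comp (by fun_prop)).clm_apply (hf.comp (by fun_prop))
    exact (hg.comp continuous_fst).inner h3
  · calc ‖inner ℂ (g z.1) (k (z.1 - z.2) (f z.2))‖ ≤ ‖g z.1‖ * ‖k (z.1 - z.2) (f z.2)‖ :=
          norm_inner_le_norm _ _
      _ ≤ ‖g z.1‖ * (M * ‖f z.2‖) := by
          refine mul_le_mul_of_nonneg_left ?_ (norm_nonneg _)
          exact (ContinuousLinearMap.le_opNorm _ _).trans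
            (mul_le_mul_of_nonneg_right (hM _) (norm_nonneg _))
      _ = _ := by ring

/-- An `L^q` bound for the adjoint operator gives an `L^p` bound, `p > 2`. -/
theorem lintegral_clmConv_rpow_le_of_adjoint {k : V → E →L[ℂ] F} (hk : Continuous k)
    (hkc : HasCompactSupport k) {p q : ℝ} (hp : 2 < p) (hpq : p.HolderConjugate q) {C : ℝ≥0∞}
    (hC : ∀ {g : V → F} (_ : Continuous g) (_ : Integrable g) {R : ℝ} (_ : ∀ x, ‖g x‖ ≤ R),
      ∫⁻ x, ‖clmConv (fun t => ContinuousLinearMap.adjoint (k (-t))) g x‖ₑ ^ q ≤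
        C * ∫⁻ x, ‖g x‖ₑ ^ q)
    {f : V → E} (hf : Continuous f) (hfi : Integrable f) :
    ∫⁻ x, ‖clmConv k f x‖ₑ ^ p ≤ C ^ (p / q) * ∫⁻ x, ‖f x‖ₑ ^ p := by
  set H := clmConv k f
  have hH : Continuous H := continuous_clmConv hk hkc hfi
  have hHi : Integrable H := integrable_clmConv hk hkc hfi
  obtain ⟨M, hM⟩ := exists_norm_clmConv_le hk hkc hfi
  have hp0 : 0 < p := by linarith
  have hq0 : 0 < q := hpq.symm.pos
  set g : V → F := fun x => ((‖H x‖ ^ (p - 2) : ℝ) : ℂ) • H x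
  have hM0 : 0 ≤ M := (norm_nonneg _).trans (hM 0)
  have hgc : Continuous g :=
    (Complex.continuous_ofReal.comp (hH.norm.rpow_const fun _ => Or.inr (by linarith))).smul hH
  have hgn : ∀ x, ‖g x‖ = ‖H x‖ ^ (p - 2) * ‖H x‖ := fun x => by
    rw [norm_smul, Complex.norm_real, Real.norm_of_nonneg (by positivity)]
  have hgn' : ∀ x, ‖g x‖ = ‖H x‖ ^ (p - 1) := fun x => by
    rw [hgn]
    rcases eq_or_ne (‖H x‖) 0 with h | h
    · rw [h, Real.zero_rpow (by linarith), Real.zero_rpow (by linarith), mul_zero]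
    · rw [← Real.rpow_add_one h]; congr 1; ring
  have hgi : Integrable g := by
    refine (hHi.norm.const_mul (M ^ (p - 2))).mono' hgc.aestronglyMeasurable
      (ae_of_all _ fun x => ?_)
    rw [hgn]
    exact mul_le_mul_of_nonneg_right
      (Real.rpow_le_rpow (norm_nonneg _) (hM x) (by linarith)) (norm_nonneg _)
  have hgb : ∀ x, ‖g x‖ ≤ M ^ (p - 1) := fun x => by
    rw [hgn']
    exact Real.rpow_le_rpow (norm_nonneg _) (hM x) (by linarith)
  have hgq : ∀ x, ‖g x‖ₑ ^ q = ‖H x‖ₑ ^ p := fun x => by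
    rw [← ofReal_norm, ← ofReal_norm, ENNReal.ofReal_rpow_of_nonneg (norm_nonneg _) hq0.le,
      ENNReal.ofReal_rpow_of_nonneg (norm_nonneg _) hp0.le, hgn', ← Real.rpow_mul (norm_nonneg _),
      hpq.sub_one_mul_conj]
  have hinner : ∀ x, inner ℂ (g x) (H x) = ((‖H x‖ ^ p : ℝ) : ℂ) := fun x => by
    rw [inner_smul_left, Complex.conj_ofReal, inner_self_eq_norm_sq_to_K]
    rcases eq_or_ne (‖H x‖) 0 with h | h
    · rw [h]; simp [Real.zero_rpow hp0.ne']
    · change ((‖H x‖ ^ (p - 2) : ℝ) : ℂ) * ((‖H x‖ : ℝ) : ℂ) ^ 2 = _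
      rw [← Complex.ofReal_pow, ← Complex.ofReal_mul, ← Real.rpow_natCast,
        ← Real.rpow_add (by positivity)]
      congr 2; push_cast; ring
  have hHp : Integrable fun x => ‖H x‖ ^ p := by
    have := (memLp_of_integrable_of_bound hHi hM (p := p) (by linarith))
    rw [← integrable_norm_rpow_iff hHi.1 (by simp; linarith) ENNReal.ofReal_ne_top,
      ENNReal.toReal_ofReal hp0.le] at this
    exact this
  set X := ∫⁻ x, ‖H x‖ₑ ^ p
  set Y := ∫⁻ x, ‖f x‖ₑ ^ p
  have hX : X = ENNReal.ofReal (∫ x, ‖H x‖ ^ p) := by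
    rw [ofReal_integral_eq_lintegral_ofReal hHp (ae_of_all _ fun x => by positivity)]
    refine lintegral_congr fun x => ?_
    rw [← ENNReal.ofReal_rpow_of_nonneg (norm_nonneg _) hp0.le, ofReal_norm]
  have hXtop : X ≠ ∞ := hX ▸ ENNReal.ofReal_ne_top
  have key : X ≤ (C * X) ^ (1 / q) * Y ^ (1 / p) := by
    calc X = ‖∫ x, inner ℂ (g x) (H x)‖ₑ := by
          simp only [hinner]
          rw [integral_complex_ofReal, ← ofReal_norm, Complex.norm_real, Real.norm_of_nonneg, hX]
          exact integral_nonneg fun x => by positivity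
      _ = ‖∫ y, inner ℂ (clmConv (fun t => ContinuousLinearMap.adjoint (k (-t))) g y) (f y)‖ₑ := by
          rw [integral_inner_clmConv hk hkc hf hfi hgc hgi]
      _ ≤ ∫⁻ y, ‖clmConv (fun t => ContinuousLinearMap.adjoint (k (-t))) g y‖ₑ * ‖f y‖ₑ := by
          refine (enorm_integral_le_lintegral_enorm _).trans (lintegral_mono fun y => ?_)
          rw [← ofReal_norm, ← ofReal_norm, ← ofReal_norm, ← ENNReal.ofReal_mul (norm_nonneg _)]
          exact ENNReal.ofReal_le_ofReal (norm_inner_le_norm _ _)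
      _ ≤ (∫⁻ y, ‖clmConv (fun t => ContinuousLinearMap.adjoint (k (-t))) g y‖ₑ ^ q) ^ (1 / q) *
            Y ^ (1 / p) := by
          refine ENNReal.lintegral_mul_le_Lp_mul_Lq volume hpq.symm ?_ hf.enorm.aemeasurable
          have hk'c : Continuous fun t => ContinuousLinearMap.adjoint (k (-t)) :=
            (ContinuousLinearMap.adjoint : (E →L[ℂ] F) ≃ₗᵢ⋆[ℂ] _).continuous.comp
              (hk.comp continuous_neg)
          have hk's : HasCompactSupport fun t => ContinuousLinearMap.adjoint (k (-t)) :=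
            (hkc.comp_homeomorph (Homeomorph.neg V)).comp_left
              (g := fun L : E →L[ℂ] F => ContinuousLinearMap.adjoint L) (map_zero _)
          exact (continuous_clmConv hk'c hk's hgi).enorm.aemeasurable
      _ ≤ _ := by
          gcongr
          refine (hC hgc hgi hgb).trans (le_of_eq ?_)
          simp only [hgq]
          rfl
  rcases eq_or_ne X 0 with h0 | h0
  · rw [h0]; exact zero_le
  have hconj : 1 / p + 1 / q = 1 := by simpa using hpq.inv_add_inv_eq_one
  have key2 : X ^ (1 / p) ≤ C ^ (1 / q) * Y ^ (1 / p) := by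
    have h3 : X = X ^ (1 / p) * X ^ (1 / q) := by
      rw [← ENNReal.rpow_add _ _ h0 hXtop, hconj, ENNReal.rpow_one]
    have hXq0 : X ^ (1 / q) ≠ 0 := by
      simp [ENNReal.rpow_eq_zero_iff, h0, hXtop]
    have hXqt : X ^ (1 / q) ≠ ∞ := ENNReal.rpow_ne_top_of_nonneg (by positivity) hXtop
    rw [ENNReal.mul_rpow_of_nonneg _ _ (by positivity)] at key
    refine (ENNReal.mul_le_mul_iff_left hXq0 hXqt).1 ?_
    rw [← h3]
    exact key.trans (le_of_eq (by ring))
  calc X = (X ^ (1 / p)) ^ p := by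
        rw [← ENNReal.rpow_mul, one_div_mul_cancel hp0.ne', ENNReal.rpow_one]
    _ ≤ (C ^ (1 / q) * Y ^ (1 / p)) ^ p := by gcongr
    _ = _ := by
        rw [ENNReal.mul_rpow_of_nonneg _ _ hp0.le, ← ENNReal.rpow_mul, ← ENNReal.rpow_mul,
          one_div_mul_cancel hp0.ne', ENNReal.rpow_one, one_div_mul_eq_div]

end Duality

/-- Operator-valued sums of bump kernels at different scales are bounded on `L^p`, `1 < p`. -/
theorem exists_lintegral_clmConv_bumpSum_le' {n : ℕ} (hn : n ≠ 0) (M : ℕ) {p : ℝ} (hp : 1 < p) :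
    ∃ C : ℝ≥0, ∀ {E F : Type} [NormedAddCommGroup E] [InnerProductSpace ℂ E]
    [CompleteSpace E] [NormedAddCommGroup F] [InnerProductSpace ℂ F] [CompleteSpace F]
    {ι : Type} [Fintype ι] {A : ℝ} (_ : 0 < A) {σ : ι → ℤ} {k : ι → Rn n → ℝ}
    (_ : ∀ j, IsBumpKernel A (σ j) (k j))
    (_ : ∀ s, (Finset.univ.filter fun j => σ j = s).card ≤ M)
    {L : ι → E →L[ℂ] F} (_ : ∀ j, ‖L j‖ ≤ 1)
    {f : Rn n → E} (_ : Continuous f) (_ : Integrable f) {R : ℝ} (_ : ∀ x, ‖f x‖ ≤ R),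
    ∫⁻ x, ‖clmConv (bumpSum k L) f x‖ₑ ^ p ≤ C * ENNReal.ofReal A ^ p * ∫⁻ x, ‖f x‖ₑ ^ p := by
  rcases le_or_gt p 2 with hp2 | hp2
  · exact exists_lintegral_clmConv_bumpSum_le hn M hp hp2
  obtain ⟨q, hpq⟩ : ∃ q : ℝ, p.HolderConjugate q := ⟨_, Real.HolderConjugate.conjExponent hp⟩
  have hq2 : q ≤ 2 := by
    rw [hpq.conjugate_eq, div_le_iff₀ (by linarith)]
    linarith
  obtain ⟨C, hC⟩ := exists_lintegral_clmConv_bumpSum_le hn M hpq.symm.lt hq2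
  have hq0 : 0 < q := hpq.symm.pos
  have hp0 : 0 < p := hpq.pos
  refine ⟨C ^ (p / q), ?_⟩
  intro E F _ _ _ _ _ _ ι _ A hA σ k hk hM L hL f hf hfi R hR
  have h1 : (fun t => ContinuousLinearMap.adjoint (bumpSum k L (-t))) =
      bumpSum (fun j t => k j (-t)) fun j => ContinuousLinearMap.adjoint (L j) := by
    ext1 t
    rw [bumpSum, map_sum]
    refine Finset.sum_congr rfl fun j _ => ?_
    rw [map_smulₛₗ, Complex.conj_ofReal]
  have h2 := lintegral_clmConv_rpow_le_of_adjoint (C := C * ENNReal.ofReal A ^ q)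
    (continuous_bumpSum (L := L) hk) (hasCompactSupport_bumpSum hk) hp2 hpq (by
      intro g hg hgi R' hR'
      rw [h1]
      refine hC hA (fun j => (hk j).comp_neg) hM (fun j => ?_) hg hgi hR'
      rw [LinearIsometryEquiv.norm_map]
      exact hL j) hf hfi
  refine h2.trans (le_of_eq ?_)
  rw [ENNReal.mul_rpow_of_nonneg _ _ (by positivity), ← ENNReal.rpow_mul,
    mul_div_cancel₀ _ hq0.ne', ENNReal.coe_rpow_of_nonneg _ (by positivity)]

/-- Convolution of a complex function with a real kernel. -/
def bumpConv {n : ℕ} (k : Rn n → ℝ) (f : Rn n → ℂ) (x : Rn n) : ℂ :=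
  ∫ t, f (x - t) * (k t : ℂ)

theorem IsBumpKernel.integrable_mul {n : ℕ} {A : ℝ} {σ : ℤ} {k : Rn n → ℝ}
    (hk : IsBumpKernel A σ k) {f : Rn n → ℂ} (hf : Continuous f) (x : Rn n) :
    Integrable fun t => f (x - t) * (k t : ℂ) := by
  refine Continuous.integrable_of_hasCompactSupport ?_ ?_
  · exact (hf.comp (by fun_prop)).mul (Complex.continuous_ofReal.comp hk.continuous)
  · exact (hk.hasCompactSupport.comp_left (g := Complex.ofReal) Complex.ofReal_zero).mul_left

/-- The Littlewood-Paley square function estimate for a family of bump kernels. -/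
theorem exists_lintegral_square_function_le {n : ℕ} (hn : n ≠ 0) (M : ℕ) {p : ℝ} (hp : 1 < p) :
    ∃ C : ℝ≥0, ∀ {ι : Type} [Fintype ι] {A : ℝ} (_ : 0 < A) {σ : ι → ℤ} {k : ι → Rn n → ℝ}
    (_ : ∀ j, IsBumpKernel A (σ j) (k j))
    (_ : ∀ s, (Finset.univ.filter fun j => σ j = s).card ≤ M)
    {f : Rn n → ℂ} (_ : Continuous f) (_ : Integrable f) {R : ℝ} (_ : ∀ x, ‖f x‖ ≤ R),
    ∫⁻ x, (∑ j, ‖bumpConv (k j) f x‖ₑ ^ (2 : ℝ)) ^ (p / 2) ≤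
      C * ENNReal.ofReal A ^ p * ∫⁻ x, ‖f x‖ₑ ^ p := by
  classical
  obtain ⟨C, hC⟩ := exists_lintegral_clmConv_bumpSum_le' hn M hp
  refine ⟨C, ?_⟩
  intro ι _ A hA σ k hk hM f hf hfi R hR
  set L : ι → ℂ →L[ℂ] EuclideanSpace ℂ ι := fun j =>
    ContinuousLinearMap.toSpanSingleton ℂ (EuclideanSpace.single j 1)
  have hL : ∀ j, ‖L j‖ ≤ 1 := fun j => by
    simp [L, ContinuousLinearMap.norm_toSpanSingleton]
  refine le_of_eq_of_le (lintegral_congr fun x => ?_) (hC hA hk hM hL hf hfi hR)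
  have hcoord : ∀ t j, bumpSum k L t (f (x - t)) j = f (x - t) * (k j t : ℂ) := fun t j => by
    simp [bumpSum, L, mul_comm, Pi.single_apply]
  have hInt : Integrable fun t => bumpSum k L t (f (x - t)) := by
    have := (integrable_clm_sub_apply (continuous_bumpSum (L := L) hk)
      (hasCompactSupport_bumpSum hk) hfi x).comp_sub_left x
    simpa using this
  have h1 : ∀ j, clmConv (bumpSum k L) f x j = bumpConv (k j) f x := fun j => by
    have := (EuclideanSpace.proj (𝕜 := ℂ) j).integral_comp_comm hInt
    refine this.symm.trans (integral_congr_ae (ae_of_all _ fun t => hcoord t j))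
  have h2 : ‖clmConv (bumpSum k L) f x‖ₑ ^ (2 : ℝ) = ∑ j, ‖bumpConv (k j) f x‖ₑ ^ (2 : ℝ) := by
    simp only [ENNReal.rpow_two, ← ofReal_norm, ← ENNReal.ofReal_pow (norm_nonneg _)]
    rw [EuclideanSpace.norm_sq_eq, ENNReal.ofReal_sum_of_nonneg fun _ _ => by positivity]
    simp only [h1]
  rw [← h2, ← ENNReal.rpow_mul, mul_div_cancel₀ _ two_ne_zero]

namespace IsGammaU

variable {Γ : ℝ → ℝ}

theorem differentiableAt (hΓ : IsGammaU Γ) {s : ℝ} (hs : 0 < s) : DifferentiableAt ℝ Γ s :=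
  (hΓ.smooth.contDiffAt (Ioi_mem_nhds hs)).differentiableAt (by simp)

theorem strictMonoOn (hΓ : IsGammaU Γ) : StrictMonoOn Γ (Ici 0) := by
  refine strictMonoOn_of_deriv_pos (convex_Ici 0) hΓ.continuousOn fun s hs => ?_
  rw [interior_Ici] at hs
  exact hΓ.deriv_pos s hs

theorem pos (hΓ : IsGammaU Γ) {s : ℝ} (hs : 0 < s) : 0 < Γ s :=
  hΓ.map_zero ▸ hΓ.strictMonoOn self_mem_Ici hs.le hs

theorem nonneg (hΓ : IsGammaU Γ) {s : ℝ} (hs : 0 ≤ s) : 0 ≤ Γ s := by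
  rcases hs.eq_or_lt with rfl | h
  · exact hΓ.map_zero.ge
  · exact (hΓ.pos h).le

theorem exists_deriv_bounds (hΓ : IsGammaU Γ) : ∃ c > (0 : ℝ), ∃ C > (0 : ℝ), ∀ s > (0 : ℝ),
    c * Γ s ≤ s * deriv Γ s ∧ s * deriv Γ s ≤ C * Γ s := by
  obtain ⟨c, hc, h1⟩ := hΓ.lower 1 (by simp)
  obtain ⟨C, hC, h2⟩ := hΓ.upper 1 le_rfl
  refine ⟨c, hc, C, hC, fun s hs => ?_⟩
  have h3 := h1 s hs
  have h4 := h2 s hs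
  have h5 := hΓ.pos hs
  have h6 := hΓ.deriv_pos s hs
  rw [iteratedDeriv_one, pow_one, abs_of_pos (by positivity)] at h3 h4
  exact ⟨(le_div_iff₀ h5).1 h3, (div_le_iff₀ h5).1 h4⟩

theorem mul_rpow_le (hΓ : IsGammaU Γ) {c : ℝ}
    (hc : ∀ s > (0 : ℝ), c * Γ s ≤ s * deriv Γ s) {s t : ℝ} (hs : 0 < s) (hst : s ≤ t) :
    Γ s * t ^ c ≤ Γ t * s ^ c := by
  have hd : ∀ x > (0 : ℝ), HasDerivAt (fun x => Γ x * x ^ (-c))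
      (deriv Γ x * x ^ (-c) + Γ x * (-c * x ^ (-c - 1))) x := fun x hx =>
    (hΓ.differentiableAt hx).hasDerivAt.mul (Real.hasDerivAt_rpow_const (Or.inl hx.ne'))
  have hmono : MonotoneOn (fun x => Γ x * x ^ (-c)) (Ioi 0) := by
    refine monotoneOn_of_deriv_nonneg (convex_Ioi 0)
      (fun x hx => (hd x hx).continuousAt.continuousWithinAt)
      (fun x hx => ?_) fun x hx => ?_
    · rw [interior_Ioi] at hx
      exact (hd x hx).differentiableAt.differentiableWithinAt
    · rw [interior_Ioi] at hx
      rw [(hd x hx).deriv, Real.rpow_sub_one (ne_of_gt hx)]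
      have h1 := hc x hx
      have h2 : 0 < x := hx
      have h3 : deriv Γ x * x ^ (-c) + Γ x * (-c * (x ^ (-c) / x)) =
          (x * deriv Γ x - c * Γ x) * (x ^ (-c) / x) := by field_simp; ring
      rw [h3]
      exact mul_nonneg (by linarith) (by positivity)
  have ht : 0 < t := hs.trans_le hst
  have h := hmono hs ht hst
  simp only [Real.rpow_neg hs.le, Real.rpow_neg ht.le, ← div_eq_mul_inv] at h
  exact (div_le_div_iff₀ (by positivity) (by positivity)).1 h

theorem mul_rpow_ge (hΓ : IsGammaU Γ) {C : ℝ}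
    (hC : ∀ s > (0 : ℝ), s * deriv Γ s ≤ C * Γ s) {s t : ℝ} (hs : 0 < s) (hst : s ≤ t) :
    Γ t * s ^ C ≤ Γ s * t ^ C := by
  have hd : ∀ x > (0 : ℝ), HasDerivAt (fun x => Γ x * x ^ (-C))
      (deriv Γ x * x ^ (-C) + Γ x * (-C * x ^ (-C - 1))) x := fun x hx =>
    (hΓ.differentiableAt hx).hasDerivAt.mul (Real.hasDerivAt_rpow_const (Or.inl hx.ne'))
  have hanti : AntitoneOn (fun x => Γ x * x ^ (-C)) (Ioi 0) := by
    refine antitoneOn_of_deriv_nonpos (convex_Ioi 0)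
      (fun x hx => (hd x hx).continuousAt.continuousWithinAt)
      (fun x hx => ?_) fun x hx => ?_
    · rw [interior_Ioi] at hx
      exact (hd x hx).differentiableAt.differentiableWithinAt
    · rw [interior_Ioi] at hx
      rw [(hd x hx).deriv, Real.rpow_sub_one (ne_of_gt hx)]
      have h1 := hC x hx
      have h2 : 0 < x := hx
      have h3 : deriv Γ x * x ^ (-C) + Γ x * (-C * (x ^ (-C) / x)) =
          (x * deriv Γ x - C * Γ x) * (x ^ (-C) / x) := by field_simp; ring
      rw [h3]
      exact mul_nonpos_of_nonpos_of_nonneg (by linarith) (by positivity)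
  have ht : 0 < t := hs.trans_le hst
  have h := hanti hs ht hst
  simp only [Real.rpow_neg hs.le, Real.rpow_neg ht.le, ← div_eq_mul_inv] at h
  exact (div_le_div_iff₀ (by positivity) (by positivity)).1 h

theorem kstar_spec (hΓ : IsGammaU Γ) (j : ℤ) :
    (2 : ℝ) ^ j * Γ (2 ^ kstar Γ j) ≤ 1 ∧ 1 < (2 : ℝ) ^ j * Γ (2 ^ (kstar Γ j + 1)) := by
  obtain ⟨c, hc, _, _, h⟩ := hΓ.exists_deriv_bounds
  have hgrow := fun {s t : ℝ} => hΓ.mul_rpow_le (s := s) (t := t) fun s hs => (h s hs).1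
  set S : Set ℤ := {m : ℤ | (2 : ℝ) ^ j * Γ ((2 : ℝ) ^ m) ≤ 1} with hS
  have hΓ1 : 0 < Γ 1 := hΓ.pos one_pos
  have h2 : (1 : ℝ) < 2 ^ c := Real.one_lt_rpow (by norm_num) hc
  have hcomm : ∀ N : ℕ, ((2 : ℝ) ^ N) ^ c = (2 ^ c) ^ N := fun N => by
    rw [← Real.rpow_natCast, ← Real.rpow_natCast, ← Real.rpow_mul (by norm_num),
      ← Real.rpow_mul (by norm_num), mul_comm]
  have hne : S.Nonempty := by
    obtain ⟨N, hN⟩ := pow_unbounded_of_one_lt ((2 : ℝ) ^ j * Γ 1) h2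
    refine ⟨-(N : ℤ), ?_⟩
    have h3 := hgrow (s := (2 : ℝ) ^ (-(N : ℤ))) (t := 1) (by positivity)
      (zpow_le_one_of_nonpos₀ (by norm_num) (by simp))
    rw [Real.one_rpow, mul_one, zpow_neg, zpow_natCast, Real.inv_rpow (by positivity),
      hcomm] at h3
    rw [hS, Set.mem_ofPred_eq, zpow_neg, zpow_natCast]
    calc _ ≤ (2 : ℝ) ^ j * (Γ 1 * ((2 ^ c) ^ N)⁻¹) := by gcongr
      _ = (2 : ℝ) ^ j * Γ 1 / (2 ^ c) ^ N := by ring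
      _ ≤ 1 := (div_le_one (by positivity)).2 hN.le
  have hbdd : BddAbove S := by
    obtain ⟨N, hN⟩ := pow_unbounded_of_one_lt (((2 : ℝ) ^ j * Γ 1)⁻¹) h2
    refine ⟨N, fun m hm => ?_⟩
    by_contra! hlt
    rw [hS, Set.mem_ofPred_eq] at hm
    have h4 : Γ ((2 : ℝ) ^ (N : ℤ)) ≤ Γ ((2 : ℝ) ^ m) :=
      hΓ.strictMonoOn.monotoneOn (mem_Ici.2 (by positivity)) (mem_Ici.2 (by positivity))
        (zpow_le_zpow_right₀ (by norm_num) hlt.le)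
    have h3 := hgrow (s := 1) (t := (2 : ℝ) ^ (N : ℤ)) one_pos (by
      rw [zpow_natCast]; exact one_le_pow₀ (by norm_num))
    rw [Real.one_rpow, mul_one, zpow_natCast, hcomm] at h3
    rw [zpow_natCast] at h4
    have h5 : 1 < ((2 : ℝ) ^ j * Γ 1) * (2 ^ c) ^ N := by
      rwa [inv_lt_iff_one_lt_mul₀' (by positivity)] at hN
    have h6 : ((2 : ℝ) ^ j * Γ 1) * (2 ^ c) ^ N ≤ 2 ^ j * Γ (2 ^ m) := by
      rw [mul_assoc]
      gcongr
      exact h3.trans h4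
    linarith
  refine ⟨Int.csSup_mem hne hbdd, ?_⟩
  by_contra! hle
  have := le_csSup hbdd (show kstar Γ j + 1 ∈ S from hle)
  rw [kstar] at this
  linarith

/-- The map `j ↦ kstar Γ j` has fibres of bounded cardinality. -/
theorem exists_card_kstar_le (hΓ : IsGammaU Γ) : ∃ M : ℕ, ∀ (J : Finset ℤ) (l s : ℤ),
    (Finset.univ.filter fun j : J => l + kstar Γ j = s).card ≤ M := by
  obtain ⟨_, _, C, hC, h⟩ := hΓ.exists_deriv_bounds
  have hgrow := fun {s t : ℝ} => hΓ.mul_rpow_ge (s := s) (t := t) fun s hs => (h s hs).2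
  obtain ⟨N, hN⟩ := exists_nat_ge C
  have hstep : ∀ m : ℤ, Γ (2 ^ (m + 1)) ≤ 2 ^ N * Γ (2 ^ m) := fun m => by
    have h1 := hgrow (s := (2 : ℝ) ^ m) (t := 2 ^ (m + 1)) (by positivity)
      (zpow_le_zpow_right₀ (by norm_num) (by simp))
    rw [zpow_add_one₀ two_ne_zero, Real.mul_rpow (by positivity) (by norm_num)] at h1
    have h2 : Γ (2 ^ m * 2) ≤ Γ (2 ^ m) * 2 ^ C := by
      have h3 : (0 : ℝ) < ((2 : ℝ) ^ m) ^ C := by positivity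
      nlinarith
    rw [zpow_add_one₀ two_ne_zero, mul_comm (2 ^ N)]
    refine h2.trans (mul_le_mul_of_nonneg_left ?_ (hΓ.pos (by positivity)).le)
    rw [← Real.rpow_natCast]
    exact Real.rpow_le_rpow_of_exponent_le (by norm_num) hN
  have hdist : ∀ i j : ℤ, kstar Γ i = kstar Γ j → i < j + N := fun i j hij => by
    have h1 := (hΓ.kstar_spec i).1
    have h2 := (hΓ.kstar_spec j).2
    have h3 := hstep (kstar Γ j)
    rw [hij] at h1
    have h4 : 0 < Γ (2 ^ kstar Γ j) := hΓ.pos (by positivity)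
    have h5 : (2 : ℝ) ^ i < 2 ^ (j + (N : ℤ)) := by
      rw [zpow_add₀ two_ne_zero, zpow_natCast]
      refine lt_of_mul_lt_mul_right ?_ h4.le
      calc _ ≤ (1 : ℝ) := h1
        _ < _ := h2
        _ ≤ 2 ^ j * (2 ^ N * Γ (2 ^ kstar Γ j)) := by gcongr
        _ = _ := by ring
    exact (zpow_lt_zpow_iff_right₀ (by norm_num)).1 h5
  refine ⟨2 * N + 1, fun J l s => ?_⟩
  rcases (Finset.univ.filter fun j : J => l + kstar Γ j = s).eq_empty_or_nonempty with he | ⟨i, hi⟩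
  · rw [he]; simp
  have hi' : l + kstar Γ i = s := by simpa using hi
  calc _ = ((Finset.univ.filter fun j : J => l + kstar Γ j = s).map
          (Function.Embedding.subtype _)).card := (Finset.card_map _).symm
    _ ≤ (Finset.Icc ((i : ℤ) - N) (i + N)).card := by
        refine Finset.card_le_card fun j hj => ?_
        simp only [Finset.mem_map, Finset.mem_filter, Finset.mem_univ, true_and] at hj
        obtain ⟨j', hj', rfl⟩ := hj
        have h1 := hdist i j' (by linarith)
        have h2 := hdist j' i (by linarith)
        simp only [Function.Embedding.subtype_apply, Finset.mem_Icc]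
        constructor <;> linarith
    _ ≤ _ := by
        rw [Int.card_Icc]
        omega

/-- Size of the phase on the support of the kernels with `l ≤ 0`. -/
theorem exists_phase_le (hΓ : IsGammaU Γ) : ∃ c > (0 : ℝ), ∃ D > (0 : ℝ), ∀ (l j : ℤ), l ≤ 0 →
    ∀ s : ℝ, 0 ≤ s → s ≤ 2 → (2 : ℝ) ^ j * Γ (2 ^ (l + kstar Γ j) * s) ≤ D * 2 ^ (c * l) := by
  obtain ⟨c, hc, C, hC, h⟩ := hΓ.exists_deriv_bounds
  refine ⟨c, hc, 2 ^ C, by positivity, fun l j hl s hs hs2 => ?_⟩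
  set m := kstar Γ j
  have hlow := hΓ.mul_rpow_le (s := (2 : ℝ) ^ (l + m + 1)) (t := 2 ^ (m + 1))
    (fun s hs => (h s hs).1) (by positivity) (zpow_le_zpow_right₀ (by norm_num) (by linarith))
  have hup := hΓ.mul_rpow_ge (s := (2 : ℝ) ^ m) (t := 2 ^ (m + 1)) (fun s hs => (h s hs).2)
    (by positivity) (zpow_le_zpow_right₀ (by norm_num) (by simp))
  rw [zpow_add_one₀ two_ne_zero m, Real.mul_rpow (by positivity) (by norm_num)] at hup
  have hup' : Γ (2 ^ m * 2) ≤ Γ (2 ^ m) * 2 ^ C := by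
    have h3 : (0 : ℝ) < ((2 : ℝ) ^ m) ^ C := by positivity
    nlinarith
  have hlow' : Γ (2 ^ (l + m + 1)) ≤ Γ (2 ^ m * 2) * 2 ^ (c * l) := by
    have h1 : ((2 : ℝ) ^ (l + m + 1)) ^ c = 2 ^ (c * l) * (2 ^ (m + 1)) ^ c := by
      rw [← Real.rpow_intCast, ← Real.rpow_intCast, ← Real.rpow_mul (by norm_num),
        ← Real.rpow_mul (by norm_num), ← Real.rpow_add (by norm_num)]
      congr 1; push_cast; ring
    rw [h1, zpow_add_one₀ two_ne_zero m] at hlow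
    have h3 : (0 : ℝ) < ((2 : ℝ) ^ m * 2) ^ c := by positivity
    nlinarith
  have hmon : Γ (2 ^ (l + m) * s) ≤ Γ (2 ^ (l + m + 1)) := by
    refine hΓ.strictMonoOn.monotoneOn (mem_Ici.2 (by positivity)) (mem_Ici.2 (by positivity)) ?_
    rw [zpow_add_one₀ two_ne_zero (l + m)]
    gcongr
  have h1 := (hΓ.kstar_spec j).1
  calc (2 : ℝ) ^ j * Γ (2 ^ (l + m) * s)
      ≤ 2 ^ j * (Γ (2 ^ m) * 2 ^ C * 2 ^ (c * l)) := by
        refine mul_le_mul_of_nonneg_left ?_ (by positivity)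
        refine hmon.trans (hlow'.trans ?_)
        gcongr
    _ = (2 ^ j * Γ (2 ^ m)) * (2 ^ C * 2 ^ (c * l)) := by ring
    _ ≤ 1 * (2 ^ C * 2 ^ (c * l)) := by gcongr
    _ = _ := one_mul _

end IsGammaU

/-- The product of a radial function and a homogeneous function of mean value zero on the sphere
has vanishing integral. -/
theorem integral_radial_mul_eq_zero {n : ℕ} [Nontrivial (Rn n)] {Ω : Rn n → ℝ}
    (hhom : ∀ c : ℝ, 0 < c → ∀ t : Rn n, Ω (c • t) = Ω t)
    (hΩ : ∫ θ : Metric.sphere (0 : Rn n) 1, Ω θ ∂((volume : Measure (Rn n)).toSphere) = 0)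
    (a : ℝ → ℝ) : ∫ t : Rn n, Ω t * a ‖t‖ = 0 := by
  calc ∫ t : Rn n, Ω t * a ‖t‖
      = ∫ t : ({(0)}ᶜ : Set (Rn n)), Ω t.1 * a ‖t.1‖ ∂((volume : Measure (Rn n)).comap (↑)) := by
        rw [integral_subtype_comap (measurableSet_singleton _).compl fun t : Rn n => Ω t * a ‖t‖,
          restrict_compl_singleton]
    _ = ∫ z, Ω z.1 * a z.2 ∂(volume : Measure (Rn n)).toSphere.prod
          (.volumeIoiPow (Module.finrank ℝ (Rn n) - 1)) := by
        rw [← (volume : Measure (Rn n)).measurePreserving_homeomorphUnitSphereProd.integral_comp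
          (Homeomorph.measurableEmbedding _)]
        refine integral_congr_ae (ae_of_all _ fun t => ?_)
        have ht : 0 < ‖t.1‖ := norm_pos_iff.2 t.2
        simp only [homeomorphUnitSphereProd_apply_fst_coe, homeomorphUnitSphereProd_apply_snd_coe]
        rw [hhom _ (inv_pos.2 ht)]
    _ = 0 := by
        rw [integral_prod_mul (fun θ : Metric.sphere (0 : Rn n) 1 => Ω θ)
          (fun s : Ioi (0 : ℝ) => a s), hΩ, zero_mul]

theorem isBumpKernel_comp_smul {n : ℕ} {A : ℝ} (hA : 0 ≤ A) (σ : ℤ) {k₀ : Rn n → ℝ}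
    (hsupp : ∀ v, k₀ v ≠ 0 → ‖v‖ ≤ 2) (hbound : ∀ v, |k₀ v| ≤ A)
    (hlip : ∀ v v', |k₀ v - k₀ v'| ≤ A * ‖v - v'‖)
    (hInt : ∫ t, k₀ ((2 : ℝ) ^ (-σ) • t) = 0) :
    IsBumpKernel A σ fun t => ((2 : ℝ) ^ σ)⁻¹ ^ n * k₀ ((2 : ℝ) ^ (-σ) • t) where
  continuous := by
    have : LipschitzWith A.toNNReal k₀ := LipschitzWith.of_dist_le_mul fun v v' => by
      rw [Real.dist_eq, dist_eq_norm, Real.coe_toNNReal _ hA]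
      exact hlip v v'
    exact continuous_const.mul (this.continuous.comp (by fun_prop))
  norm_le t ht := by
    have h := hsupp _ (right_ne_zero_of_mul ht)
    rw [norm_smul, Real.norm_of_nonneg (by positivity), zpow_neg, inv_mul_le_iff₀ (by positivity)]
      at h
    linarith
  bound t := by
    rw [abs_mul, abs_of_pos (by positivity), mul_right_comm, ← mul_pow,
      inv_mul_cancel₀ (by positivity), one_pow, one_mul]
    exact hbound _
  lipschitz t t' := by
    have h := hlip ((2 : ℝ) ^ (-σ) • t) ((2 : ℝ) ^ (-σ) • t')
    rw [← smul_sub, norm_smul, Real.norm_of_nonneg (by positivity), zpow_neg] at h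
    rw [← mul_sub, abs_mul, abs_of_pos (by positivity), pow_succ, zpow_neg]
    calc _ = (((2 : ℝ) ^ σ)⁻¹ * 2 ^ σ) ^ n * 2 ^ σ *
          |k₀ (((2 : ℝ) ^ σ)⁻¹ • t) - k₀ (((2 : ℝ) ^ σ)⁻¹ • t')| := by rw [mul_pow]; ring
      _ = 2 ^ σ * |k₀ (((2 : ℝ) ^ σ)⁻¹ • t) - k₀ (((2 : ℝ) ^ σ)⁻¹ • t')| := by
          rw [inv_mul_cancel₀ (by positivity), one_pow, one_mul]
      _ ≤ 2 ^ σ * (A * (((2 : ℝ) ^ σ)⁻¹ * ‖t - t'‖)) := by gcongr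
      _ = _ := by field_simp
  integral_eq_zero := by rw [integral_const_mul, hInt, mul_zero]

/-- A smooth homogeneous function truncated to an annulus is bounded and Lipschitz. -/
theorem exists_annulus_kernel_bounds {n : ℕ} {Ω : Rn n → ℝ}
    (hΩ : ContDiffOn ℝ (⊤ : ℕ∞) Ω {x : Rn n | x ≠ 0}) {ψ : ℝ → ℝ} (hψ : IsLPCutoff ψ) :
    ∃ B > (0 : ℝ), (∀ v, |ψ ‖v‖ * (Ω v / ‖v‖ ^ n)| ≤ B) ∧
      ∀ v v', |ψ ‖v‖ * (Ω v / ‖v‖ ^ n) - ψ ‖v'‖ * (Ω v' / ‖v'‖ ^ n)| ≤ B * ‖v - v'‖ := by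
  set w : Rn n → ℝ := fun v => ψ ‖v‖ * (Ω v / ‖v‖ ^ n) with hw
  have hzero : ∀ v, w v ≠ 0 → 1 / 2 ≤ ‖v‖ ∧ ‖v‖ ≤ 2 := fun v hv => by
    simpa using hψ.2.2.1 _ (left_ne_zero_of_mul hv)
  have hsupp : HasCompactSupport w :=
    HasCompactSupport.intro (isCompact_closedBall (0 : Rn n) 2) fun t ht => by
      by_contra hc
      exact ht (mem_closedBall_zero_iff.2 (hzero t hc).2)
  have hcd : ContDiff ℝ 1 w := by
    rw [contDiff_iff_contDiffAt]
    intro v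
    rcases eq_or_ne v 0 with rfl | hv
    · have : w =ᶠ[𝓝 0] fun _ => 0 := by
        filter_upwards [Metric.ball_mem_nhds (0 : Rn n) (by norm_num : (0 : ℝ) < 1 / 2)] with t ht
        by_contra hc
        have := (hzero t hc).1
        rw [mem_ball_zero_iff] at ht
        linarith
      exact contDiffAt_const.congr_of_eventuallyEq this
    · have h1 : ContDiffAt ℝ 1 (fun v : Rn n => ‖v‖) v := contDiffAt_norm ℝ hv
      have h2 : ContDiffAt ℝ 1 Ω v :=
        (hΩ.contDiffAt (isOpen_ne.mem_nhds hv)).of_le (by exact_mod_cast le_top)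
      have h3 : ContDiff ℝ 1 ψ := hψ.1.of_le (by exact_mod_cast le_top)
      exact (h3.contDiffAt.comp v h1).mul
        (h2.div (h1.pow n) (pow_ne_zero _ (norm_ne_zero_iff.2 hv)))
  obtain ⟨B₁, hB₁⟩ := hcd.continuous.bounded_above_of_compact_support hsupp
  obtain ⟨B₂, hB₂⟩ := hcd.lipschitzWith_of_hasCompactSupport hsupp one_ne_zero
  have hB₁0 : 0 ≤ B₁ := (norm_nonneg _).trans (hB₁ 0)
  refine ⟨B₁ + B₂ + 1, by positivity, fun v => ?_, fun v v' => ?_⟩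
  · have := hB₁ v
    rw [Real.norm_eq_abs] at this
    have h2 : (0 : ℝ) ≤ B₂ := B₂.2
    linarith
  · have := hB₂.dist_le_mul v v'
    rw [Real.dist_eq, dist_eq_norm] at this
    refine this.trans (mul_le_mul_of_nonneg_right ?_ (norm_nonneg _))
    linarith

theorem abs_pow_mul_sub_pow_mul_le {n : ℕ} {w : Rn n → ℝ} {φ : ℝ → ℝ} {B L δ : ℝ} (hδ : 0 ≤ δ)
    (hB : 0 ≤ B) (hL : 0 ≤ L) (m : ℕ)
    (hw0 : ∀ v, w v ≠ 0 → 1 / 2 ≤ ‖v‖ ∧ ‖v‖ ≤ 2) (hw : ∀ v, |w v| ≤ B)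
    (hw' : ∀ v v', |w v - w v'| ≤ B * ‖v - v'‖)
    (hφ : ∀ s ∈ Icc (1 / 2 : ℝ) 2, |φ s| ≤ δ)
    (hφ' : ∀ s ∈ Icc (1 / 2 : ℝ) 2, ∀ t ∈ Icc (1 / 2 : ℝ) 2, |φ s - φ t| ≤ L * δ * |s - t|)
    (v v' : Rn n) :
    |φ ‖v‖ ^ m * w v - φ ‖v'‖ ^ m * w v'| ≤ B * (L + 1) * (m + 1) * δ ^ m * ‖v - v'‖ := by
  have h1 : B * δ ^ m ≤ B * (L + 1) * (m + 1) * δ ^ m := by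
    have h2 : (1 : ℝ) ≤ (L + 1) * (m + 1) := by
      have : (0 : ℝ) ≤ m := by positivity
      nlinarith
    have h3 : 0 ≤ B * δ ^ m := by positivity
    nlinarith
  have hside : ∀ v v', w v' = 0 → |φ ‖v‖ ^ m * w v| ≤
      B * (L + 1) * (m + 1) * δ ^ m * ‖v - v'‖ := fun v v' h0 => by
    rcases eq_or_ne (w v) 0 with h | h
    · rw [h, mul_zero, abs_zero]; positivity
    · have h4 := hw' v v'
      rw [h0, sub_zero] at h4
      rw [abs_mul, abs_pow]
      calc |φ ‖v‖| ^ m * |w v| ≤ δ ^ m * (B * ‖v - v'‖) := by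
            gcongr
            exact hφ _ (hw0 v h)
        _ = B * δ ^ m * ‖v - v'‖ := by ring
        _ ≤ _ := by gcongr
  rcases eq_or_ne (w v') 0 with h' | h'
  · rw [h', mul_zero, sub_zero]
    exact hside v v' h'
  rcases eq_or_ne (w v) 0 with h | h
  · rw [h, mul_zero, zero_sub, abs_neg, norm_sub_rev]
    exact hside v' v h
  have hv := hφ _ (hw0 v h)
  have hv' := hφ _ (hw0 v' h')
  have hd := hφ' _ (hw0 v h) _ (hw0 v' h')
  have hn : |‖v‖ - ‖v'‖| ≤ ‖v - v'‖ := abs_norm_sub_norm_le v v'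
  have hpow : |φ ‖v‖ ^ m - φ ‖v'‖ ^ m| ≤ m * L * δ ^ m * ‖v - v'‖ := by
    rcases Nat.eq_zero_or_pos m with rfl | hm
    · simp
    · refine (abs_pow_sub_pow_le _ _ _).trans ?_
      calc _ ≤ (L * δ * ‖v - v'‖) * m * δ ^ (m - 1) := by
            gcongr
            · exact hd.trans (by gcongr)
            · exact max_le hv hv'
        _ = m * L * (δ ^ (m - 1) * δ) * ‖v - v'‖ := by ring
        _ = _ := by rw [← pow_succ, Nat.sub_add_cancel hm]
  calc |φ ‖v‖ ^ m * w v - φ ‖v'‖ ^ m * w v'|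
      = |(φ ‖v‖ ^ m - φ ‖v'‖ ^ m) * w v + φ ‖v'‖ ^ m * (w v - w v')| := by ring_nf
    _ ≤ |φ ‖v‖ ^ m - φ ‖v'‖ ^ m| * |w v| + |φ ‖v'‖| ^ m * |w v - w v'| := by
        refine (abs_add_le _ _).trans (le_of_eq ?_)
        rw [abs_mul, abs_mul, abs_pow]
    _ ≤ (m * L * δ ^ m * ‖v - v'‖) * B + δ ^ m * (B * ‖v - v'‖) := by
        gcongr
        · exact hw v
        · exact hw' v v'
    _ = B * δ ^ m * ‖v - v'‖ * (m * L + 1) := by ring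
    _ ≤ B * δ ^ m * ‖v - v'‖ * ((L + 1) * (m + 1)) := by
        refine mul_le_mul_of_nonneg_left ?_ (by positivity)
        have : (0 : ℝ) ≤ m := by positivity
        nlinarith
    _ = _ := by ring

/-- The kernel of the `m`-th Taylor coefficient of the multiplier-localised operator. -/
def phaseKernel {n : ℕ} (Γ : ℝ → ℝ) (K : Rn n → ℝ) (ψ : ℝ → ℝ) (j l : ℤ) (m : ℕ) (t : Rn n) : ℝ :=
  ((2 : ℝ) ^ j * Γ ‖t‖) ^ m * (ψ ((2 : ℝ) ^ (-(l + kstar Γ j)) * ‖t‖) * K t)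

theorem exists_isBumpKernel_phaseKernel {n : ℕ} (hn : n ≠ 0) {Γ : ℝ → ℝ} (hΓ : IsGammaU Γ)
    {K : Rn n → ℝ} (hK : IsHomCZKernel n K) {ψ : ℝ → ℝ} (hψ : IsLPCutoff ψ) :
    ∃ c > (0 : ℝ), ∃ D > (0 : ℝ), ∃ B > (0 : ℝ), ∀ l : ℤ, l ≤ 0 → ∀ (j : ℤ) (m : ℕ),
      IsBumpKernel (B * (m + 1) * (D * 2 ^ (c * l)) ^ m) (l + kstar Γ j)
        (phaseKernel Γ K ψ j l m) := by
  have : Nontrivial (Rn n) := by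
    have : Nonempty (Fin n) := ⟨⟨0, Nat.pos_of_ne_zero hn⟩⟩
    infer_instance
  obtain ⟨c, hc, D, hD, hphase⟩ := hΓ.exists_phase_le
  obtain ⟨_, _, C, hC, hderiv⟩ := hΓ.exists_deriv_bounds
  obtain ⟨Ω, hΩ, hhom, hmean, hKΩ⟩ := hK
  obtain ⟨B, hB, hw, hw'⟩ := exists_annulus_kernel_bounds hΩ hψ
  refine ⟨c, hc, D, hD, B * (2 * C + 1), by positivity, fun l hl j m => ?_⟩
  set σ := l + kstar Γ j
  set δ : ℝ := D * 2 ^ (c * l)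
  have hδ : 0 < δ := by positivity
  set w : Rn n → ℝ := fun v => ψ ‖v‖ * (Ω v / ‖v‖ ^ n)
  set φ : ℝ → ℝ := fun s => 2 ^ j * Γ (2 ^ σ * s)
  have hψ0 : ψ 0 = 0 := by
    by_contra h
    have := (hψ.2.2.1 0 h).1
    norm_num at this
  have hw0 : ∀ v, w v ≠ 0 → 1 / 2 ≤ ‖v‖ ∧ ‖v‖ ≤ 2 := fun v hv => by
    simpa using hψ.2.2.1 _ (left_ne_zero_of_mul hv)
  have hφ0 : ∀ s, 0 ≤ s → 0 ≤ φ s := fun s hs => by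
    have := hΓ.nonneg (s := 2 ^ σ * s) (by positivity)
    positivity
  have hφ : ∀ s ∈ Icc (1 / 2 : ℝ) 2, |φ s| ≤ δ := fun s hs => by
    have h0 : (0 : ℝ) ≤ s := by linarith [hs.1]
    rw [abs_of_nonneg (hφ0 s h0)]
    exact hphase l j hl s h0 hs.2
  have hφd : ∀ s ∈ Icc (1 / 2 : ℝ) 2, HasDerivWithinAt φ (2 ^ j * (deriv Γ (2 ^ σ * s) * 2 ^ σ))
      (Icc (1 / 2 : ℝ) 2) s := fun s hs => by
    have h0 : (0 : ℝ) < s := by linarith [hs.1]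
    have h1 : HasDerivAt (fun s : ℝ => (2 : ℝ) ^ σ * s) (2 ^ σ) s := by
      simpa using (hasDerivAt_id s).const_mul ((2 : ℝ) ^ σ)
    exact (((hΓ.differentiableAt (by positivity)).hasDerivAt.comp s h1).const_mul
      _).hasDerivWithinAt
  have hφ' : ∀ s ∈ Icc (1 / 2 : ℝ) 2, ∀ t ∈ Icc (1 / 2 : ℝ) 2,
      |φ s - φ t| ≤ 2 * C * δ * |s - t| := fun s hs t ht => by
    refine (convex_Icc (1 / 2 : ℝ) 2).norm_image_sub_le_of_norm_hasDerivWithin_le hφd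
      (fun x hx => ?_) ht hs
    have h0 : (0 : ℝ) < x := by linarith [hx.1]
    have h1 := (hderiv (2 ^ σ * x) (by positivity)).2
    have h2 := hΓ.deriv_pos (2 ^ σ * x) (by positivity)
    have h3 := hphase l j hl x h0.le hx.2
    rw [Real.norm_of_nonneg (by positivity)]
    have h4 : (2 : ℝ) ^ j * (deriv Γ (2 ^ σ * x) * 2 ^ σ) * x ≤ C * δ := by
      calc _ = (2 : ℝ) ^ j * (2 ^ σ * x * deriv Γ (2 ^ σ * x)) := by ring
        _ ≤ 2 ^ j * (C * Γ (2 ^ σ * x)) := by gcongr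
        _ = C * (2 ^ j * Γ (2 ^ σ * x)) := by ring
        _ ≤ _ := by gcongr
    have h5 : 0 ≤ (2 : ℝ) ^ j * (deriv Γ (2 ^ σ * x) * 2 ^ σ) := by positivity
    nlinarith [hx.1]
  have hform : ∀ t, ((2 : ℝ) ^ σ)⁻¹ ^ n *
      (φ ‖(2 : ℝ) ^ (-σ) • t‖ ^ m * w ((2 : ℝ) ^ (-σ) • t)) = phaseKernel Γ K ψ j l m t := by
    intro t
    rcases eq_or_ne t 0 with rfl | ht
    · simp [phaseKernel, w, hψ0]
    have ht' : ‖t‖ ≠ 0 := norm_ne_zero_iff.2 ht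
    have h1 : ‖(2 : ℝ) ^ (-σ) • t‖ = 2 ^ (-σ) * ‖t‖ := by
      rw [norm_smul, Real.norm_of_nonneg (by positivity)]
    have h2 : (2 : ℝ) ^ σ * (2 ^ (-σ) * ‖t‖) = ‖t‖ := by
      rw [zpow_neg, mul_inv_cancel_left₀ (by positivity)]
    simp only [phaseKernel, w, φ, h1, h2, hhom _ (by positivity : (0 : ℝ) < 2 ^ (-σ)), hKΩ t ht]
    change _ = ((2 : ℝ) ^ j * Γ ‖t‖) ^ m * (ψ ((2 : ℝ) ^ (-σ) * ‖t‖) * (Ω t / ‖t‖ ^ n))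
    rw [mul_pow _ ‖t‖, zpow_neg]
    field_simp
  have hmain := isBumpKernel_comp_smul (A := B * (2 * C + 1) * (m + 1) * δ ^ m)
    (by positivity) σ (k₀ := fun v => φ ‖v‖ ^ m * w v)
    (fun v hv => (hw0 v (right_ne_zero_of_mul hv)).2)
    (fun v => ?_)
    (abs_pow_mul_sub_pow_mul_le hδ.le hB.le (by positivity) m hw0 hw hw' hφ hφ') ?_
  · simp only [hform] at hmain
    exact hmain
  · rcases eq_or_ne (w v) 0 with h | h
    · rw [h, mul_zero, abs_zero]; positivity
    · rw [abs_mul, abs_pow]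
      calc |φ ‖v‖| ^ m * |w v| ≤ δ ^ m * B := by
            gcongr
            · exact hφ _ (hw0 v h)
            · exact hw v
        _ = B * δ ^ m * 1 := by ring
        _ ≤ B * δ ^ m * ((2 * C + 1) * (m + 1)) := by
            refine mul_le_mul_of_nonneg_left ?_ (by positivity)
            have : (0 : ℝ) ≤ m := by positivity
            nlinarith
        _ = _ := by ring
  · have h1 : ∀ t : Rn n, φ ‖(2 : ℝ) ^ (-σ) • t‖ ^ m * w ((2 : ℝ) ^ (-σ) • t) =
        Ω t * (fun s => φ (2 ^ (-σ) * s) ^ m * (ψ (2 ^ (-σ) * s) / (2 ^ (-σ) * s) ^ n)) ‖t‖ := by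
      intro t
      have h1 : ‖(2 : ℝ) ^ (-σ) • t‖ = 2 ^ (-σ) * ‖t‖ := by
        rw [norm_smul, Real.norm_of_nonneg (by positivity)]
      simp only [w, h1, hhom _ (by positivity : (0 : ℝ) < 2 ^ (-σ))]
      ring
    simp only [h1]
    exact integral_radial_mul_eq_zero hhom hmean fun s =>
      φ (2 ^ (-σ) * s) ^ m * (ψ (2 ^ (-σ) * s) / (2 ^ (-σ) * s) ^ n)

/-- `L^r` bound, `r ≥ 2`, for the inverse Fourier transform of a bounded function supported in
an interval. -/
theorem eLpNorm_fourierInv_le {m : ℝ → ℂ} {a R r : ℝ} (ha : 0 ≤ a) (hR : 1 ≤ 2 * R)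
    (hm : ∀ τ, ‖m τ‖ ≤ a) (hsupp : ∀ τ, m τ ≠ 0 → |τ| ≤ R) (hr : 2 ≤ r) :
    eLpNorm (𝓕⁻ m) (ENNReal.ofReal r) volume ≤ ENNReal.ofReal (2 * R * a) := by
  have hr0 : 0 < r := by linarith
  have hRpos : 0 ≤ R := by linarith
  by_cases hmi : Integrable m
  swap
  · have h0 : 𝓕⁻ m = 0 := by
      ext x
      rw [Real.fourierInv_eq_fourier_neg, Real.fourier_eq]
      exact integral_undef fun h => hmi ((Real.fourierIntegral_convergent_iff _).1 h)
    rw [h0, eLpNorm_zero]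
    exact zero_le
  have hlint : ∀ s : ℝ, 0 < s → ∫⁻ τ, ‖m τ‖ₑ ^ s ≤ ENNReal.ofReal (2 * R * a ^ s) := fun s hs => by
    have hset : (Function.support fun τ => ‖m τ‖ₑ ^ s) ⊆ Icc (-R) R := fun τ hτ => by
      refine abs_le.1 (hsupp τ fun h => hτ ?_)
      simp [h, hs]
    rw [← setLIntegral_eq_of_support_subset hset]
    calc _ ≤ ∫⁻ _ in Icc (-R) R, ENNReal.ofReal (a ^ s) := by
          refine lintegral_mono fun τ => ?_
          rw [← ofReal_norm, ENNReal.ofReal_rpow_of_nonneg (norm_nonneg _) hs.le]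
          exact ENNReal.ofReal_le_ofReal (Real.rpow_le_rpow (norm_nonneg _) (hm τ) hs.le)
      _ = _ := by
          rw [setLIntegral_const, Real.volume_Icc, ← ENNReal.ofReal_mul (by positivity)]
          congr 1; ring
  have hsup : ∀ x, ‖𝓕⁻ m x‖ₑ ≤ ENNReal.ofReal (2 * R * a) := fun x => by
    have h1 := hlint 1 one_pos
    simp only [ENNReal.rpow_one, Real.rpow_one] at h1
    refine le_trans ?_ h1
    rw [Real.fourierInv_eq]
    refine (enorm_integral_le_lintegral_enorm _).trans (le_of_eq ?_)
    refine lintegral_congr fun τ => ?_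
    rw [← ofReal_norm, Circle.norm_smul, ofReal_norm]
  have hm2 : MemLp m 2 volume := by
    refine ⟨hmi.1, ?_⟩
    rw [eLpNorm_eq_lintegral_rpow_enorm_toReal two_ne_zero ENNReal.ofNat_ne_top]
    refine ENNReal.rpow_lt_top_of_nonneg (by simp) (ne_of_lt ?_)
    exact (hlint _ (by simp)).trans_lt ENNReal.ofReal_lt_top
  have hplanch : ∫⁻ x, ‖𝓕⁻ m x‖ₑ ^ (2 : ℝ) ≤ ENNReal.ofReal (2 * R * a ^ (2 : ℝ)) := by
    have hcont : Continuous (𝓕 m) := VectorFourier.fourierIntegral_continuous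
      Real.continuous_fourierChar (innerSL ℝ).continuous₂ hmi
    have h1 : ∫⁻ x, ‖𝓕⁻ m x‖ₑ ^ (2 : ℝ) = ∫⁻ x, ‖𝓕 m x‖ₑ ^ (2 : ℝ) := by
      simp only [Real.fourierInv_eq_fourier_neg]
      exact lintegral_neg_eq_self fun x => ‖𝓕 m x‖ₑ ^ (2 : ℝ)
    have h2 := eLpNorm_fourier_of_integrable hmi hm2
    rw [eLpNorm_eq_lintegral_rpow_enorm_toReal two_ne_zero ENNReal.ofNat_ne_top,
      eLpNorm_eq_lintegral_rpow_enorm_toReal two_ne_zero ENNReal.ofNat_ne_top] at h2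
    have h3 := ENNReal.rpow_left_injective (by simp) h2
    simp only [ENNReal.toReal_ofNat] at h3
    rw [h1, h3]
    exact hlint 2 two_pos
  rw [eLpNorm_eq_lintegral_rpow_enorm_toReal (by simpa using hr0) ENNReal.ofReal_ne_top,
    ENNReal.toReal_ofReal hr0.le]
  calc (∫⁻ x, ‖𝓕⁻ m x‖ₑ ^ r) ^ (1 / r) ≤ (ENNReal.ofReal (2 * R * a) ^ r) ^ (1 / r) := by
        refine ENNReal.rpow_le_rpow ?_ (by positivity)
        calc ∫⁻ x, ‖𝓕⁻ m x‖ₑ ^ r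
            ≤ ∫⁻ x, ENNReal.ofReal (2 * R * a) ^ (r - 2) * ‖𝓕⁻ m x‖ₑ ^ (2 : ℝ) := by
              refine lintegral_mono fun x => ?_
              calc ‖𝓕⁻ m x‖ₑ ^ r = ‖𝓕⁻ m x‖ₑ ^ (r - 2) * ‖𝓕⁻ m x‖ₑ ^ (2 : ℝ) := by
                    rw [← ENNReal.rpow_add_of_nonneg _ _ (by linarith) (by norm_num)]
                    congr 1; ring
                _ ≤ _ := mul_le_mul' (ENNReal.rpow_le_rpow (hsup x) (by linarith)) le_rfl
          _ = ENNReal.ofReal (2 * R * a) ^ (r - 2) * ∫⁻ x, ‖𝓕⁻ m x‖ₑ ^ (2 : ℝ) :=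
              lintegral_const_mul' _ _
                (ENNReal.rpow_ne_top_of_nonneg (by linarith) ENNReal.ofReal_ne_top)
          _ ≤ ENNReal.ofReal (2 * R * a) ^ (r - 2) * ENNReal.ofReal (2 * R * a) ^ (2 : ℝ) := by
              refine mul_le_mul' le_rfl (hplanch.trans ?_)
              rw [ENNReal.ofReal_rpow_of_nonneg (by positivity) (by norm_num)]
              refine ENNReal.ofReal_le_ofReal ?_
              simp only [Real.rpow_two]
              have : 0 ≤ a ^ 2 := by positivity
              nlinarith [mul_nonneg this (by linarith : 0 ≤ 2 * R)]
          _ = _ := by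
              rw [← ENNReal.rpow_add_of_nonneg _ _ (by linarith) (by norm_num)]
              congr 1; ring
    _ = _ := by
        rw [← ENNReal.rpow_mul, mul_one_div_cancel hr0.ne', ENNReal.rpow_one]

theorem IsLPCutoff.apply_zero {ψ : ℝ → ℝ} (hψ : IsLPCutoff ψ) : ψ 0 = 0 := by
  by_contra h
  have := (hψ.2.2.1 0 h).1
  norm_num at this

theorem IsLPCutoff.low_mem_Icc {ψ : ℝ → ℝ} (hψ : IsLPCutoff ψ) (τ : ℝ) :
    1 - ∑' i : ℕ, ψ ((2 : ℝ) ^ (-(i : ℤ)) * |τ|) ∈ Icc (0 : ℝ) 1 := by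
  rcases eq_or_ne τ 0 with rfl | hτ
  · simp [hψ.apply_zero]
  have h1 := hψ.2.2.2 |τ| (abs_ne_zero.2 hτ)
  have h2 : Summable fun i : ℕ => ψ ((2 : ℝ) ^ (-(i : ℤ)) * |τ|) :=
    h1.summable.comp_injective (i := fun i : ℕ => (i : ℤ)) Nat.cast_injective
  have h3 : ∑' i : ℕ, ψ ((2 : ℝ) ^ (-(i : ℤ)) * |τ|) ≤ 1 :=
    hasSum_le_inj (fun i : ℕ => (i : ℤ)) Nat.cast_injective (fun c _ => (hψ.2.1 _).1)
      (fun i => le_rfl) h2.hasSum h1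
  have h4 : 0 ≤ ∑' i : ℕ, ψ ((2 : ℝ) ^ (-(i : ℤ)) * |τ|) := tsum_nonneg fun i => (hψ.2.1 _).1
  constructor <;> linarith

theorem IsLPCutoff.abs_le_one_of_low_ne_zero {ψ : ℝ → ℝ} (hψ : IsLPCutoff ψ) {τ : ℝ}
    (h : 1 - ∑' i : ℕ, ψ ((2 : ℝ) ^ (-(i : ℤ)) * |τ|) ≠ 0) : |τ| ≤ 1 := by
  by_contra! hτ
  refine h ?_
  have h1 := hψ.2.2.2 |τ| (by positivity)
  have h2 : HasSum (fun i : ℕ => ψ ((2 : ℝ) ^ (-(i : ℤ)) * |τ|)) 1 := by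
    refine (Function.Injective.hasSum_iff (g := fun i : ℕ => (i : ℤ)) Nat.cast_injective
      fun l hl => ?_).2 h1
    by_contra hc
    have h3 := (hψ.2.2.1 _ hc).2
    have hl' : l ≤ -1 := by
      by_contra! hl'
      exact hl ⟨l.toNat, Int.toNat_of_nonneg (by omega)⟩
    rw [abs_of_pos (by positivity)] at h3
    have h4 : (2 : ℝ) ^ (1 : ℤ) ≤ 2 ^ (-l) := zpow_le_zpow_right₀ (by norm_num) (by omega)
    rw [zpow_one] at h4
    nlinarith
  rw [h2.tsum_eq, sub_self]

/-- A function whose Fourier transform decays quadratically has finite Besov norm. -/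
theorem exists_besovNorm_le {ψ : ℝ → ℝ} (hψ : IsLPCutoff ψ) {r : ℝ} (hr : 2 ≤ r) :
    ∃ C > (0 : ℝ), ∀ {g : ℝ → ℂ} {A : ℝ} (_ : ∀ τ, ‖𝓕 g τ‖ ≤ A) (_ : ∀ τ, τ ^ 2 * ‖𝓕 g τ‖ ≤ A),
      besovNorm ψ r g ≤ ENNReal.ofReal (C * A) := by
  set q : ℝ := 2 ^ (-(1 / 2) : ℝ)
  have hq0 : 0 < q := by positivity
  have hq1 : q < 1 := Real.rpow_lt_one_of_one_lt_of_neg (by norm_num) (by norm_num)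
  have hq1' : 0 < 1 - q := by linarith
  refine ⟨2 + 16 * (1 - q)⁻¹, by positivity, fun {g A} h1 h2 => ?_⟩
  have hA : 0 ≤ A := (norm_nonneg _).trans (h1 0)
  have hlow : eLpNorm (deltaLow ψ g) (ENNReal.ofReal r) volume ≤ ENNReal.ofReal (2 * A) := by
    have := eLpNorm_fourierInv_le (m := fun τ : ℝ =>
      Complex.ofReal (1 - ∑' i : ℕ, ψ ((2 : ℝ) ^ (-(i : ℤ)) * |τ|)) * 𝓕 g τ) (R := 1) hA
      (by norm_num) (fun τ => ?_) (fun τ hτ => ?_) hr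
    · rw [mul_one] at this
      exact this
    · have h3 := hψ.low_mem_Icc τ
      rw [norm_mul, Complex.norm_real, Real.norm_of_nonneg h3.1]
      exact (mul_le_of_le_one_left (norm_nonneg _) h3.2).trans (h1 τ)
    · refine hψ.abs_le_one_of_low_ne_zero fun h => left_ne_zero_of_mul hτ ?_
      rw [h, Complex.ofReal_zero]
  have hhigh : ∀ i : ℕ, eLpNorm (deltaHigh ψ i g) (ENNReal.ofReal r) volume ≤
      ENNReal.ofReal (16 * A * (2 ^ i)⁻¹) := fun i => by
    have h0 : ∀ τ : ℝ, ψ ((2 : ℝ) ^ (-(i : ℤ)) * |τ|) ≠ 0 → 2 ^ i ≤ 2 * |τ| ∧ |τ| ≤ 2 * 2 ^ i := by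
      intro τ hτ
      have h3 := hψ.2.2.1 _ hτ
      rw [abs_of_nonneg (by positivity), zpow_neg, zpow_natCast, inv_mul_eq_div] at h3
      have h4 := (le_div_iff₀ (by positivity)).1 h3.1
      have h5 := (div_le_iff₀ (by positivity)).1 h3.2
      constructor <;> linarith
    have h2i : (1 : ℝ) ≤ 2 ^ i := one_le_pow₀ (by norm_num)
    have := eLpNorm_fourierInv_le (m := fun τ : ℝ =>
      Complex.ofReal (ψ ((2 : ℝ) ^ (-(i : ℤ)) * |τ|)) * 𝓕 g τ) (R := 2 * 2 ^ i)
      (a := 4 * A / (2 ^ i) ^ 2) (by positivity)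
      (by linarith) (fun τ => ?_) (fun τ hτ => ?_) hr
    · refine this.trans (le_of_eq ?_)
      congr 1
      field_simp
      ring
    · rw [norm_mul, Complex.norm_real, Real.norm_of_nonneg (hψ.2.1 _).1]
      rcases eq_or_ne (ψ ((2 : ℝ) ^ (-(i : ℤ)) * |τ|)) 0 with h | h
      · rw [h, zero_mul]; positivity
      · rw [le_div_iff₀ (by positivity)]
        have h4 : ((2 : ℝ) ^ i) ^ 2 ≤ 4 * τ ^ 2 := by
          rw [← sq_abs τ]
          nlinarith [(h0 τ h).1]
        calc _ ≤ 1 * ‖𝓕 g τ‖ * (4 * τ ^ 2) := by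
              gcongr
              exact (hψ.2.1 _).2
          _ = 4 * (τ ^ 2 * ‖𝓕 g τ‖) := by ring
          _ ≤ _ := by gcongr; exact h2 τ
    · exact (h0 τ fun h => left_ne_zero_of_mul hτ (by rw [h, Complex.ofReal_zero])).2
  have hterm : ∀ i : ℕ, ENNReal.ofReal ((2 : ℝ) ^ ((i : ℝ) / r)) *
      eLpNorm (deltaHigh ψ i g) (ENNReal.ofReal r) volume ≤ ENNReal.ofReal (16 * A * q ^ i) := by
    intro i
    refine (mul_le_mul' le_rfl (hhigh i)).trans ?_
    rw [← ENNReal.ofReal_mul (by positivity)]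
    refine ENNReal.ofReal_le_ofReal ?_
    have h3 : (2 : ℝ) ^ ((i : ℝ) / r) ≤ 2 ^ ((i : ℝ) / 2) :=
      Real.rpow_le_rpow_of_exponent_le (by norm_num) (by gcongr)
    have h4 : (2 : ℝ) ^ ((i : ℝ) / 2) * (2 ^ i)⁻¹ = q ^ i := by
      rw [← Real.rpow_natCast, ← Real.rpow_natCast, ← Real.rpow_neg (by norm_num),
        ← Real.rpow_add (by norm_num), ← Real.rpow_mul (by norm_num)]
      congr 1; ring
    calc _ ≤ (2 : ℝ) ^ ((i : ℝ) / 2) * (16 * A * (2 ^ i)⁻¹) := by gcongr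
      _ = 16 * A * (2 ^ ((i : ℝ) / 2) * (2 ^ i)⁻¹) := by ring
      _ = _ := by rw [h4]
  have hsum : ∑' i : ℕ, ENNReal.ofReal ((2 : ℝ) ^ ((i : ℝ) / r)) *
      eLpNorm (deltaHigh ψ i g) (ENNReal.ofReal r) volume ≤
      ENNReal.ofReal (16 * (1 - q)⁻¹ * A) := by
    refine (ENNReal.tsum_le_tsum hterm).trans (le_of_eq ?_)
    rw [← ENNReal.ofReal_tsum_of_nonneg (fun i => by positivity)
      ((summable_geometric_of_lt_one hq0.le hq1).mul_left _), tsum_mul_left,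
      tsum_geometric_of_lt_one hq0.le hq1]
    congr 1; ring
  calc besovNorm ψ r g ≤ ENNReal.ofReal (2 * A) + ENNReal.ofReal (16 * (1 - q)⁻¹ * A) :=
        add_le_add hlow hsum
    _ = _ := by
        rw [← ENNReal.ofReal_add (by positivity) (by positivity)]
        congr 1; ring

theorem IsChiCutoff.abs_le_four {χ : ℝ → ℝ} (hχ : IsChiCutoff χ) {u : ℝ} (hu : χ u ≠ 0) :
    |u| ≤ 4 := by
  have h := hχ.2.2.1 u hu
  exact abs_le.2 ⟨by linarith [h.1], h.2⟩

theorem IsChiCutoff.hasCompactSupport {χ : ℝ → ℝ} (hχ : IsChiCutoff χ) : HasCompactSupport χ :=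
  HasCompactSupport.of_support_subset_isCompact isCompact_Icc fun u hu => hχ.2.2.1 u hu

/-- The Fourier transform of `χ(u) u^m` decays quadratically, with geometric growth in `m`. -/
theorem IsChiCutoff.exists_fourier_mul_pow_le {χ : ℝ → ℝ} (hχ : IsChiCutoff χ) :
    ∃ C > (0 : ℝ), ∀ (m : ℕ) (τ : ℝ),
      ‖𝓕 (fun u : ℝ => ((χ u * u ^ m : ℝ) : ℂ)) τ‖ ≤ C * ((m + 1) ^ 2 * 4 ^ m) ∧
      τ ^ 2 * ‖𝓕 (fun u : ℝ => ((χ u * u ^ m : ℝ) : ℂ)) τ‖ ≤ C * ((m + 1) ^ 2 * 4 ^ m) := by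
  have hd1 : ContDiff ℝ (⊤ : ℕ∞) (deriv χ) := (contDiff_infty_iff_deriv.1 hχ.1).2
  have hd2 : ContDiff ℝ (⊤ : ℕ∞) (deriv (deriv χ)) := (contDiff_infty_iff_deriv.1 hd1).2
  have hc0 := hχ.hasCompactSupport
  have hc1 : HasCompactSupport (deriv χ) := hc0.deriv
  have hc2 : HasCompactSupport (deriv (deriv χ)) := hc1.deriv
  obtain ⟨M₁, hM₁⟩ := hc1.exists_bound_of_continuous hd1.continuous
  obtain ⟨M₂, hM₂⟩ := hc2.exists_bound_of_continuous hd2.continuous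
  set M : ℝ := max 1 (max M₁ M₂)
  have hM0 : ∀ u, |χ u| ≤ M := fun u => by
    rw [abs_of_nonneg (hχ.2.1 u).1]
    exact (hχ.2.1 u).2.trans (le_max_left _ _)
  have hM1 : ∀ u, |deriv χ u| ≤ M := fun u =>
    (hM₁ u).trans ((le_max_left _ _).trans (le_max_right _ _))
  have hM2 : ∀ u, |deriv (deriv χ) u| ≤ M := fun u =>
    (hM₂ u).trans ((le_max_right _ _).trans (le_max_right _ _))
  have hMpos : 1 ≤ M := le_max_left _ _
  have hts : tsupport χ ⊆ Icc (1 / 2) 4 :=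
    closure_minimal (fun u hu => hχ.2.2.1 u hu) isClosed_Icc
  have hs1 : ∀ u, u ∉ Icc (1 / 2 : ℝ) 4 → deriv χ u = 0 := fun u hu =>
    by_contra fun h => hu (hts (support_deriv_subset h))
  have hs2 : ∀ u, u ∉ Icc (1 / 2 : ℝ) 4 → deriv (deriv χ) u = 0 := fun u hu =>
    by_contra fun h => hu (hts ((closure_minimal support_deriv_subset isClosed_closure)
      (support_deriv_subset h)))
  have hs0 : ∀ u, u ∉ Icc (1 / 2 : ℝ) 4 → χ u = 0 := fun u hu =>
    by_contra fun h => hu (hχ.2.2.1 u h)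
  refine ⟨4 * M, by positivity, fun m τ => ?_⟩
  set H0 : ℝ → ℝ := fun u => χ u * u ^ m with hH0
  set H1 : ℝ → ℝ := fun u => deriv χ u * u ^ m + χ u * (m * u ^ (m - 1)) with hH1
  set H2 : ℝ → ℝ := fun u => (deriv (deriv χ) u * u ^ m + deriv χ u * (m * u ^ (m - 1))) +
    (deriv χ u * (m * u ^ (m - 1)) + χ u * (m * ((m - 1 : ℕ) * u ^ (m - 1 - 1)))) with hH2
  have hχd : ∀ u, HasDerivAt χ (deriv χ u) u := fun u =>
    (hχ.1.differentiable (by simp)).differentiableAt.hasDerivAt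
  have hχd1 : ∀ u, HasDerivAt (deriv χ) (deriv (deriv χ) u) u := fun u =>
    (hd1.differentiable (by simp)).differentiableAt.hasDerivAt
  have hD0 : ∀ u, HasDerivAt H0 (H1 u) u := fun u => (hχd u).mul (hasDerivAt_pow m u)
  have hD1 : ∀ u, HasDerivAt H1 (H2 u) u := fun u =>
    ((hχd1 u).mul (hasDerivAt_pow m u)).add
      ((hχd u).mul ((hasDerivAt_pow (m - 1) u).const_mul (m : ℝ)))
  have hInt : ∀ {H : ℝ → ℝ} {B : ℝ}, Continuous H → (∀ u, u ∉ Icc (1 / 2 : ℝ) 4 → H u = 0) →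
      (∀ u ∈ Icc (1 / 2 : ℝ) 4, |H u| ≤ B) →
      Integrable (fun u => (H u : ℂ)) ∧ ∀ τ, ‖𝓕 (fun u => (H u : ℂ)) τ‖ ≤ 4 * B := by
    intro H B hc hz hb
    have hi : Integrable H := hc.integrable_of_hasCompactSupport
      (HasCompactSupport.of_support_subset_isCompact isCompact_Icc fun u hu =>
        by_contra fun h => hu (hz u h))
    refine ⟨hi.ofReal, fun τ => ?_⟩
    have hB : 0 ≤ B := (abs_nonneg _).trans (hb 1 (by norm_num))
    rw [Real.fourier_eq]
    refine (norm_integral_le_integral_norm _).trans ?_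
    simp only [Circle.norm_smul, Complex.norm_real, Real.norm_eq_abs]
    rw [← setIntegral_eq_integral_of_forall_compl_eq_zero (s := Icc (1 / 2 : ℝ) 4)
      fun u hu => by rw [hz u hu, abs_zero]]
    refine (setIntegral_mono_on hi.abs.integrableOn (integrableOn_const (by simp))
      measurableSet_Icc hb).trans ?_
    rw [setIntegral_const, smul_eq_mul, Measure.real, Real.volume_Icc,
      ENNReal.toReal_ofReal (by norm_num)]
    gcongr
    norm_num
  have hpow : ∀ u ∈ Icc (1 / 2 : ℝ) 4, ∀ k ≤ m, |u ^ k| ≤ 4 ^ m := fun u hu k hk => by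
    rw [abs_of_nonneg (pow_nonneg (by linarith [hu.1]) _)]
    exact (pow_le_pow_left₀ (by linarith [hu.1]) hu.2 k).trans
      (pow_le_pow_right₀ (by norm_num) hk)
  have hχc := hχ.1.continuous
  have hχc1 := hd1.continuous
  have hχc2 := hd2.continuous
  have hm0 : (0 : ℝ) ≤ m := Nat.cast_nonneg m
  have hm1 : ((m - 1 : ℕ) : ℝ) ≤ m := by exact_mod_cast Nat.sub_le m 1
  obtain ⟨hi0, hb0⟩ := hInt (H := H0) (B := M * 4 ^ m) (by fun_prop)
    (fun u hu => by simp [hH0, hs0 u hu]) fun u hu => by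
      rw [hH0, abs_mul]
      exact mul_le_mul (hM0 u) (hpow u hu m le_rfl) (abs_nonneg _) (by positivity)
  obtain ⟨hi1, -⟩ := hInt (H := H1) (B := M * 4 ^ m + M * (m * 4 ^ m)) (by fun_prop)
    (fun u hu => by simp [hH1, hs0 u hu, hs1 u hu]) fun u hu => by
      refine (abs_add_le _ _).trans ?_
      rw [abs_mul, abs_mul, abs_mul, Nat.abs_cast]
      gcongr
      · exact hM1 u
      · exact hpow u hu m le_rfl
      · exact hM0 u
      · exact hpow u hu _ (by omega)
  obtain ⟨hi2, hb2⟩ := hInt (H := H2)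
    (B := (M * 4 ^ m + M * (m * 4 ^ m)) + (M * (m * 4 ^ m) + M * (m * (m * 4 ^ m)))) (by fun_prop)
    (fun u hu => by simp [hH2, hs0 u hu, hs1 u hu, hs2 u hu]) fun u hu => by
      refine (abs_add_le _ _).trans
        (add_le_add ((abs_add_le _ _).trans ?_) ((abs_add_le _ _).trans ?_))
      · rw [abs_mul, abs_mul, abs_mul, Nat.abs_cast]
        gcongr
        · exact hM2 u
        · exact hpow u hu m le_rfl
        · exact hM1 u
        · exact hpow u hu _ (by omega)
      · rw [abs_mul, abs_mul, abs_mul, abs_mul, abs_mul, Nat.abs_cast, Nat.abs_cast]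
        gcongr
        · exact hM1 u
        · exact hpow u hu _ (by omega)
        · exact hM0 u
        · exact hpow u hu _ (by omega)
  have hd0' : deriv (fun u => (H0 u : ℂ)) = fun u => (H1 u : ℂ) :=
    funext fun u => (hD0 u).ofReal_comp.deriv
  have hd1' : deriv (fun u => (H1 u : ℂ)) = fun u => (H2 u : ℂ) :=
    funext fun u => (hD1 u).ofReal_comp.deriv
  have hF1 := Real.fourier_deriv hi0 (fun u => (hD0 u).ofReal_comp.differentiableAt)
    (hd0' ▸ hi1)
  have hF2 := Real.fourier_deriv hi1 (fun u => (hD1 u).ofReal_comp.differentiableAt)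
    (hd1' ▸ hi2)
  rw [hd0'] at hF1
  rw [hd1', hF1] at hF2
  have hP : (0 : ℝ) < 4 ^ m := by positivity
  constructor
  · refine (hb0 τ).trans ?_
    have : (1 : ℝ) ≤ (m + 1) ^ 2 := one_le_pow₀ (by linarith)
    calc 4 * (M * 4 ^ m) = 4 * M * (1 * 4 ^ m) := by ring
      _ ≤ _ := by gcongr
  · have h3 : ‖𝓕 (fun u => (H2 u : ℂ)) τ‖ = (2 * Real.pi) ^ 2 *
        (τ ^ 2 * ‖𝓕 (fun u => (H0 u : ℂ)) τ‖) := by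
      rw [hF2]
      simp only [norm_smul, norm_mul, Complex.norm_real, Complex.norm_I, Complex.norm_ofNat,
        Real.norm_eq_abs, abs_of_pos Real.pi_pos]
      rw [← sq_abs τ]
      ring
    have h4 : (1 : ℝ) ≤ (2 * Real.pi) ^ 2 := one_le_pow₀ (by linarith [Real.two_le_pi])
    calc τ ^ 2 * ‖𝓕 (fun u => (H0 u : ℂ)) τ‖
        ≤ (2 * Real.pi) ^ 2 * (τ ^ 2 * ‖𝓕 (fun u => (H0 u : ℂ)) τ‖) :=
          le_mul_of_one_le_left (by positivity) h4
      _ = ‖𝓕 (fun u => (H2 u : ℂ)) τ‖ := h3.symm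
      _ ≤ _ := (hb2 τ).trans (le_of_eq (by ring))

/-- Besov bound for a power series in `u`, localised by `χ`. -/
theorem exists_besovNorm_powerSeries_le {ψ χ : ℝ → ℝ} (hψ : IsLPCutoff ψ) (hχ : IsChiCutoff χ)
    {r : ℝ} (hr : 2 ≤ r) :
    ∃ C > (0 : ℝ), ∀ {a : ℕ → ℂ} {T : ℝ → ℂ},
      Summable (fun m : ℕ => (m + 1 : ℝ) ^ 2 * 4 ^ m * ‖a m‖) →
      (∀ u : ℝ, |u| ≤ 4 → HasSum (fun m : ℕ => a m * ((u : ℂ) ^ m)) (T u)) →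
      besovNorm ψ r (fun u => (χ u : ℂ) * T u) ≤
        ENNReal.ofReal (C * ∑' m : ℕ, (m + 1 : ℝ) ^ 2 * 4 ^ m * ‖a m‖) := by
  obtain ⟨C₁, hC₁, h₁⟩ := exists_besovNorm_le hψ hr
  obtain ⟨C₂, hC₂, h₂⟩ := hχ.exists_fourier_mul_pow_le
  refine ⟨C₁ * C₂, by positivity, fun {a T} hs hT => ?_⟩
  have hcont : ∀ m : ℕ, Continuous fun u : ℝ => χ u * u ^ m := fun m => by
    have := hχ.1.continuous
    fun_prop
  have hInt : ∀ m : ℕ, Integrable fun u : ℝ => ((χ u * u ^ m : ℝ) : ℂ) := fun m =>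
    ((hcont m).integrable_of_hasCompactSupport hχ.hasCompactSupport.mul_right).ofReal
  have hL1 : ∀ m : ℕ, ∫ u, |χ u * u ^ m| ≤ 4 * 4 ^ m := fun m => by
    have hb : ∀ u : ℝ, |χ u * u ^ m| ≤ (Icc (1 / 2 : ℝ) 4).indicator (fun _ => (4 : ℝ) ^ m) u := by
      intro u
      rcases eq_or_ne (χ u) 0 with h | h
      · rw [h, zero_mul, abs_zero]
        exact indicator_nonneg (fun _ _ => by positivity) u
      · rw [indicator_of_mem (hχ.2.2.1 u h), abs_mul, abs_pow,
          abs_of_nonneg (hχ.2.1 u).1]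
        exact (mul_le_of_le_one_left (by positivity) (hχ.2.1 u).2).trans
          (pow_le_pow_left₀ (abs_nonneg _) (hχ.abs_le_four h) m)
    have hI : Integrable ((Icc (1 / 2 : ℝ) 4).indicator fun _ => (4 : ℝ) ^ m) :=
      (integrable_indicator_iff measurableSet_Icc).2 (integrableOn_const (by simp))
    refine (integral_mono_of_nonneg (ae_of_all _ fun u => abs_nonneg _) hI
      (ae_of_all _ hb)).trans ?_
    rw [integral_indicator_const _ measurableSet_Icc, smul_eq_mul, Measure.real, Real.volume_Icc,
      ENNReal.toReal_ofReal (by norm_num)]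
    gcongr
    norm_num
  have hF : ∀ τ : ℝ, HasSum (fun m => a m * 𝓕 (fun u : ℝ => ((χ u * u ^ m : ℝ) : ℂ)) τ)
      (𝓕 (fun u => (χ u : ℂ) * T u) τ) := fun τ => by
    have hnorm : ∀ m (u : ℝ), ‖Real.fourierChar (-inner ℝ u τ) •
        (a m * ((χ u * u ^ m : ℝ) : ℂ))‖ = ‖a m‖ * |χ u * u ^ m| := fun m u => by
      rw [Circle.norm_smul, norm_mul, Complex.norm_real, Real.norm_eq_abs]
    have := hasSum_integral_of_summable_integral_norm (μ := (volume : Measure ℝ))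
      (F := fun (m : ℕ) (u : ℝ) => Real.fourierChar (-inner ℝ u τ) •
        (a m * ((χ u * u ^ m : ℝ) : ℂ))) (fun m => ?_) ?_
    · have e₁ : (fun m => a m * 𝓕 (fun u : ℝ => ((χ u * u ^ m : ℝ) : ℂ)) τ) = fun m =>
          ∫ u, Real.fourierChar (-inner ℝ u τ) • (a m * ((χ u * u ^ m : ℝ) : ℂ)) := by
        funext m
        rw [Real.fourier_eq, ← integral_const_mul]
        refine integral_congr_ae (ae_of_all _ fun u => ?_)
        simp only [mul_smul_comm]
      have e₂ : 𝓕 (fun u => (χ u : ℂ) * T u) τ =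
          ∫ u, ∑' m, Real.fourierChar (-inner ℝ u τ) • (a m * ((χ u * u ^ m : ℝ) : ℂ)) := by
        rw [Real.fourier_eq]
        refine integral_congr_ae (ae_of_all _ fun u => ?_)
        simp only []
        rcases eq_or_ne (χ u) 0 with h | h
        · simp [h]
        · have h3 := ((hT u (hχ.abs_le_four h)).mul_left (χ u : ℂ)).const_smul
            (Real.fourierChar (-inner ℝ u τ))
          rw [← h3.tsum_eq]
          refine tsum_congr fun m => ?_
          push_cast
          congr 1; ring
      rw [e₁, e₂]
      exact this
    · exact (Real.fourierIntegral_convergent_iff τ).2 ((hInt m).const_mul (a m))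
    · simp only [hnorm, integral_const_mul]
      refine Summable.of_nonneg_of_le (fun m => mul_nonneg (norm_nonneg _)
        (integral_nonneg fun u => abs_nonneg _)) (fun m => ?_) (hs.mul_left 4)
      have : (1 : ℝ) ≤ (m + 1 : ℝ) ^ 2 := one_le_pow₀ (by linarith [Nat.cast_nonneg (α := ℝ) m])
      calc _ ≤ ‖a m‖ * (4 * 4 ^ m) := by gcongr; exact hL1 m
        _ = 4 * (1 * 4 ^ m * ‖a m‖) := by ring
        _ ≤ _ := by gcongr
  set S := ∑' m : ℕ, (m + 1 : ℝ) ^ 2 * 4 ^ m * ‖a m‖ with hS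
  rw [mul_assoc]
  refine h₁ (fun τ => ?_) fun τ => ?_
  · rw [← (hF τ).tsum_eq]
    refine tsum_of_norm_bounded (hs.hasSum.mul_left C₂) fun m => ?_
    rw [norm_mul]
    calc _ ≤ ‖a m‖ * (C₂ * ((m + 1) ^ 2 * 4 ^ m)) := by gcongr; exact (h₂ m τ).1
      _ = _ := by ring
  · have h3 := ((hF τ).mul_left ((τ ^ 2 : ℝ) : ℂ)).tsum_eq
    have h4 : τ ^ 2 * ‖𝓕 (fun u => (χ u : ℂ) * T u) τ‖ =
        ‖((τ ^ 2 : ℝ) : ℂ) * 𝓕 (fun u => (χ u : ℂ) * T u) τ‖ := by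
      rw [norm_mul, Complex.norm_real, Real.norm_of_nonneg (sq_nonneg τ)]
    rw [h4, ← h3]
    refine tsum_of_norm_bounded (hs.hasSum.mul_left C₂) fun m => ?_
    rw [norm_mul, norm_mul, Complex.norm_real, Real.norm_of_nonneg (sq_nonneg τ)]
    calc _ = ‖a m‖ * (τ ^ 2 * ‖𝓕 (fun u : ℝ => ((χ u * u ^ m : ℝ) : ℂ)) τ‖) := by ring
      _ ≤ ‖a m‖ * (C₂ * ((m + 1) ^ 2 * 4 ^ m)) := by exact mul_le_mul_of_nonneg_left (h₂ m τ).2 (norm_nonneg _)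
      _ = _ := by ring

theorem summable_add_one_pow_three_mul_pow_div_factorial {x : ℝ} (hx : 0 ≤ x) :
    Summable fun m : ℕ => (m + 1 : ℝ) ^ 3 * x ^ m / m.factorial := by
  refine Summable.of_nonneg_of_le (fun m => by positivity) (fun m => ?_)
    (Real.summable_pow_div_factorial (8 * x))
  have h1 : (m + 1 : ℝ) ≤ 2 ^ m := by exact_mod_cast Nat.lt_two_pow_self
  have h2 : (m + 1 : ℝ) ^ 3 ≤ 8 ^ m := by
    calc (m + 1 : ℝ) ^ 3 ≤ (2 ^ m) ^ 3 := by gcongr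
      _ = 8 ^ m := by rw [← pow_mul, mul_comm, pow_mul]; norm_num
  rw [mul_pow]
  gcongr

theorem norm_phaseKernel_le {n : ℕ} {Γ : ℝ → ℝ} (hΓ : IsGammaU Γ) {K : Rn n → ℝ} {ψ : ℝ → ℝ}
    {j l : ℤ} {D : ℝ} (hD : ∀ t : Rn n, ψ ((2 : ℝ) ^ (-(l + kstar Γ j)) * ‖t‖) ≠ 0 →
      (2 : ℝ) ^ j * Γ ‖t‖ ≤ D) (m : ℕ) (t : Rn n) :
    |phaseKernel Γ K ψ j l m t| ≤ D ^ m * |phaseKernel Γ K ψ j l 0 t| := by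
  unfold phaseKernel
  rw [pow_zero, one_mul, abs_mul, abs_pow]
  rcases eq_or_ne (ψ ((2 : ℝ) ^ (-(l + kstar Γ j)) * ‖t‖)) 0 with h | h
  · rw [h, zero_mul, abs_zero, mul_zero, mul_zero]
  · have h1 : 0 ≤ Γ ‖t‖ := hΓ.nonneg (norm_nonneg t)
    rw [abs_of_nonneg (by positivity)]
    gcongr
    exact hD t h

/-- Taylor expansion of `T_{j,l}[u]` in powers of `u`. -/
theorem hasSum_Tjl {n : ℕ} {Γ : ℝ → ℝ} (hΓ : IsGammaU Γ) {K : Rn n → ℝ} {ψ : ℝ → ℝ}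
    {j l : ℤ} {D : ℝ}
    (hD : ∀ t : Rn n, ψ ((2 : ℝ) ^ (-(l + kstar Γ j)) * ‖t‖) ≠ 0 → (2 : ℝ) ^ j * Γ ‖t‖ ≤ D)
    {f : Rn n → ℂ} {x : Rn n}
    (hInt : ∀ m, Integrable fun t => f (x - t) * (phaseKernel Γ K ψ j l m t : ℂ)) (u : ℝ) :
    HasSum (fun m : ℕ => Complex.I ^ (m + 1) / (m + 1).factorial *
      bumpConv (phaseKernel Γ K ψ j l (m + 1)) f x * (u : ℂ) ^ (m + 1)) (Tjl Γ K ψ j l u f x) := by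
  have key := hasSum_integral_of_summable_integral_norm (μ := (volume : Measure (Rn n)))
    (F := fun (m : ℕ) (t : Rn n) => Complex.I ^ (m + 1) / (m + 1).factorial * (u : ℂ) ^ (m + 1) *
      (f (x - t) * (phaseKernel Γ K ψ j l (m + 1) t : ℂ)))
    (fun m => (hInt (m + 1)).const_mul _) ?_
  · have e₁ : (fun m : ℕ => Complex.I ^ (m + 1) / (m + 1).factorial *
        bumpConv (phaseKernel Γ K ψ j l (m + 1)) f x * (u : ℂ) ^ (m + 1)) = fun m : ℕ =>
        ∫ t, Complex.I ^ (m + 1) / (m + 1).factorial * (u : ℂ) ^ (m + 1) *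
          (f (x - t) * (phaseKernel Γ K ψ j l (m + 1) t : ℂ)) := by
      funext m
      rw [integral_const_mul, bumpConv]
      ring
    have e₂ : Tjl Γ K ψ j l u f x = ∫ t, ∑' m : ℕ,
        Complex.I ^ (m + 1) / (m + 1).factorial * (u : ℂ) ^ (m + 1) *
          (f (x - t) * (phaseKernel Γ K ψ j l (m + 1) t : ℂ)) := by
      unfold Tjl
      refine integral_congr_ae (ae_of_all _ fun t => ?_)
      simp only []
      have h1 := NormedSpace.expSeries_div_hasSum_exp
        (Complex.I * Complex.ofReal ((2 : ℝ) ^ j * u * Γ ‖t‖))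
      rw [← hasSum_nat_add_iff' 1, ← Complex.exp_eq_exp_ℂ] at h1
      simp only [Finset.range_one, Finset.sum_singleton, pow_zero, Nat.factorial_zero,
        Nat.cast_one, div_one] at h1
      have h2 := (h1.mul_left (f (x - t))).mul_right
        (Complex.ofReal (ψ ((2 : ℝ) ^ (-(l + kstar Γ j)) * ‖t‖) * K t))
      rw [← h2.tsum_eq]
      refine tsum_congr fun m => ?_
      unfold phaseKernel
      push_cast
      ring
    rw [e₁, e₂]
    exact key
  · have hs : Summable fun m : ℕ => (|u| * D) ^ (m + 1) / (m + 1).factorial :=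
      (summable_nat_add_iff 1).2 (Real.summable_pow_div_factorial (|u| * D))
    refine Summable.of_nonneg_of_le (fun m => integral_nonneg fun t => norm_nonneg _) (fun m => ?_)
      (hs.mul_right (∫ t, ‖f (x - t) * (phaseKernel Γ K ψ j l 0 t : ℂ)‖))
    rw [← integral_const_mul]
    refine integral_mono ((hInt (m + 1)).const_mul _).norm ((hInt 0).norm.const_mul _) fun t => ?_
    simp only [norm_mul, norm_div, norm_pow, Complex.norm_I, one_pow, Complex.norm_natCast,
      Complex.norm_real, Real.norm_eq_abs]
    calc _ ≤ 1 / ((m + 1).factorial : ℝ) * |u| ^ (m + 1) *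
          (‖f (x - t)‖ * (D ^ (m + 1) * |phaseKernel Γ K ψ j l 0 t|)) := by
          gcongr
          exact norm_phaseKernel_le hΓ hD (m + 1) t
      _ = _ := by rw [mul_pow]; ring

theorem norm_bumpConv_phaseKernel_le {n : ℕ} {Γ : ℝ → ℝ} (hΓ : IsGammaU Γ) {K : Rn n → ℝ}
    {ψ : ℝ → ℝ} {j l : ℤ} {D : ℝ}
    (hD : ∀ t : Rn n, ψ ((2 : ℝ) ^ (-(l + kstar Γ j)) * ‖t‖) ≠ 0 → (2 : ℝ) ^ j * Γ ‖t‖ ≤ D)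
    {f : Rn n → ℂ} {x : Rn n}
    (hInt : ∀ m, Integrable fun t => f (x - t) * (phaseKernel Γ K ψ j l m t : ℂ)) (m : ℕ) :
    ‖bumpConv (phaseKernel Γ K ψ j l m) f x‖ ≤
      D ^ m * ∫ t, ‖f (x - t) * (phaseKernel Γ K ψ j l 0 t : ℂ)‖ := by
  rw [← integral_const_mul]
  refine (norm_integral_le_integral_norm _).trans
    (integral_mono (hInt m).norm ((hInt 0).norm.const_mul _) fun t => ?_)
  simp only [norm_mul, Complex.norm_real, Real.norm_eq_abs]
  calc _ ≤ ‖f (x - t)‖ * (D ^ m * |phaseKernel Γ K ψ j l 0 t|) := by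
        gcongr
        exact norm_phaseKernel_le hΓ hD m t
    _ = _ := by ring

/-- Separation of variables: the Besov norm in `u` is dominated by a weighted sum of
convolutions that do not depend on `u`. -/
theorem exists_besovNorm_Tjl_le {n : ℕ} (hn : n ≠ 0) {Γ : ℝ → ℝ} (hΓ : IsGammaU Γ)
    {K : Rn n → ℝ} (hK : IsHomCZKernel n K) {ψ χ : ℝ → ℝ} (hψ : IsLPCutoff ψ)
    (hχ : IsChiCutoff χ) {r : ℝ} (hr : 2 ≤ r) :
    ∃ C > (0 : ℝ), ∀ l : ℤ, l ≤ 0 → ∀ (j : ℤ) {f : Rn n → ℂ}, Continuous f → ∀ x,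
      besovNorm ψ r (fun u => (χ u : ℂ) * Tjl Γ K ψ j l u f x) ≤
        ∑' m : ℕ, ENNReal.ofReal (C * ((m + 2 : ℝ) ^ 2 * 4 ^ (m + 1) / (m + 1).factorial)) *
          ‖bumpConv (phaseKernel Γ K ψ j l (m + 1)) f x‖ₑ := by
  obtain ⟨C, hC, h⟩ := exists_besovNorm_powerSeries_le hψ hχ hr
  obtain ⟨c, hc, D, hD, hphase⟩ := hΓ.exists_phase_le
  obtain ⟨_, _, _, _, _, _, hker⟩ := exists_isBumpKernel_phaseKernel hn hΓ hK hψ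
  refine ⟨C, hC, fun l hl j f hf x => ?_⟩
  have hInt : ∀ m, Integrable fun t => f (x - t) * (phaseKernel Γ K ψ j l m t : ℂ) :=
    fun m => (hker l hl j m).integrable_mul hf x
  have hDt : ∀ t : Rn n, ψ ((2 : ℝ) ^ (-(l + kstar Γ j)) * ‖t‖) ≠ 0 →
      (2 : ℝ) ^ j * Γ ‖t‖ ≤ D := fun t ht => by
    have h1 := (hψ.2.2.1 _ ht).2
    rw [abs_of_nonneg (by positivity)] at h1
    have h2 := hphase l j hl _ (by positivity) h1
    rw [← mul_assoc, ← zpow_add₀ two_ne_zero, add_neg_cancel, zpow_zero, one_mul] at h2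
    refine h2.trans (mul_le_of_le_one_right hD.le ?_)
    refine Real.rpow_le_one_of_one_le_of_nonpos (by norm_num) ?_
    exact mul_nonpos_of_nonneg_of_nonpos hc.le (by exact_mod_cast hl)
  set b : ℕ → ℂ := fun m => bumpConv (phaseKernel Γ K ψ j l m) f x with hb
  set a : ℕ → ℂ := fun m => if m = 0 then 0 else Complex.I ^ m / m.factorial * b m with ha
  have ha0 : a 0 = 0 := by simp [ha]
  have ha1 : ∀ m, a (m + 1) = Complex.I ^ (m + 1) / (m + 1).factorial * b (m + 1) := fun m => by
    simp [ha]
  have hna : ∀ m, (((m + 1 : ℕ) : ℝ) + 1) ^ 2 * 4 ^ (m + 1) * ‖a (m + 1)‖ =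
      (m + 2 : ℝ) ^ 2 * 4 ^ (m + 1) / (m + 1).factorial * ‖b (m + 1)‖ := fun m => by
    rw [ha1, norm_mul, norm_div, norm_pow, Complex.norm_I, one_pow, Complex.norm_natCast]
    push_cast
    ring
  set I₀ := ∫ t, ‖f (x - t) * (phaseKernel Γ K ψ j l 0 t : ℂ)‖
  have hI₀ : 0 ≤ I₀ := integral_nonneg fun t => norm_nonneg _
  have hs : Summable fun m : ℕ => (m + 1 : ℝ) ^ 2 * 4 ^ m * ‖a m‖ := by
    refine Summable.of_nonneg_of_le (fun m => by positivity) (fun m => ?_)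
      ((summable_add_one_pow_three_mul_pow_div_factorial (x := 4 * D) (by positivity)).mul_right I₀)
    have hna' : ‖a m‖ ≤ 1 / m.factorial * (D ^ m * I₀) := by
      rcases Nat.eq_zero_or_pos m with rfl | hm
      · rw [ha0, norm_zero]; positivity
      · simp only [ha, hm.ne', if_false]
        rw [norm_mul, norm_div, norm_pow, Complex.norm_I, one_pow, Complex.norm_natCast]
        gcongr
        exact norm_bumpConv_phaseKernel_le hΓ hDt hInt m
    have hm1 : (m + 1 : ℝ) ^ 2 ≤ (m + 1) ^ 3 :=
      pow_le_pow_right₀ (by linarith [Nat.cast_nonneg (α := ℝ) m]) (by norm_num)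
    calc _ ≤ (m + 1 : ℝ) ^ 3 * 4 ^ m * (1 / m.factorial * (D ^ m * I₀)) := by gcongr
      _ = _ := by rw [mul_pow]; ring
  have hT : ∀ u : ℝ, |u| ≤ 4 → HasSum (fun m : ℕ => a m * (u : ℂ) ^ m) (Tjl Γ K ψ j l u f x) :=
    fun u _ => by
      rw [← hasSum_nat_add_iff' 1]
      simpa [ha0, ha1] using hasSum_Tjl hΓ hDt hInt u
  refine (h hs hT).trans (le_of_eq ?_)
  rw [hs.tsum_eq_zero_add, ha0, norm_zero, mul_zero, zero_add, ← tsum_mul_left,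
    ENNReal.ofReal_tsum_of_nonneg (fun m => by positivity)
      (((summable_nat_add_iff 1).2 hs).mul_left C)]
  refine tsum_congr fun m => ?_
  rw [hna, ← mul_assoc, ENNReal.ofReal_mul (by positivity), ofReal_norm]

/-- Minkowski's inequality for countable sums. -/
theorem lintegral_Lp_tsum_le {α : Type*} [MeasurableSpace α] {μ : Measure α} {p : ℝ} (hp : 1 ≤ p)
    {f : ℕ → α → ℝ≥0∞} (hf : ∀ m, Measurable (f m)) :
    (∫⁻ a, (∑' m, f m a) ^ p ∂μ) ^ (1 / p) ≤ ∑' m, (∫⁻ a, f m a ^ p ∂μ) ^ (1 / p) := by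
  have hp0 : 0 < p := by linarith
  have hfin : ∀ N, (∫⁻ a, (∑ m ∈ Finset.range N, f m a) ^ p ∂μ) ^ (1 / p) ≤
      ∑ m ∈ Finset.range N, (∫⁻ a, f m a ^ p ∂μ) ^ (1 / p) := fun N => by
    induction N with
    | zero => simp [hp0]
    | succ N ih =>
      simp only [Finset.sum_range_succ]
      exact (ENNReal.lintegral_Lp_add_le
        (Finset.measurable_fun_sum _ fun m _ => hf m).aemeasurable (hf N).aemeasurable hp).trans
        (add_le_add_left ih _)
  have hmono : Monotone fun N => fun a => (∑ m ∈ Finset.range N, f m a) ^ p := fun N N' h a =>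
    ENNReal.rpow_le_rpow (Finset.sum_le_sum_of_subset (Finset.range_mono h)) hp0.le
  have h1 : ∀ a, (∑' m, f m a) ^ p = ⨆ N, (∑ m ∈ Finset.range N, f m a) ^ p := fun a => by
    rw [ENNReal.tsum_eq_iSup_nat]
    exact (ENNReal.orderIsoRpow p hp0).map_iSup _
  simp only [h1]
  rw [lintegral_iSup (fun N => (Finset.measurable_fun_sum _ fun m _ => hf m).pow_const p) hmono]
  refine ((ENNReal.orderIsoRpow (1 / p) (by positivity)).map_iSup _).trans_le (iSup_le fun N => ?_)
  exact (hfin N).trans (ENNReal.sum_le_tsum _)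

theorem tsum_rpow_tsum_le {ι : Type*} {p : ℝ} (hp : 1 ≤ p) (f : ℕ → ι → ℝ≥0∞) :
    (∑' j, (∑' m, f m j) ^ p) ^ (1 / p) ≤ ∑' m, (∑' j, f m j ^ p) ^ (1 / p) := by
  let _ : MeasurableSpace ι := ⊤
  have := lintegral_Lp_tsum_le (μ := Measure.count) hp (f := f) fun m => measurable_from_top
  simpa only [lintegral_count] using this

/-- `ℓ² ⊆ ℓ^r` for `r ≥ 2`. -/
theorem tsum_rpow_le_tsum_rpow_two {ι : Type*} {r : ℝ} (hr : 2 ≤ r) (a : ι → ℝ≥0∞) :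
    (∑' j, a j ^ r) ^ (1 / r) ≤ (∑' j, a j ^ (2 : ℝ)) ^ (1 / (2 : ℝ)) := by
  set S := (∑' j, a j ^ (2 : ℝ)) ^ (1 / (2 : ℝ)) with hS
  have hS2 : ∑' j, a j ^ (2 : ℝ) = S ^ (2 : ℝ) := by
    rw [hS, ← ENNReal.rpow_mul]; norm_num
  have hle : ∀ j, a j ≤ S := fun j => by
    rw [hS, one_div, ENNReal.le_rpow_inv_iff two_pos]
    exact ENNReal.le_tsum j
  rw [one_div, ENNReal.rpow_inv_le_iff (by linarith)]
  calc ∑' j, a j ^ r ≤ ∑' j, S ^ (r - 2) * a j ^ (2 : ℝ) := by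
        refine ENNReal.tsum_le_tsum fun j => ?_
        calc a j ^ r = a j ^ (r - 2) * a j ^ (2 : ℝ) := by
              rw [← ENNReal.rpow_add_of_nonneg _ _ (by linarith) two_pos.le, sub_add_cancel]
          _ ≤ _ := mul_le_mul' (ENNReal.rpow_le_rpow (hle j) (by linarith)) le_rfl
    _ = S ^ r := by
        rw [ENNReal.tsum_mul_left, hS2,
          ← ENNReal.rpow_add_of_nonneg _ _ (by linarith) two_pos.le, sub_add_cancel]

theorem IsBumpKernel.continuous_bumpConv {n : ℕ} {A : ℝ} {σ : ℤ} {k : Rn n → ℝ}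
    (hk : IsBumpKernel A σ k) {f : Rn n → ℂ} (hf : Continuous f) {R : ℝ} (hR : ∀ x, ‖f x‖ ≤ R) :
    Continuous (bumpConv k f) := by
  have hki : Integrable fun t => ((1 : ℂ)) * (k t : ℂ) :=
    hk.integrable_mul (f := fun _ => 1) continuous_const 0
  refine continuous_of_dominated (bound := fun t => R * ‖(1 : ℂ) * (k t : ℂ)‖)
    (fun x => (hk.integrable_mul hf x).1) (fun x => ae_of_all _ fun t => ?_)
    (hki.norm.const_mul R) (ae_of_all _ fun t => ?_)
  · rw [norm_mul, one_mul]
    exact mul_le_mul_of_nonneg_right (hR _) (norm_nonneg _)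
  · fun_prop

/-- Square function estimate over all scales `j`, for the phase kernels of a fixed order. -/
theorem exists_lintegral_tsum_phaseKernel_le {n : ℕ} (hn : n ≠ 0) {Γ : ℝ → ℝ} (hΓ : IsGammaU Γ)
    {K : Rn n → ℝ} (hK : IsHomCZKernel n K) {ψ : ℝ → ℝ} (hψ : IsLPCutoff ψ) {p : ℝ} (hp : 1 < p) :
    ∃ c > (0 : ℝ), ∃ D > (0 : ℝ), ∃ B > (0 : ℝ), ∀ l : ℤ, l ≤ 0 → ∀ (m : ℕ)
      {f : Rn n → ℂ} (_ : Continuous f) (_ : Integrable f) {R : ℝ} (_ : ∀ x, ‖f x‖ ≤ R),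
      (∫⁻ x, (∑' j : ℤ, ‖bumpConv (phaseKernel Γ K ψ j l m) f x‖ₑ ^ (2 : ℝ)) ^ (p / 2)) ^ (1 / p) ≤
        ENNReal.ofReal (B * (m + 1) * (D * 2 ^ (c * l)) ^ m) *
          eLpNorm f (ENNReal.ofReal p) volume := by
  obtain ⟨c, hc, D, hD, B, hB, hker⟩ := exists_isBumpKernel_phaseKernel hn hΓ hK hψ
  obtain ⟨M, hM⟩ := hΓ.exists_card_kstar_le
  obtain ⟨C, hC⟩ := exists_lintegral_square_function_le hn M hp
  have hp0 : 0 < p := by linarith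
  set C' : ℝ := (C : ℝ) ^ (1 / p) + 1
  have hC' : 0 < C' := by positivity
  refine ⟨c, hc, D, hD, C' * B, by positivity, fun l hl m {f} hf hfi R hR => ?_⟩
  set A : ℝ := B * (m + 1) * (D * 2 ^ (c * l)) ^ m with hA
  have hA0 : 0 < A := by positivity
  have hmeas : ∀ j : ℤ, Measurable fun x => ‖bumpConv (phaseKernel Γ K ψ j l m) f x‖ₑ ^ (2 : ℝ) :=
    fun j => ((hker l hl j m).continuous_bumpConv hf hR).measurable.enorm.pow_const _
  have hp2 : 0 < p / 2 := by positivity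
  have h1 : ∀ x, (∑' j : ℤ, ‖bumpConv (phaseKernel Γ K ψ j l m) f x‖ₑ ^ (2 : ℝ)) ^ (p / 2) =
      ⨆ J : Finset ℤ, (∑ j ∈ J, ‖bumpConv (phaseKernel Γ K ψ j l m) f x‖ₑ ^ (2 : ℝ)) ^ (p / 2) :=
    fun x => by
      rw [ENNReal.tsum_eq_iSup_sum]
      exact (ENNReal.orderIsoRpow (p / 2) hp2).map_iSup _
  have h2 : ∫⁻ x, (∑' j : ℤ, ‖bumpConv (phaseKernel Γ K ψ j l m) f x‖ₑ ^ (2 : ℝ)) ^ (p / 2) ≤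
      C * ENNReal.ofReal A ^ p * ∫⁻ x, ‖f x‖ₑ ^ p := by
    simp only [h1]
    rw [lintegral_iSup_directed_of_measurable
      (fun J => (Finset.measurable_fun_sum _ fun j _ => hmeas j).pow_const _)
      (Monotone.directed_le fun J J' h x =>
        ENNReal.rpow_le_rpow (Finset.sum_le_sum_of_subset h) hp2.le)]
    refine iSup_le fun J => ?_
    have := hC hA0 (σ := fun j : J => l + kstar Γ j)
      (k := fun j : J => phaseKernel Γ K ψ j l m) (fun j => hker l hl j m)
      (fun s => hM J l s) hf hfi hR
    refine le_of_eq_of_le (lintegral_congr fun x => ?_) this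
    rw [Finset.sum_coe_sort J fun j => ‖bumpConv (phaseKernel Γ K ψ j l m) f x‖ₑ ^ (2 : ℝ)]
  rw [eLpNorm_eq_lintegral_rpow_enorm_toReal (by simpa using hp0) ENNReal.ofReal_ne_top,
    ENNReal.toReal_ofReal hp0.le]
  have h3 : C' * B * (m + 1) * (D * 2 ^ (c * l)) ^ m = C' * A := by rw [hA]; ring
  calc _ ≤ (C * ENNReal.ofReal A ^ p * ∫⁻ x, ‖f x‖ₑ ^ p) ^ (1 / p) :=
        ENNReal.rpow_le_rpow h2 (by positivity)
    _ = (C : ℝ≥0∞) ^ (1 / p) * ENNReal.ofReal A * (∫⁻ x, ‖f x‖ₑ ^ p) ^ (1 / p) := by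
        rw [ENNReal.mul_rpow_of_nonneg _ _ (by positivity),
          ENNReal.mul_rpow_of_nonneg _ _ (by positivity), ← ENNReal.rpow_mul,
          mul_one_div_cancel hp0.ne', ENNReal.rpow_one]
    _ ≤ _ := by
        rw [h3, ENNReal.ofReal_mul hC'.le]
        refine mul_le_mul' (mul_le_mul' ?_ le_rfl) le_rfl
        rw [← ENNReal.ofReal_coe_nnreal, ENNReal.ofReal_rpow_of_nonneg C.coe_nonneg (by positivity)]
        exact ENNReal.ofReal_le_ofReal (by simp [C'])

/-- Lemma 5.1. -/
theorem Tjl_besov_estimate (n : ℕ) (hn : 2 ≤ n) (Γ : ℝ → ℝ) (hΓ : IsGammaU Γ)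
    (K : Rn n → ℝ) (hK : IsHomCZKernel n K) (ψ : ℝ → ℝ) (hψ : IsLPCutoff ψ)
    (χ : ℝ → ℝ) (hχ : IsChiCutoff χ) (p r : ℝ) (hp : 1 < p) (hr : 2 ≤ r) :
    ∃ ε > (0 : ℝ), ∃ C > (0 : ℝ), ∀ l : ℤ, l ≤ 0 → ∀ f : SchwartzMap (Rn n) ℂ,
      lpNormENN p
          (fun x => (∑' j : ℤ,
            besovNorm ψ r (fun u => Complex.ofReal (χ u) * Tjl Γ K ψ j l u (⇑f) x) ^ r)
              ^ (1 / r)) volume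
        ≤ ENNReal.ofReal (C * (2 : ℝ) ^ (ε * (l : ℝ))) *
            eLpNorm (⇑f) (ENNReal.ofReal p) volume := by
  have hn0 : n ≠ 0 := by omega
  have hp0 : 0 < p := by linarith
  obtain ⟨C, hC, hbesov⟩ := exists_besovNorm_Tjl_le hn0 hΓ hK hψ hχ hr
  obtain ⟨c, hc, D, hD, B, hB, hsq⟩ := exists_lintegral_tsum_phaseKernel_le hn0 hΓ hK hψ hp
  obtain ⟨_, _, _, _, _, _, hker⟩ := exists_isBumpKernel_phaseKernel hn0 hΓ hK hψ
  have hsum : Summable fun m : ℕ => (((m + 1 : ℕ) : ℝ) + 1) ^ 3 * (4 * D) ^ (m + 1) /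
      (m + 1).factorial :=
    (summable_nat_add_iff 1).2
      (summable_add_one_pow_three_mul_pow_div_factorial (x := 4 * D) (by positivity))
  set S : ℝ := ∑' m : ℕ, (((m + 1 : ℕ) : ℝ) + 1) ^ 3 * (4 * D) ^ (m + 1) / (m + 1).factorial with hS
  have hS0 : 0 < S := hsum.tsum_pos (fun m => by positivity) 0 (by positivity)
  refine ⟨c, hc, C * B * S, by positivity, fun l hl f => ?_⟩
  have hf : Continuous f := f.continuous
  have hfi : Integrable f := f.integrable
  obtain ⟨R, -, hR⟩ := f.decay 0 0
  have hR : ∀ x, ‖f x‖ ≤ R := fun x => by simpa using hR x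
  set w : ℕ → ℝ := fun m => C * ((m + 2 : ℝ) ^ 2 * 4 ^ (m + 1) / (m + 1).factorial) with hw
  set F : ℕ → Rn n → ℝ≥0∞ := fun m x =>
    (∑' j : ℤ, ‖bumpConv (phaseKernel Γ K ψ j l (m + 1)) f x‖ₑ ^ (2 : ℝ)) ^ (1 / (2 : ℝ)) with hF
  have hFmeas : ∀ m, Measurable (F m) := fun m =>
    (Measurable.tsum fun j =>
      ((hker l hl j (m + 1)).continuous_bumpConv hf hR).measurable.enorm.pow_const _).pow_const _
  have hpt : ∀ x, (∑' j : ℤ,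
      besovNorm ψ r (fun u => Complex.ofReal (χ u) * Tjl Γ K ψ j l u (⇑f) x) ^ r) ^ (1 / r) ≤
      ∑' m, ENNReal.ofReal (w m) * F m x := fun x => by
    refine (tsum_rpow_le_tsum_rpow_two hr _).trans ?_
    calc _ ≤ (∑' j : ℤ, (∑' m : ℕ, ENNReal.ofReal (w m) *
          ‖bumpConv (phaseKernel Γ K ψ j l (m + 1)) f x‖ₑ) ^ (2 : ℝ)) ^ (1 / (2 : ℝ)) := by
          gcongr with j
          exact hbesov l hl j hf x
      _ ≤ ∑' m : ℕ, (∑' j : ℤ, (ENNReal.ofReal (w m) *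
          ‖bumpConv (phaseKernel Γ K ψ j l (m + 1)) f x‖ₑ) ^ (2 : ℝ)) ^ (1 / (2 : ℝ)) :=
          tsum_rpow_tsum_le one_le_two fun m j =>
            ENNReal.ofReal (w m) * ‖bumpConv (phaseKernel Γ K ψ j l (m + 1)) f x‖ₑ
      _ = _ := by
          refine tsum_congr fun m => ?_
          simp only [ENNReal.mul_rpow_of_nonneg _ _ two_pos.le, ENNReal.tsum_mul_left]
          rw [ENNReal.mul_rpow_of_nonneg _ _ (by norm_num), ← ENNReal.rpow_mul,
            mul_one_div_cancel two_ne_zero, ENNReal.rpow_one]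
  have hterm : ∀ m, (∫⁻ x, (ENNReal.ofReal (w m) * F m x) ^ p) ^ (1 / p) ≤
      ENNReal.ofReal (C * B * 2 ^ (c * l) *
        ((((m + 1 : ℕ) : ℝ) + 1) ^ 3 * (4 * D) ^ (m + 1) / (m + 1).factorial)) *
          eLpNorm f (ENNReal.ofReal p) volume := fun m => by
    have hFp : ∀ x, F m x ^ p =
        (∑' j : ℤ, ‖bumpConv (phaseKernel Γ K ψ j l (m + 1)) f x‖ₑ ^ (2 : ℝ)) ^ (p / 2) :=
      fun x => by rw [hF, ← ENNReal.rpow_mul]; congr 1; ring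
    simp only [ENNReal.mul_rpow_of_nonneg _ _ hp0.le, hFp]
    rw [lintegral_const_mul' _ _ (ENNReal.rpow_ne_top_of_nonneg hp0.le ENNReal.ofReal_ne_top),
      ENNReal.mul_rpow_of_nonneg _ _ (by positivity), ← ENNReal.rpow_mul,
      mul_one_div_cancel hp0.ne', ENNReal.rpow_one]
    refine (mul_le_mul' le_rfl (hsq l hl (m + 1) hf hfi hR)).trans ?_
    rw [← mul_assoc, ← ENNReal.ofReal_mul (by positivity)]
    refine mul_le_mul' (ENNReal.ofReal_le_ofReal ?_) le_rfl
    have h1 : ((2 : ℝ) ^ (c * l)) ^ (m + 1) ≤ 2 ^ (c * l) := by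
      refine pow_le_of_le_one (by positivity) ?_ (Nat.succ_ne_zero m)
      exact Real.rpow_le_one_of_one_le_of_nonpos (by norm_num)
        (mul_nonpos_of_nonneg_of_nonpos hc.le (by exact_mod_cast hl))
    calc w m * (B * (((m + 1 : ℕ) : ℝ) + 1) * (D * 2 ^ (c * l)) ^ (m + 1))
        = C * B * ((2 : ℝ) ^ (c * l)) ^ (m + 1) *
          ((((m + 1 : ℕ) : ℝ) + 1) ^ 3 * (4 * D) ^ (m + 1) / (m + 1).factorial) := by
          simp only [hw]
          push_cast
          ring
      _ ≤ _ := by gcongr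
  calc lpNormENN p _ volume ≤ (∫⁻ x, (∑' m, ENNReal.ofReal (w m) * F m x) ^ p) ^ (1 / p) := by
        unfold lpNormENN
        gcongr with x
        exact hpt x
    _ ≤ ∑' m, (∫⁻ x, (ENNReal.ofReal (w m) * F m x) ^ p) ^ (1 / p) :=
        lintegral_Lp_tsum_le hp.le fun m => (hFmeas m).const_mul _
    _ ≤ _ := ENNReal.tsum_le_tsum hterm
    _ = _ := by
        rw [ENNReal.tsum_mul_right, ← ENNReal.ofReal_tsum_of_nonneg (fun m => by positivity)
          (hsum.mul_left _), tsum_mul_left, ← hS]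
        congr 2
        ring
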